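/- Let v_n be the number of n-quasigroups of order 4 and m_n the number of MDS codes in Σ^n. Then v_n / (3^(n+1)·2^(2^n + 1)) → 1 and m_n / (3^n·2^(2^(n−1) + 1)) → 1 as n → ∞. -/

import Mathlib

/-- The alphabet `Σ = {0,1,2,3}`. -/
abbrev V4 := Fin 4

/-- An `n`-quasigroup of order 4. -/
def IsNQuasigroup {n : ℕ} (f : (Fin n → V4) → V4) : Prop :=
  ∀ (a : Fin n → V4) (i : Fin n) (b : V4),
    ∃! x : V4, f (Function.update a i x) = b

/-- The `k`-edge through `x`: the four vertices obtained from `x` by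
replacing its `k`-th coordinate by each element of `Σ`. -/
def kEdge {n : ℕ} (x : Fin n → V4) (k : Fin n) : Set (Fin n → V4) :=
  {y | ∃ a : V4, y = Function.update x k a}

/-- A (distance 2) MDS code: every edge meets it in exactly one vertex. -/
def IsMDSCode {n : ℕ} (C : Set (Fin n → V4)) : Prop :=
  ∀ (x : Fin n → V4) (k : Fin n), (kEdge x k ∩ C).ncard = 1


namespace QG
open Function
set_option linter.unusedSectionVars false
set_option linter.unusedVariables false

def ps (p : Fin 3) (a : Fin 4) : ZMod 2 :=
  (![![0,1,0,1],![0,0,1,1],![0,1,1,0]] : Fin 3 → Fin 4 → ZMod 2) p a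

lemma z2ne {a b : ZMod 2} : a ≠ b ↔ a = b + 1 := by revert a b; decide
lemma z2c (a : ZMod 2) : a = 0 ∨ a = 1 := by revert a; decide
lemma z2aa (a : ZMod 2) : a + a = 0 := by revert a; decide

/-- a balanced line -/
def Bal (g : Fin 4 → ZMod 2) : Prop := ∃ s c, ∀ a, g a = ps s a + c

lemma ps_ext {a b : Fin 4} {p q : Fin 3} (h : p ≠ q) (h1 : ps p a = ps p b) (h2 : ps q a = ps q b) :
    a = b := by revert a b p q; decide
lemma ps_sep {a b : Fin 4} {p q : Fin 3} (h : p ≠ q) (h1 : ps p a = ps p b) (h2 : a ≠ b) :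
    ps q a = ps q b + 1 := by revert a b p q; decide
lemma ps_sum {p q r : Fin 3} (h : p ≠ q) (h1 : p ≠ r) (h2 : q ≠ r) (a : Fin 4) :
    ps p a + ps q a + ps r a = 0 := by revert a p q r; decide
lemma ps_fac {s t : Fin 3} {c d : ZMod 2} (h : ∀ a, ps s a + c = ps t a + d) : s = t ∧ c = d := by
  revert s t c d; decide
lemma exists_third (p q : Fin 3) : ∃ r, r ≠ p ∧ r ≠ q := by revert p q; decide
lemma fin3_cases {p q r : Fin 3} (h : p ≠ q) (h1 : p ≠ r) (h2 : q ≠ r) (w : Fin 3) :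
    w = p ∨ w = q ∨ w = r := by revert w p q r; decide

lemma bal_perm_aux : ∀ a b c d : Fin 4, a ≠ b → a ≠ c → a ≠ d → b ≠ c → b ≠ d → c ≠ d →
    ∀ p, ∃ s e, ps p a = ps s 0 + e ∧ ps p b = ps s 1 + e ∧ ps p c = ps s 2 + e ∧
      ps p d = ps s 3 + e := by decide
lemma bal_perm {g : Fin 4 → Fin 4} (h : Injective g) (p : Fin 3) : Bal (fun a => ps p (g a)) := by
  obtain ⟨s, e, h0, h1, h2, h3⟩ := bal_perm_aux (g 0) (g 1) (g 2) (g 3)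
    (h.ne (by decide)) (h.ne (by decide)) (h.ne (by decide)) (h.ne (by decide))
    (h.ne (by decide)) (h.ne (by decide)) p
  refine ⟨s, e, fun a => ?_⟩
  fin_cases a <;> assumption

lemma Bal.add {g} (h : Bal g) (d : ZMod 2) : Bal (fun a => g a + d) := by
  obtain ⟨s, c, h⟩ := h
  exact ⟨s, c + d, fun a => by simp only [h]; ring⟩
lemma Bal.ex {g} (h : Bal g) (e : ZMod 2) : ∃ a, g a = e := by
  obtain ⟨s, c, h⟩ := h
  simp only [h]; clear h; revert s c e; decide
lemma Bal.sum {g} (h : Bal g) : g 0 + g 1 + g 2 + g 3 = 0 := by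
  obtain ⟨s, c, h⟩ := h
  simp only [h]; clear h; revert s c; decide
lemma Bal.sum4 {g} (h : Bal g) {a b c d : Fin 4} (h1 : a ≠ b) (h2 : a ≠ c) (h3 : a ≠ d)
    (h4 : b ≠ c) (h5 : b ≠ d) (h6 : c ≠ d) : g a + g b + g c + g d = 0 := by
  obtain ⟨s, e, h⟩ := h
  simp only [h]; clear h; revert s e a b c d; decide
lemma Bal.two {g} (h : Bal g) {a b c : Fin 4} (h1 : a ≠ b) (h2 : a ≠ c)
    (h4 : b ≠ c) (hab : g a = g b) : g c = g a + 1 := by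
  obtain ⟨s, e, h⟩ := h
  simp only [h] at *; clear h; revert s e a b c; decide
lemma Bal.sub {g g'} (h : Bal g) (h' : Bal g') (hs : ∀ a, g a = 1 → g' a = 1) : ∀ a, g a = g' a := by
  obtain ⟨s, e, h⟩ := h
  obtain ⟨s', e', h'⟩ := h'
  simp only [h, h'] at *; clear h h'; revert s e s' e'; decide

section
variable {ι : Type*} [DecidableEq ι]

/-- `x` lies in the section `(B,y)`. -/
def Ag (B : Finset ι) (y x : ι → Fin 4) : Prop := ∀ i, i ∉ B → x i = y i

lemma Ag.refl (B : Finset ι) (y) : Ag B y y := fun _ _ => rfl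
lemma Ag.symm {B : Finset ι} {y x} (h : Ag B y x) : Ag B x y := fun i hi => (h i hi).symm
lemma Ag.trans {B : Finset ι} {y x z} (h : Ag B y x) (h' : Ag B x z) : Ag B y z :=
  fun i hi => (h' i hi).trans (h i hi)
lemma Ag.mono {B B' : Finset ι} {y x} (h : Ag B y x) (hB : B ⊆ B') : Ag B' y x :=
  fun i hi => h i (fun h' => hi (hB h'))
lemma Ag.upd {B : Finset ι} {y x} (h : Ag B y x) {l} (hl : l ∈ B) (v) : Ag B y (update x l v) := by
  intro i hi
  have : i ≠ l := fun e => hi (e ▸ hl)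
  rw [update_of_ne this, h i hi]
lemma Ag.pw {B : Finset ι} {y x x'} (h : Ag B y x) (h' : Ag B y x') (P : Finset ι) :
    Ag B y (P.piecewise x x') := by
  intro i hi
  by_cases hP : i ∈ P <;> simp [hP, h i hi, h' i hi]

lemma chain {R : Type*} (g : (ι → Fin 4) → R) (B : Finset ι) (y : ι → Fin 4) :
    ∀ (E : Finset ι), E ⊆ B →
    (∀ x, Ag B y x → ∀ m ∈ E, ∀ v, g (update x m v) = g x) →
    ∀ x w, Ag B y x → Ag E x w → g w = g x := by
  intro E
  induction E using Finset.induction_on with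
  | empty =>
    intro _ _ x w _ h
    have : w = x := funext fun i => h i (by simp)
    rw [this]
  | insert m E hm ih =>
    intro hE h x w hx hw
    rw [← h x hx m (by simp) (w m)]
    refine ih (fun i hi => hE (by simp [hi])) (fun x hx m hm v => h x hx m (by simp [hm]) v) _ w
      (hx.upd (hE (by simp)) _) ?_
    intro i hi
    by_cases h' : i = m
    · subst h'; simp
    · rw [update_of_ne h']; exact hw i (by simp [h', hi])

/-- non-additivity of `F` on the `(l,m)`-plane through `x`. -/
def Nn (F : (ι → Fin 4) → ZMod 2) (l m : ι) (x : ι → Fin 4) : Prop :=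
  ∃ a a' b b', F (update (update x l a) m b) + F (update (update x l a') m b) +
    F (update (update x l a) m b') + F (update (update x l a') m b') ≠ 0

lemma not_Nn {F : (ι → Fin 4) → ZMod 2} {l m : ι} {x} : ¬ Nn F l m x ↔
   ∀ a a' b b', F (update (update x l a) m b) + F (update (update x l a') m b) +
    F (update (update x l a) m b') + F (update (update x l a') m b') = 0 := by
  unfold Nn; push Not; rfl

lemma Nn_symm {F : (ι → Fin 4) → ZMod 2} {l m : ι} (h : l ≠ m) {x} : Nn F l m x ↔ Nn F m l x := by
  have key : ∀ {l m : ι}, l ≠ m → Nn F l m x → Nn F m l x := by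
    rintro l m h ⟨a, a', b, b', H⟩
    refine ⟨b, b', a, a', ?_⟩
    simp only [update_comm h.symm] at *
    intro h'; apply H; rw [← h']; ring
  exact ⟨key h, key h.symm⟩

lemma Nn_upd_left {F : (ι → Fin 4) → ZMod 2} {l m : ι} {x v} :
    Nn F l m (update x l v) ↔ Nn F l m x := by
  unfold Nn; simp only [update_idem]
lemma Nn_upd_right {F : (ι → Fin 4) → ZMod 2} {l m : ι} (h : l ≠ m) {x v} :
    Nn F l m (update x m v) ↔ Nn F l m x := by
  rw [Nn_symm h, Nn_upd_left, Nn_symm h]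

/-- closed sets -/
def Cl (F : (ι → Fin 4) → ZMod 2) (B : Finset ι) (y : ι → Fin 4) (P : Finset ι) : Prop :=
  ∀ l ∈ P, l ∈ B → ∀ m ∈ B, m ∉ P → ∀ x, Ag B y x → ¬ Nn F l m x

lemma Cl.single {F : (ι → Fin 4) → ZMod 2} {B : Finset ι} {y : ι → Fin 4} {P : Finset ι}
    (h : Cl F B y P) {l} (hl : l ∈ P) (hlB : l ∈ B) {x x'} (hx : Ag B y x) (hx' : Ag B y x')
    (hxx : ∀ i ∈ P, x i = x' i) (v) :
    F x + F (update x l v) = F x' + F (update x' l v) := by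
  refine chain (fun x => F x + F (update x l v)) B y (B \ P) Finset.sdiff_subset ?_ x' x hx' ?_
  · intro x hx m hm u
    have hm' := Finset.mem_sdiff.1 hm
    have hlm : l ≠ m := fun e => hm'.2 (e ▸ hl)
    have := not_Nn.1 (h l hl hlB m hm'.1 hm'.2 x hx) (x l) v (x m) u
    simp only [update_comm hlm.symm, update_eq_self] at this ⊢
    rw [update_comm hlm] at this
    simp only [update_eq_self] at this
    grind
  · intro i hi
    by_cases hP : i ∈ P
    · exact hxx i hP
    · have : i ∉ B := fun hB => hi (by simp [hB, hP])
      rw [hx i this, hx' i this]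

lemma Cl.rect {F : (ι → Fin 4) → ZMod 2} {B : Finset ι} {y : ι → Fin 4} {P : Finset ι}
    (h : Cl F B y P) {x x'} (hx : Ag B y x) (hx' : Ag B y x') :
    F x + F x' = F (P.piecewise x x') + F (P.piecewise x' x) := by
  have := chain (fun w => F w + F (P.piecewise w x')) B y (P ∩ B) Finset.inter_subset_right ?_ x
    (P.piecewise x' x) hx ?_
  · have e : P.piecewise (P.piecewise x' x) x' = x' := by
      funext i; by_cases hi : i ∈ P <;> simp [hi]
    simp only [e] at this
    grind
  · intro w hw m hm v
    have hm' := Finset.mem_inter.1 hm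
    have e : P.piecewise (update w m v) x' = update (P.piecewise w x') m v := by
      funext i; by_cases hi : i = m
      · subst hi; simp [hm'.1]
      · by_cases hi' : i ∈ P <;> simp [hi', hi]
    have := h.single hm'.1 hm'.2 hw (hw.pw hx' P) (fun i hi => by simp [hi]) v
    simp only [e]
    grind
  · intro i hi
    by_cases hP : i ∈ P
    · have : i ∉ B := fun hB => hi (by simp [hB, hP])
      simp [hP, hx i this, hx' i this]
    · simp [hP]

lemma Cl.persist {F : (ι → Fin 4) → ZMod 2} {B : Finset ι} {y : ι → Fin 4} {P : Finset ι}
    (h : Cl F B y P) {l m} (hl : l ∈ P) (hm : m ∈ P) (hlB : l ∈ B) (hmB : m ∈ B) {x x'}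
    (hx : Ag B y x) (hx' : Ag B y x')
    (hxx : ∀ i ∈ P, x i = x' i) (hn : Nn F l m x) : Nn F l m x' := by
  obtain ⟨a, a', b, b', H⟩ := hn
  refine ⟨a, a', b, b', ?_⟩
  have h1 := h.single hm hmB (hx.upd hlB a |>.upd hmB b) (hx'.upd hlB a |>.upd hmB b)
    (fun i hi => by simp only [update_apply]; split_ifs <;> simp [hxx i hi]) b'
  have h2 := h.single hm hmB (hx.upd hlB a' |>.upd hmB b) (hx'.upd hlB a' |>.upd hmB b)
    (fun i hi => by simp only [update_apply]; split_ifs <;> simp [hxx i hi]) b'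
  simp only [update_idem] at h1 h2
  intro h'; apply H; rw [← h']; grind

lemma Cl.compl {F : (ι → Fin 4) → ZMod 2} {B : Finset ι} {y : ι → Fin 4} {P : Finset ι}
    (h : Cl F B y P) : Cl F B y (B \ P) := by
  intro l hl hlB m hm hmP x hx
  have hl' := Finset.mem_sdiff.1 hl
  have hm' : m ∈ P := by by_contra h'; exact hmP (by simp [hm, h'])
  have : l ≠ m := fun e => hl'.2 (e ▸ hm')
  rw [Nn_symm this]
  exact h m hm' hm l hlB hl'.2 x hx
lemma Cl.inter {F : (ι → Fin 4) → ZMod 2} {B : Finset ι} {y : ι → Fin 4} {P Q : Finset ι}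
    (h : Cl F B y P) (h' : Cl F B y Q) : Cl F B y (P ∩ Q) := by
  intro l hl hlB m hm hmP x hx
  have hl' := Finset.mem_inter.1 hl
  by_cases hmp : m ∈ P
  · exact h' l hl'.2 hlB m hm (fun h => hmP (by simp [h, hmp])) x hx
  · exact h l hl'.1 hlB m hm hmp x hx
lemma Cl.sdiff {F : (ι → Fin 4) → ZMod 2} {B : Finset ι} {y : ι → Fin 4} {P Q : Finset ι}
    (h : Cl F B y P) (h' : Cl F B y Q) (hP : P ⊆ B) : Cl F B y (P \ Q) := by
  have : P \ Q = P ∩ (B \ Q) := by ext i; simp; intro h1 _; exact hP h1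
  rw [this]; exact h.inter h'.compl
lemma Cl.mono {F : (ι → Fin 4) → ZMod 2} {B B' : Finset ι} {y y' : ι → Fin 4} {P : Finset ι}
    (h : Cl F B y P) (hB : B' ⊆ B) (hy : Ag B y y') : Cl F B' y' P := by
  intro l hl hlB m hm hmP x hx
  exact h l hl (hB hlB) m (hB hm) hmP x (hy.trans (hx.mono hB))
lemma Cl.self (F : (ι → Fin 4) → ZMod 2) (B : Finset ι) (y : ι → Fin 4) : Cl F B y B :=
  fun _ _ _ _ hm hm' => absurd hm hm'
lemma Cl.congr {F : (ι → Fin 4) → ZMod 2} {B : Finset ι} {y y' : ι → Fin 4} {P : Finset ι}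
    (h : Cl F B y P) (hy : Ag B y y') : Cl F B y' P := h.mono subset_rfl hy

/-- a closed set gives closedness from a splitting -/
lemma Cl.of_rect {F : (ι → Fin 4) → ZMod 2} {B : Finset ι} {y : ι → Fin 4} {P : Finset ι}
    (h : ∀ x x', Ag B y x → Ag B y x' → F x + F x' = F (P.piecewise x x') + F (P.piecewise x' x)) :
    Cl F B y P := by
  intro l hl hlB m hm hmP x hx
  rw [not_Nn]
  intro a a' b b'
  have hlm : l ≠ m := fun e => hmP (e ▸ hl)
  have := h (update (update x l a) m b) (update (update x l a') m b') (hx.upd hlB a |>.upd hm b)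
    (hx.upd hlB a' |>.upd hm b')
  have e : ∀ a a' b b', P.piecewise (update (update x l a) m b) (update (update x l a') m b') =
      update (update x l a) m b' := by
    intro a a' b b'
    funext i
    by_cases h1 : i = m
    · subst h1; simp [hmP]
    · by_cases h2 : i = l
      · subst h2; simp [hl, h1]
      · by_cases h3 : i ∈ P <;> simp [h1, h2, h3]
  rw [e, e] at this
  grind

def Conn (F : (ι → Fin 4) → ZMod 2) (B : Finset ι) (y : ι → Fin 4) : Prop :=
  ∀ P, P ⊆ B → P.Nonempty → Cl F B y P → P = B

/-- disconnected -/
def Disc (F : (ι → Fin 4) → ZMod 2) (B : Finset ι) (y : ι → Fin 4) : Prop :=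
  ∃ P, P ⊆ B ∧ P.Nonempty ∧ P ≠ B ∧ Cl F B y P

lemma not_disc {F : (ι → Fin 4) → ZMod 2} {B : Finset ι} {y : ι → Fin 4} :
    ¬ Disc F B y ↔ Conn F B y := by
  unfold Disc Conn
  push Not
  constructor
  · intro h P h1 h2 h3
    by_contra h4
    exact h P h1 h2 h4 h3
  · intro h P h1 h2 h3 h4
    exact h3 (h P h1 h2 h4)

/-- connected component -/
def Comp (F : (ι → Fin 4) → ZMod 2) (B : Finset ι) (y : ι → Fin 4) (Z : Finset ι) : Prop :=
  Z ⊆ B ∧ Z.Nonempty ∧ Cl F B y Z ∧ ∀ P, P ⊆ Z → P.Nonempty → Cl F B y P → P = Z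

lemma exists_comp (F : (ι → Fin 4) → ZMod 2) (B : Finset ι) (y : ι → Fin 4) {l : ι} (hl : l ∈ B) :
    ∃ Z, l ∈ Z ∧ Comp F B y Z := by
  classical
  obtain ⟨Z, hZ, hmin⟩ := Finset.exists_min_image
    (B.powerset.filter (fun P => l ∈ P ∧ Cl F B y P)) Finset.card
    ⟨B, by simp [hl, Cl.self]⟩
  simp only [Finset.mem_filter, Finset.mem_powerset] at hZ hmin
  refine ⟨Z, hZ.2.1, hZ.1, ⟨l, hZ.2.1⟩, hZ.2.2, ?_⟩
  intro P hP hne hcl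
  by_cases hlP : l ∈ P
  · exact Finset.eq_of_subset_of_card_le hP (hmin P ⟨hP.trans hZ.1, hlP, hcl⟩)
  · exfalso
    have h1 := hmin (Z \ P) ⟨Finset.sdiff_subset.trans hZ.1, by simp [hlP, hZ.2.1],
      hZ.2.2.sdiff hcl hZ.1⟩
    have h2 := Finset.card_sdiff_add_card_eq_card hP
    have := hne.card_pos
    omega

lemma Comp.sub_or_disj {F : (ι → Fin 4) → ZMod 2} {B : Finset ι} {y : ι → Fin 4} {Z P : Finset ι}
    (h : Comp F B y Z) (hP : Cl F B y P) : Z ⊆ P ∨ Disjoint Z P := by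
  by_cases hne : (Z ∩ P).Nonempty
  · left
    have := h.2.2.2 (Z ∩ P) Finset.inter_subset_left hne (h.2.2.1.inter hP)
    exact Finset.inter_eq_left.1 this
  · right
    rw [Finset.disjoint_iff_inter_eq_empty]
    exact Finset.not_nonempty_iff_eq_empty.1 hne

lemma Comp.conn {F : (ι → Fin 4) → ZMod 2} {B : Finset ι} {y : ι → Fin 4} {Z : Finset ι}
    (h : Comp F B y Z) {x} (hx : Ag B y x) : Conn F Z x := by
  intro P hP hne hcl
  refine h.2.2.2 P hP hne ?_
  intro l hl hlB m hm hmP w hw hN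
  by_cases hmZ : m ∈ Z
  · refine hcl l hl (hP hl) m hmZ hmP (Z.piecewise w x) (fun i hi => by simp [hi]) ?_
    exact h.2.2.1.persist (hP hl) hmZ hlB hm hw (hw.pw hx Z) (fun i hi => by simp [hi]) hN
  · exact h.2.2.1 l (hP hl) hlB m hm hmZ w hw hN

lemma Comp.of_conn {F : (ι → Fin 4) → ZMod 2} {B : Finset ι} {y : ι → Fin 4} {Z : Finset ι}
    (hZ : Z ⊆ B) (hne : Z.Nonempty) (hcl : Cl F B y Z) {x} (hx : Ag B y x) (hc : Conn F Z x) :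
    Comp F B y Z :=
  ⟨hZ, hne, hcl, fun P hP hne h => hc P hP hne (h.mono hZ hx)⟩

lemma Conn.congr {F : (ι → Fin 4) → ZMod 2} {B : Finset ι} {y y' : ι → Fin 4}
    (h : Conn F B y) (hy : Ag B y y') : Conn F B y' :=
  fun P h1 h2 h3 => h P h1 h2 (h3.congr hy.symm)
lemma Disc.congr {F : (ι → Fin 4) → ZMod 2} {B : Finset ι} {y y' : ι → Fin 4}
    (h : Disc F B y) (hy : Ag B y y') : Disc F B y' := by
  obtain ⟨P, h1, h2, h3, h4⟩ := h
  exact ⟨P, h1, h2, h3, h4.congr hy⟩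

/-- Latin in the directions of `V`. -/
def Lat (f : (ι → Fin 4) → Fin 4) (V : Finset ι) : Prop :=
  ∀ l ∈ V, ∀ x, Injective fun v => f (update x l v)

def BalOn (F : (ι → Fin 4) → ZMod 2) (V : Finset ι) : Prop :=
  ∀ l ∈ V, ∀ x, Bal fun v => F (update x l v)

lemma Lat.mono {f : (ι → Fin 4) → Fin 4} {V W : Finset ι} (h : Lat f V) (hW : W ⊆ V) : Lat f W :=
  fun l hl => h l (hW hl)
lemma BalOn.mono {f : (ι → Fin 4) → ZMod 2} {V W : Finset ι} (h : BalOn f V) (hW : W ⊆ V) :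
    BalOn f W := fun l hl => h l (hW hl)

lemma Lat.bal {f : (ι → Fin 4) → Fin 4} {V : Finset ι} (h : Lat f V) (p : Fin 3) :
    BalOn (fun x => ps p (f x)) V := fun l hl x => bal_perm (h l hl x) p

end
end QG

namespace QG
open Function
set_option linter.unusedSectionVars false
set_option linter.unusedVariables false

set_option synthInstance.maxSize 2000 in
set_option synthInstance.maxHeartbeats 400000 in
set_option maxRecDepth 100000 in
set_option maxHeartbeats 2000000 in
lemma ls_red : ∀ a11 : Fin 4, a11 ≠ 1 → ∀ a12, a12 ≠ 1 → a12 ≠ 2 → a12 ≠ a11 →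
   ∀ a13, a13 ≠ 1 → a13 ≠ 3 → a13 ≠ a11 → a13 ≠ a12 →
   ∀ a21, a21 ≠ 1 → a21 ≠ 2 → a21 ≠ a11 → ∀ a22, a22 ≠ 2 → a22 ≠ a12 → a22 ≠ a21 →
   ∀ a23, a23 ≠ 2 → a23 ≠ 3 → a23 ≠ a13 → a23 ≠ a21 → a23 ≠ a22 →
   ∀ a31, a31 ≠ 1 → a31 ≠ 3 → a31 ≠ a11 → a31 ≠ a21 → 
   ∀ a32, a32 ≠ 3 → a32 ≠ 2 → a32 ≠ a12 → a32 ≠ a22 → a32 ≠ a31 → 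
   ∀ a33, a33 ≠ 3 → a33 ≠ a13 → a33 ≠ a23 → a33 ≠ a31 → a33 ≠ a32 → 
   ∃ p, ps p a11 = ps p 1 + ps p 1 ∧ ps p a12 = ps p 1 + ps p 2 ∧ ps p a13 = ps p 1 + ps p 3 ∧
     ps p a21 = ps p 2 + ps p 1 ∧ ps p a22 = ps p 2 + ps p 2 ∧ ps p a23 = ps p 2 + ps p 3 ∧
     ps p a31 = ps p 3 + ps p 1 ∧ ps p a32 = ps p 3 + ps p 2 ∧ ps p a33 = ps p 3 + ps p 3 := by
  decide

lemma ls_norm (h : Fin 4 → Fin 4 → Fin 4) (hr : ∀ a, Injective (h a))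
    (hc : ∀ b, Injective fun a => h a b) (h0 : ∀ b, h 0 b = b) (h1 : ∀ a, h a 0 = a) :
    ∃ p, ∀ a b, ps p (h a b) = ps p a + ps p b := by
  have R : ∀ {a b b'}, b ≠ b' → h a b ≠ h a b' := fun hb => (hr _).ne hb
  have K : ∀ {a a' b}, a ≠ a' → h a b ≠ h a' b := fun {a a' b} hb => (hc b).ne hb
  have R0 : ∀ {a b}, b ≠ 0 → h a b ≠ a := fun {a b} hb e => R (a := a) hb (by rw [e, h1])
  have K0 : ∀ {a b}, a ≠ 0 → h a b ≠ b := fun {a b} hb e => K (b := b) hb (by rw [e, h0])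
  obtain ⟨p, h11, h12, h13, h21, h22, h23, h31, h32, h33⟩ := ls_red (h 1 1) (R0 (by decide))
    (h 1 2) (R0 (by decide)) (K0 (by decide)) (R (by decide))
    (h 1 3) (R0 (by decide)) (K0 (by decide)) (R (by decide)) (R (by decide))
    (h 2 1) (K0 (by decide)) (R0 (by decide)) (K (by decide))
    (h 2 2) (R0 (by decide)) (K (by decide)) (R (by decide))
    (h 2 3) (R0 (by decide)) (K0 (by decide)) (K (by decide)) (R (by decide)) (R (by decide))
    (h 3 1) (K0 (by decide)) (R0 (by decide)) (K (by decide)) (K (by decide))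
    (h 3 2) (R0 (by decide)) (K0 (by decide)) (K (by decide)) (K (by decide)) (R (by decide))
    (h 3 3) (R0 (by decide)) (K (by decide)) (K (by decide)) (R (by decide)) (R (by decide))
  have e0 : ps p 0 = 0 := by clear * - ; revert p; decide
  refine ⟨p, fun a b => ?_⟩
  fin_cases a <;> fin_cases b <;> first | assumption | simp [h0, h1, e0]

lemma ls (g : Fin 4 → Fin 4 → Fin 4) (hr : ∀ a, Injective (g a))
    (hc : ∀ b, Injective fun a => g a b) :
    ∃ p, ∀ a a' b b', ps p (g a b) + ps p (g a' b) + ps p (g a b') + ps p (g a' b') = 0 := by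
  let β : Equiv.Perm (Fin 4) := Equiv.ofBijective (g 0) (Finite.injective_iff_bijective.1 (hr 0))
  let α : Equiv.Perm (Fin 4) := Equiv.ofBijective (fun a => g a (β.symm 0))
    (Finite.injective_iff_bijective.1 (hc _))
  have hα0 : α 0 = 0 := by
    change β (β.symm 0) = 0; simp
  obtain ⟨p, hp⟩ := ls_norm (fun a b => g (α.symm a) (β.symm b))
    (fun a => (hr _).comp β.symm.injective) (fun b => (hc (β.symm b)).comp α.symm.injective)
    (fun b => by
      have : α.symm 0 = 0 := by rw [Equiv.symm_apply_eq, hα0]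
      rw [this]; change β (β.symm b) = b; simp)
    (fun a => by change α (α.symm a) = a; simp)
  refine ⟨p, fun a a' b b' => ?_⟩
  have := fun a b => hp (α a) (β b)
  simp only [Equiv.symm_apply_apply] at this
  rw [this, this, this, this]
  grind

section
variable {ι : Type*} [DecidableEq ι]

lemma Lat.ls {f : (ι → Fin 4) → Fin 4} {V : Finset ι} (h : Lat f V) {l m} (hl : l ∈ V) (hm : m ∈ V)
    (hlm : l ≠ m) (x) : ∃ p, ¬ Nn (fun x => ps p (f x)) l m x := by
  obtain ⟨p, hp⟩ := QG.ls (fun a b => f (update (update x l a) m b)) (fun a => h m hm _)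
    (fun b => by
      have := h l hl (update x m b)
      simpa only [update_comm hlm] using this)
  exact ⟨p, not_Nn.2 hp⟩

/-- two additive ⇒ third additive -/
lemma Nn_third {f : (ι → Fin 4) → Fin 4} {l m x} {p q r : Fin 3} (h : p ≠ q) (h1 : p ≠ r)
    (h2 : q ≠ r) (hp : ¬ Nn (fun x => ps p (f x)) l m x) (hq : ¬ Nn (fun x => ps q (f x)) l m x) :
    ¬ Nn (fun x => ps r (f x)) l m x := by
  rw [not_Nn] at *
  intro a a' b b'
  have := hp a a' b b'
  have := hq a a' b b'
  have := ps_sum h h1 h2 (f (update (update x l a) m b))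
  have := ps_sum h h1 h2 (f (update (update x l a') m b))
  have := ps_sum h h1 h2 (f (update (update x l a) m b'))
  have := ps_sum h h1 h2 (f (update (update x l a') m b'))
  grind
end
end QG

namespace QG
open Function
set_option linter.unusedSectionVars false
set_option linter.unusedVariables false

lemma Bal.ex3 {g} (h : Bal g) {a b : Fin 4} (h1 : g a = 1) (h2 : g b = 0) :
    ∃ c, c ≠ a ∧ c ≠ b ∧ g c = 1 := by
  obtain ⟨s, e, h⟩ := h
  simp only [h] at *; clear h; revert s e a b; decide
lemma Bal.sub' {g g'} (h : Bal g) (h' : Bal g') (hs : ∀ a, g a = 1 → g' a = 0) :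
    ∀ a, g a = g' a + 1 :=
  h.sub (h'.add 1) (fun a ha => by simp only [hs a ha]; decide)

lemma plane_split {R : Type*} {G : Fin 4 → Fin 4 → ZMod 2} {r : Fin 4 → Fin 4 → R}
    (hl : ∀ b, Bal fun a => G a b) (hk : ∀ a, Bal (G a))
    (rl : ∀ a a' b, G a b = 1 → G a' b = 1 → r a b = r a' b)
    (rk : ∀ a b b', G a b = 1 → G a b' = 1 → r a b = r a b')
    {a1 b1 a2 b2} (h1 : G a1 b1 = 1) (h2 : G a2 b2 = 1) (hr : r a1 b1 ≠ r a2 b2) :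
    (∀ a b, G a b = G a1 b + G a b1 + 1) ∧
    (∀ a b, G a b1 = 1 → G a1 b = 1 → r a b = r a1 b1) := by
  have row : ∀ a a' b b', G a b = 1 → G a' b' = 1 → r a b ≠ r a' b' → ∀ b, G a b = G a' b + 1 := by
    intro a a' b b' h h' hr
    refine (hk a).sub' (hk a') ?_
    intro d hd
    rcases z2c (G a' d) with h0 | h0
    · exact h0
    · exact absurd ((rk a b d h hd).trans ((rl a a' d hd h0).trans (rk a' d b' h0 h'))) hr
  have add : ∀ a b, G a b = G a1 b + G a b1 + 1 := by
    intro a b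
    obtain ⟨d, hd⟩ := (hk a).ex 1
    have h12 := row _ _ _ _ h1 h2 hr
    by_cases e : r a d = r a1 b1
    · have := row _ _ _ _ hd h2 (by rw [e]; exact hr)
      have e1 := this b
      have e2 := this b1
      have e3 := h12 b
      have e4 := h12 b1
      grind
    · have := row _ _ _ _ hd h1 e
      have e1 := this b
      have e2 := this b1
      grind
  refine ⟨add, fun a b ha hb => ?_⟩
  have : G a b = 1 := by rw [add, ha, hb]; decide
  exact (rk a b b1 this ha).trans (rl _ _ _ ha h1)

lemma local_split {R : Type*} {G : Fin 4 → Fin 4 → Fin 4 → ZMod 2} {r : Fin 4 → Fin 4 → Fin 4 → R}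
    (hj : ∀ a b, Bal fun c => G c a b)
    (hl : ∀ c b, Bal fun a => G c a b) (hk : ∀ c a, Bal (G c a))
    (rj : ∀ c c' a b, G c a b = 1 → G c' a b = 1 → r c a b = r c' a b)
    (rl : ∀ c a a' b, G c a b = 1 → G c a' b = 1 → r c a b = r c a' b)
    (rk : ∀ c a b b', G c a b = 1 → G c a b' = 1 → r c a b = r c a b')
    {c c'} {a1 b1 a2 b2} (h1 : G c a1 b1 = 1) (h2 : G c a2 b2 = 1) (hr : r c a1 b1 ≠ r c a2 b2)
    (hc' : ∀ a b a' b', G c' a b = 1 → G c' a' b' = 1 → r c' a b = r c' a' b') :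
    ∃ c'', c'' ≠ c ∧ c'' ≠ c' ∧ (∀ a b, G c'' a b = G c a b) ∧
      (∃ a b a' b', G c'' a b = 1 ∧ G c'' a' b' = 1 ∧ r c'' a b ≠ r c'' a' b') := by
  obtain ⟨b0, hb0⟩ := (hk c' 0).ex 1
  wlog hw : r c a1 b1 ≠ r c' 0 b0 generalizing a1 b1 a2 b2
  · exact this h2 h1 hr.symm (by push Not at hw; rw [← hw]; exact hr.symm)
  have hρ : ∀ a b, G c' a b = 1 → r c' a b = r c' 0 b0 := fun a b h => hc' _ _ _ _ h hb0
  obtain ⟨add, blk⟩ := plane_split (hl c) (hk c) (rl c) (rk c) h1 h2 hr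
  set u := fun b => G c a1 b with hu
  set w := fun a => G c a b1 with hwdef
  have add' : ∀ a b, G c a b = u b + w a + 1 := add
  have hub : Bal u := hk c a1
  have hwb : Bal w := hl c b1
  have u1 : u b1 = 1 := h1
  have w1 : w a1 = 1 := h1
  have z01 : ∀ a b, w a = 1 → u b = 1 → G c' a b = 0 := by
    intro a b ha hb
    rcases z2c (G c' a b) with h0 | h0
    · exact h0
    · have : G c a b = 1 := by rw [add', ha, hb]; decide
      exact absurd ((blk a b ha hb).symm.trans ((rj _ _ _ _ this h0).trans (hρ _ _ h0))) hw
  have Gc'1 : ∀ a, w a = 1 → ∀ b, G c' a b = u b + 1 := fun a ha =>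
    (hk c' a).sub' hub fun b hb => by
      rcases z2c (u b) with h0 | h0
      · exact h0
      · rw [z01 a b ha h0] at hb; exact absurd hb (by decide)
  have Gc'2 : ∀ b, u b = 1 → ∀ a, G c' a b = w a + 1 := fun b hb =>
    (hl c' b).sub' hwb fun a ha => by
      rcases z2c (w a) with h0 | h0
      · exact h0
      · rw [z01 a b h0 hb] at ha; exact absurd ha (by decide)
  obtain ⟨c'', hne, hne', hT⟩ := (hj a1 b1).ex3 h1 (z01 a1 b1 w1 u1)
  have rT : r c'' a1 b1 = r c a1 b1 := rj _ _ _ _ hT h1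
  have T1 : ∀ b, G c'' a1 b = u b := (hk c'' a1).sub hub fun b hb => by
    rcases z2c (u b) with h0 | h0
    · have : G c' a1 b = 1 := by rw [Gc'1 a1 w1, h0]; decide
      exact absurd (rT.symm.trans ((rk _ _ _ _ hT hb).trans ((rj _ _ _ _ hb this).trans
        (hρ _ _ this)))) hw
    · exact h0
  have T2 : ∀ b, u b = 1 → ∀ a, G c'' a b = w a := fun b hb => (hl c'' b).sub hwb fun a ha => by
    rcases z2c (w a) with h0 | h0
    · have : G c' a b = 1 := by rw [Gc'2 b hb, h0]; decide
      have e1 : G c'' a1 b = 1 := by rw [T1, hb]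
      exact absurd (rT.symm.trans ((rk _ _ _ _ hT e1).trans ((rl _ _ _ _ e1 ha).trans
        ((rj _ _ _ _ ha this).trans (hρ _ _ this))))) hw
    · exact h0
  have T3 : ∀ a b, G c'' a b = G c a b := by
    intro a b
    rw [add']
    rcases z2c (w a) with h0 | h0
    · have := (hk c'' a).sub' hub (fun b hb => by
        rcases z2c (u b) with h | h
        · exact h
        · rw [T2 b h, h0] at hb; exact absurd hb (by decide)) b
      rw [this, h0]; ring
    · have := hub.sub (hk c'' a) (fun b hb => by rw [T2 b hb, h0]) b
      rw [← this, h0]; grind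
  refine ⟨c'', hne, hne', T3, a1, b1, a2, b2, hT, by rw [T3, h2], ?_⟩
  rw [rT, rj c'' c a2 b2 (by rw [T3, h2]) h2]
  exact hr

section
variable {ι : Type*} [DecidableEq ι]

theorem thmA [Fintype ι] {R : Type*} {F : (ι → Fin 4) → ZMod 2} {B : Finset ι} {y : ι → Fin 4}
    (hF : BalOn F B) (hc : Conn F B y) {r : (ι → Fin 4) → R}
    (hr : ∀ x, Ag B y x → ∀ l ∈ B, ∀ v, F x = 1 → F (update x l v) = 1 → r x = r (update x l v)) :
    ∀ x x', Ag B y x → Ag B y x' → F x = 1 → F x' = 1 → r x = r x' := by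
  classical
  intro x0 x0' hx0 hx0' hFx0 hFx0'
  by_cases hB : B.Nonempty
  swap
  · rw [Finset.not_nonempty_iff_eq_empty] at hB
    subst hB
    have : x0 = x0' := funext fun i => (hx0 i (by simp)).trans (hx0' i (by simp)).symm
    rw [this]
  have hr' : ∀ x, Ag B y x → ∀ l ∈ B, ∀ v v', F (update x l v) = 1 → F (update x l v') = 1 →
      r (update x l v) = r (update x l v') := by
    intro x hx l hl v v' h h'
    have := hr (update x l v) (hx.upd hl v) l hl v' h
    simp only [update_idem] at this
    exact this h'
  obtain ⟨i, hi⟩ := hB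
  choose α hα using fun z => (hF i hi z).ex 1
  set ρ : (ι → Fin 4) → R := fun z => r (update z i (α z)) with hρ
  have ρr : ∀ z, Ag B y z → F z = 1 → ρ z = r z := by
    intro z hz h
    have := hr' z hz i hi (α z) (z i) (hα z) (by rwa [update_eq_self])
    rwa [update_eq_self] at this
  have ρi : ∀ z, Ag B y z → ∀ v, ρ (update z i v) = ρ z := by
    intro z hz v
    have h := hα (update z i v)
    simp only [hρ, update_idem] at h ⊢
    exact hr' z hz i hi _ _ h (hα z)
  let J := B.filter (fun k => ∃ z v, Ag B y z ∧ ρ z ≠ ρ (update z k v))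
  have hJ : ∀ k ∈ B, k ∉ J → ∀ z v, Ag B y z → ρ (update z k v) = ρ z := by
    intro k hk hkJ z v hz
    by_contra h
    exact hkJ (Finset.mem_filter.2 ⟨hk, z, v, hz, fun e => h e.symm⟩)
  have hiJ : i ∉ J := by
    intro h
    obtain ⟨-, z, v, hz, h⟩ := Finset.mem_filter.1 h
    exact h (ρi z hz v).symm
  by_cases hJe : J = ∅
  · rw [← ρr x0 hx0 hFx0, ← ρr x0' hx0' hFx0']
    refine (chain ρ B y B subset_rfl ?_ x0 x0' hx0 (hx0.symm.trans hx0')).symm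
    intro x hx m hm v
    exact hJ m hm (by simp [hJe]) x v hx
  exfalso
  have hcl : Cl F B y (B \ J) := by
    intro l hl hlB k hk hkJ
    have hlJ := (Finset.mem_sdiff.1 hl).2
    have hkJ : k ∈ J := by by_contra h; exact hkJ (by simp [hk, h])
    have hlk : l ≠ k := fun e => hlJ (e ▸ hkJ)
    obtain ⟨-, z0, v0, hz0, hne0⟩ := Finset.mem_filter.1 hkJ
    let E := B \ {l, k}
    have hEB : E ⊆ B := Finset.sdiff_subset
    let Sp : (ι → Fin 4) → Prop := fun z => ∃ a b a' b',
      F (update (update z l a) k b) = 1 ∧ F (update (update z l a') k b') = 1 ∧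
      r (update (update z l a) k b) ≠ r (update (update z l a') k b')
    have Sp_upd : ∀ z a b, Sp (update (update z l a) k b) ↔ Sp z := by
      intro z a b
      have : ∀ a' b', update (update (update (update z l a) k b) l a') k b' =
          update (update z l a') k b' := by
        intro a' b'
        rw [update_comm hlk.symm, update_idem, update_idem]
      simp only [Sp, this]
    have hex : ∃ z, Ag B y z ∧ Sp z := by
      by_cases hli : l = i
      · subst hli
        refine ⟨z0, hz0, α z0, z0 k, α (update z0 k v0), v0, ?_, ?_, ?_⟩
        · rw [update_comm hlk, update_eq_self]; exact hα z0
        · rw [update_comm hlk]; exact hα _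
        · rw [update_comm hlk, update_eq_self, update_comm hlk]; exact hne0
      · have hki : k ≠ i := fun e => hiJ (e ▸ hkJ)
        obtain ⟨β, hβ⟩ := (hF l hlB (update (update z0 i (α z0)) k v0)).ex 1
        have hz1 : Ag B y (update z0 i (α z0)) := hz0.upd hi _
        refine ⟨update z0 i (α z0), hz1, z0 l, z0 k, β, v0, ?_, ?_, ?_⟩
        · rw [update_comm (fun e => hli e.symm), update_eq_self, update_comm hki.symm,
            update_eq_self]; exact hα z0
        · rw [update_comm hlk]; exact hβ
        · rw [update_comm (fun e => hli e.symm), update_eq_self, update_comm hki.symm,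
            update_eq_self]
          rw [← ρr _ hz1 (hα z0), ρi z0 hz0]
          rw [update_comm hlk, ← ρr _ ((hz1.upd hk _).upd hlB _) hβ]
          rw [hJ l hlB hlJ _ _ (hz1.upd hk _)]
          rw [update_comm hki.symm, ρi _ (hz0.upd hk _)]
          exact hne0
    -- main distance induction
    have main : ∀ e : ℕ, ∀ y0 z, Ag E y y0 → Ag E y z → Sp y0 → hammingDist y0 z = e →
        (∀ w, Ag E y w → Sp w → e ≤ hammingDist w z) →
        ∀ a b, F (update (update z l a) k b) = F (update (update y0 l a) k b) + e := by
      intro e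
      induction e with
      | zero =>
        intro y0 z _ _ _ hd _ a b
        rw [hammingDist_eq_zero] at hd
        subst hd; simp
      | succ e ih =>
        intro y0 z hy0 hz hs hd hmin a b
        obtain ⟨m, hm⟩ : ∃ m, y0 m ≠ z m := by
          by_contra h; push Not at h
          rw [show y0 = z from funext h, hammingDist_self] at hd; omega
        have hmE : m ∈ E := by
          by_contra h
          exact hm ((hy0 m h).trans (hz m h).symm)
        have hmB := hEB hmE
        have hml : m ≠ l := by rintro rfl; simp [E] at hmE
        have hmk : m ≠ k := by rintro rfl; simp [E] at hmE
        -- distance computations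
        have dist1 : ∀ c, hammingDist (update y0 m c) (update z m c) = e := by
          intro c
          have : hammingDist y0 z = hammingDist (update y0 m c) (update z m c) + 1 := by
            unfold hammingDist
            have : (Finset.univ.filter fun i => y0 i ≠ z i) =
                insert m (Finset.univ.filter fun i => update y0 m c i ≠ update z m c i) := by
              ext i
              by_cases h : i = m
              · subst h; simp [hm]
              · simp [h]
            rw [this, Finset.card_insert_of_notMem (by simp)]
          omega
        have dist2 : ∀ w c, hammingDist w z ≤ hammingDist w (update z m c) + 1 := by
          intro w c
          refine (hammingDist_triangle w (update z m c) z).trans ?_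
          gcongr
          unfold hammingDist
          rw [Finset.card_le_one]
          intro i hi j hj
          have : ∀ i, i ∈ (Finset.univ.filter fun i => update z m c i ≠ z i) → i = m := by
            intro i hi
            by_contra h
            simp [h] at hi
          rw [this i hi, this j hj]
        have hns : ¬ Sp (update y0 m (z m)) := by
          intro h
          have := hmin _ (hy0.upd hmE _) h
          have h2 := dist1 (z m)
          rw [update_eq_self] at h2
          omega
        obtain ⟨a1, b1, a2, b2, h1, h2, h3⟩ := hs
        have hBz : ∀ w, Ag E y w → Ag B y w := fun w hw => hw.mono hEB
        have comm : ∀ (w : ι → Fin 4) c a b, update (update (update w m c) l a) k b =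
            update (update (update w l a) k b) m c := by
          intro w c a b
          rw [update_comm hml, update_comm hmk]
        obtain ⟨c'', hc1, hc2, hc3, hc4⟩ := local_split
          (G := fun c a b => F (update (update (update y0 m c) l a) k b))
          (r := fun c a b => r (update (update (update y0 m c) l a) k b))
          (c := y0 m) (c' := z m) (a1 := a1) (a2 := a2) (b1 := b1) (b2 := b2)
          (by intro a b; simp only [comm]; exact hF m hmB _)
          (by intro c b; simp only [update_comm hlk]; exact hF l hlB _)
          (by intro c a; exact hF k hk _)
          (by intro c c' a b; simp only [comm]
              exact hr' _ (((hBz _ hy0).upd hlB _).upd hk _) m hmB _ _)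
          (by intro c a a' b; simp only [update_comm hlk]
              exact hr' _ (((hBz _ hy0).upd hmB _).upd hk _) l hlB _ _)
          (by intro c a b b'
              exact hr' _ (((hBz _ hy0).upd hmB _).upd hlB _) k hk _ _)
          (by simp only [update_eq_self]; exact h1)
          (by simp only [update_eq_self]; exact h2)
          (by simp only [update_eq_self]; exact h3)
          (by intro a b a' b' h h'
              by_contra h''
              exact hns ⟨a, b, a', b', h, h', h''⟩)
        simp only [update_eq_self] at hc3
        have i1 := ih y0 (update z m (y0 m)) hy0 (hz.upd hmE _) ⟨a1, b1, a2, b2, h1, h2, h3⟩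
          (by have := dist1 (y0 m); rwa [update_eq_self] at this)
          (fun w hw hs => by have := hmin w hw hs; have := dist2 w (y0 m); omega) a b
        have i2 := ih (update y0 m c'') (update z m c'') (hy0.upd hmE _) (hz.upd hmE _)
          hc4 (dist1 c'')
          (fun w hw hs => by have := hmin w hw hs; have := dist2 w c''; omega) a b
        rw [hc3] at i2
        rw [comm] at i1 i2
        have := (hF m hmB (update (update z l a) k b)).two hc1.symm hm hc2 (by rw [i1, i2])
        rw [i1, ← comm, update_eq_self] at this
        rw [this]; push_cast; ring
    intro x hx
    rw [not_Nn]
    -- reduce to base point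
    let z := update (update x l (y l)) k (y k)
    have hz : Ag E y z := by
      intro j hj
      by_cases h1 : j = k
      · subst h1; simp [z]
      · by_cases h2 : j = l
        · subst h2; simp [z, h1]
        · simp only [z, update_of_ne h1, update_of_ne h2]
          exact hx j (fun hjB => hj (by simp [E, hjB, h1, h2]))
    obtain ⟨z1, hz1, hs1⟩ := hex
    let S := (Finset.univ : Finset (ι → Fin 4)).filter (fun w => Ag E y w ∧ Sp w)
    have hSne : S.Nonempty := by
      refine ⟨update (update z1 l (y l)) k (y k), ?_⟩
      simp only [S, Finset.mem_filter, Finset.mem_univ, true_and]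
      refine ⟨?_, (Sp_upd _ _ _).2 hs1⟩
      intro j hj
      by_cases h1 : j = k
      · subst h1; simp
      · by_cases h2 : j = l
        · subst h2; simp [h1]
        · simp only [update_of_ne h1, update_of_ne h2]
          exact hz1 j (fun hjB => hj (by simp [E, hjB, h1, h2]))
    obtain ⟨y0, hy0, hmin⟩ := Finset.exists_min_image S (fun w => hammingDist w z) hSne
    simp only [S, Finset.mem_filter, Finset.mem_univ, true_and] at hy0 hmin
    have key := main _ y0 z hy0.1 hz hy0.2 rfl (fun w hw hs => hmin w ⟨hw, hs⟩)
    obtain ⟨a1, b1, a2, b2, h1, h2, h3⟩ := hy0.2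
    have hB0 := hy0.1.mono hEB
    obtain ⟨add, -⟩ := plane_split (G := fun a b => F (update (update y0 l a) k b))
      (r := fun a b => r (update (update y0 l a) k b))
      (by intro b; simp only [update_comm hlk]; exact hF l hlB _)
      (by intro a; exact hF k hk _)
      (by intro a a' b; simp only [update_comm hlk]
          exact hr' _ (hB0.upd hk _) l hlB _ _)
      (by intro a b b'
          exact hr' _ (hB0.upd hlB _) k hk _ _) h1 h2 h3
    have zx : ∀ a b, update (update z l a) k b = update (update x l a) k b := by
      intro a b
      simp only [z]
      rw [update_comm hlk.symm, update_idem, update_idem]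
    intro a a' b b'
    have k1 := key a b
    have k2 := key a' b
    have k3 := key a b'
    have k4 := key a' b'
    rw [zx] at k1 k2 k3 k4
    rw [k1, k2, k3, k4]
    have l1 := add a b
    have l2 := add a' b
    have l3 := add a b'
    have l4 := add a' b'
    rw [l1, l2, l3, l4]
    generalize ((hammingDist y0 z : ℕ) : ZMod 2) = t
    grind
  have := hc (B \ J) Finset.sdiff_subset ⟨i, by simp [hi, hiJ]⟩ hcl
  obtain ⟨j, hj⟩ := Finset.nonempty_iff_ne_empty.2 hJe
  have hjB := (Finset.mem_filter.1 hj).1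
  rw [← this] at hjB
  exact (Finset.mem_sdiff.1 hjB).2 hj

end
end QG

namespace QG
open Function
set_option linter.unusedSectionVars false
set_option linter.unusedVariables false
section
variable {ι : Type*} [DecidableEq ι]

lemma Nn_add {F : (ι → Fin 4) → ZMod 2} {l m x} (d : ZMod 2) :
    Nn (fun x => F x + d) l m x ↔ Nn F l m x := by
  unfold Nn
  have : ∀ a b c e : ZMod 2, a + d + (b + d) + (c + d) + (e + d) = a + b + c + e := by
    intro a b c e; grind
  simp only [this]
lemma Cl_add {F : (ι → Fin 4) → ZMod 2} {B : Finset ι} {y} {P} (d : ZMod 2) :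
    Cl (fun x => F x + d) B y P ↔ Cl F B y P := by
  unfold Cl; simp only [Nn_add]
lemma Conn_add {F : (ι → Fin 4) → ZMod 2} {B : Finset ι} {y} (d : ZMod 2) :
    Conn (fun x => F x + d) B y ↔ Conn F B y := by
  unfold Conn; simp only [Cl_add]

theorem thmA_e [Fintype ι] {R : Type*} {F : (ι → Fin 4) → ZMod 2} {B : Finset ι} {y : ι → Fin 4}
    (hF : BalOn F B) (hc : Conn F B y) {r : (ι → Fin 4) → R} (e : ZMod 2)
    (hr : ∀ x, Ag B y x → ∀ l ∈ B, ∀ v, F x = e → F (update x l v) = e → r x = r (update x l v)) :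
    ∀ x x', Ag B y x → Ag B y x' → F x = e → F x' = e → r x = r x' := by
  have key : ∀ a : ZMod 2, a + (e + 1) = 1 ↔ a = e := by intro a; constructor <;> intro h <;> grind
  have := thmA (F := fun x => F x + (e + 1)) (B := B) (y := y) (r := r)
    (fun l hl x => (hF l hl x).add (e+1)) ((Conn_add _).2 hc)
    (fun x hx l hl v h h' => hr x hx l hl v ((key _).1 h) ((key _).1 h'))
  intro x x' hx hx' h h'
  exact this x x' hx hx' ((key _).2 h) ((key _).2 h')

/-- cluster property -/
def Clu (f : (ι → Fin 4) → Fin 4) (B : Finset ι) (y : ι → Fin 4) (Z : Finset ι) : Prop :=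
  ∀ x x' w, Ag B y x → Ag B y w → Ag Z x x' → f x = f x' → f (Z.piecewise x w) = f (Z.piecewise x' w)

lemma pw_upd {P : Finset ι} {x w : ι → Fin 4} {l} (hl : l ∈ P) (v) :
    P.piecewise (update x l v) w = update (P.piecewise x w) l v := by
  funext i; by_cases hi : i = l
  · subst hi; simp [hl]
  · by_cases hi' : i ∈ P <;> simp [hi', hi]
lemma pw_upd' {P : Finset ι} {x w : ι → Fin 4} {l} (hl : l ∉ P) (v) :
    P.piecewise x (update w l v) = update (P.piecewise x w) l v := by
  funext i; by_cases hi : i = l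
  · subst hi; simp [hl]
  · by_cases hi' : i ∈ P <;> simp [hi', hi]
lemma pw_upd_off {P : Finset ι} {x w : ι → Fin 4} {l} (hl : l ∉ P) (v) :
    P.piecewise (update x l v) w = P.piecewise x w := by
  funext i; by_cases hi : i = l
  · subst hi; simp [hl]
  · by_cases hi' : i ∈ P <;> simp [hi', hi]
lemma pw_upd_on {P : Finset ι} {x w : ι → Fin 4} {l} (hl : l ∈ P) (v) :
    P.piecewise x (update w l v) = P.piecewise x w := by
  funext i; by_cases hi : i = l
  · subst hi; simp [hl]
  · by_cases hi' : i ∈ P <;> simp [hi', hi]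
lemma pw_ag {P : Finset ι} {x x' w : ι → Fin 4} (h : Ag P x x') : P.piecewise w x = P.piecewise w x' := by
  funext i; by_cases hi' : i ∈ P
  · simp [hi']
  · simp [hi', h i hi']
lemma Ag_pw {P : Finset ι} {x w : ι → Fin 4} : Ag P w (P.piecewise x w) := by
  intro i hi; simp [hi]
lemma pw_of_ag {P : Finset ι} {x w : ι → Fin 4} (h : Ag P x w) : P.piecewise x w = x := by
  funext i; by_cases hi' : i ∈ P
  · simp [hi']
  · simp [hi', h i hi']
lemma pw_pw {P : Finset ι} {x w u : ι → Fin 4} : P.piecewise (P.piecewise x w) u = P.piecewise x u := by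
  funext i; by_cases hi' : i ∈ P <;> simp [hi']
lemma pw_pw' {P : Finset ι} {x w u : ι → Fin 4} : P.piecewise u (P.piecewise x w) = P.piecewise u w := by
  funext i; by_cases hi' : i ∈ P <;> simp [hi']

lemma Lat.ne {f : (ι → Fin 4) → Fin 4} {V : Finset ι} (h : Lat f V) {l} (hl : l ∈ V) {x : ι → Fin 4} {v}
    (hv : v ≠ x l) : f x ≠ f (update x l v) := by
  intro e
  have := h l hl x (a₁ := x l) (a₂ := v) (by simpa using e)
  exact hv this.symm

theorem CLU [Fintype ι] {f : (ι → Fin 4) → Fin 4} {p : Fin 3} {B : Finset ι} {y : ι → Fin 4}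
    {Z : Finset ι} (hf : Lat f B) (hZ : Comp (fun x => ps p (f x)) B y Z) : Clu f B y Z := by
  intro x x' w hx hw hxx hfx
  obtain ⟨q, hq, -⟩ := exists_third p p
  have hZB := hZ.1
  have hx' : Ag B y x' := hx.trans (hxx.mono hZB)
  have inv : ∀ v, Ag Z x v → ∀ l ∈ Z, ∀ c, ps p (f v) = ps p (f (update v l c)) →
      ps q (f v) + ps q (f (Z.piecewise v w)) =
      ps q (f (update v l c)) + ps q (f (Z.piecewise (update v l c) w)) := by
    intro v hv l hl c hp
    by_cases hc : c = v l
    · subst hc; simp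
    have hvB := hx.trans (hv.mono hZB)
    have h1 := hf.ne (hZB hl) hc
    have h2 := hf.ne (x := Z.piecewise v w) (hZB hl) (v := c) (by simpa [hl] using hc)
    have h3 := hZ.2.2.1.single hl (hZB hl) hvB (hvB.pw hw Z) (fun i hi => by simp [hi]) c
    rw [pw_upd hl]
    have h4 := ps_sep hq.symm hp h1
    have h5 := ps_sep hq.symm (a := f (Z.piecewise v w)) (b := f (update (Z.piecewise v w) l c))
      (by rw [hp] at h3; grind) h2
    rw [h4, h5]; grind
  have key := thmA_e (hf.mono hZB |>.bal p) (hZ.conn hx) (ps p (f x))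
    (r := fun v => ps q (f v) + ps q (f (Z.piecewise v w)))
    (fun v hv l hl c h1 h2 => inv v hv l hl c (h1.trans h2.symm))
    x x' (Ag.refl _ _) hxx rfl (by rw [hfx])
  have k2 : ps p (f (Z.piecewise x w)) = ps p (f (Z.piecewise x' w)) := by
    have h1 := hZ.2.2.1.rect hx hw
    have h2 := hZ.2.2.1.rect hx' hw
    rw [← pw_ag hxx] at h2
    simp only [hfx] at h1 h2
    grind
  refine ps_ext hq.symm k2.symm ?_ |>.symm
  simp only [hfx] at key
  grind

/-- codes -/
def Code (C : Set (ι → Fin 4)) : Prop := ∀ x k, ∃! v, update x k v ∈ C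

noncomputable def sol (C : Set (ι → Fin 4)) (k : ι) (x : ι → Fin 4) : Fin 4 :=
  Classical.epsilon fun v => update x k v ∈ C

lemma Code.sol_mem {C : Set (ι → Fin 4)} (h : Code C) (k x) : update x k (sol C k x) ∈ C := by
  exact Classical.epsilon_spec (h x k).exists
lemma Code.sol_eq {C : Set (ι → Fin 4)} (h : Code C) {k x v} : update x k v ∈ C ↔ v = sol C k x :=
  ⟨fun hv => (h x k).unique hv (h.sol_mem k x), fun e => e ▸ h.sol_mem k x⟩
lemma Code.mem {C : Set (ι → Fin 4)} (h : Code C) (k) {x} : x ∈ C ↔ x k = sol C k x := by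
  rw [← h.sol_eq, update_eq_self]
lemma sol_upd (C : Set (ι → Fin 4)) (k x v) : sol C k (update x k v) = sol C k x := by
  unfold sol; simp only [update_idem]
lemma sol_congr (C : Set (ι → Fin 4)) (k) {x x'} (h : ∀ i, i ≠ k → x i = x' i) :
    sol C k x = sol C k x' := by
  rw [← sol_upd C k x (x' k)]
  congr 1; funext i
  by_cases hi : i = k
  · subst hi; simp
  · simp [hi, h i hi]
lemma Code.lat {C : Set (ι → Fin 4)} (h : Code C) {k} {V : Finset ι} (hk : k ∉ V) :
    Lat (sol C k) V := by
  intro l hl x v v' e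
  have hlk : l ≠ k := fun h => hk (h ▸ hl)
  have h1 := h.sol_mem k (update x l v)
  have h2 := h.sol_mem k (update x l v')
  simp only at e
  rw [update_comm hlk] at h1 h2
  rw [← e] at h2
  exact (h _ l).unique h1 h2
/-- perspective change -/
lemma Code.persp {C : Set (ι → Fin 4)} (h : Code C) {k l} (hkl : k ≠ l) {x} {a b} :
    sol C k (update x l b) = a ↔ sol C l (update x k a) = b := by
  rw [eq_comm, ← h.sol_eq, eq_comm (b := b), ← h.sol_eq, update_comm hkl]

variable [Fintype ι]

def SemiOn (C : Set (ι → Fin 4)) (D : Finset ι) (y : ι → Fin 4) : Prop :=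
  ∃ (P : ι → Fin 3) (c : ZMod 2), ∀ x ∈ C, Ag D y x → ∑ l ∈ D, ps (P l) (x l) = c

def Dif (C : Set (ι → Fin 4)) (D : Finset ι) (y : ι → Fin 4) (K : Finset ι) : Prop :=
  ∀ x w, Ag D y x → Ag D y w → x ∈ C → w ∈ C → K.piecewise x w ∈ C → K.piecewise w x ∈ C

/-- the `p`-function from coordinate `k`. -/
noncomputable abbrev Fk (C : Set (ι → Fin 4)) (k : ι) (p : Fin 3) : (ι → Fin 4) → ZMod 2 :=
  fun x => ps p (sol C k x)

lemma additive_of_singles {F : (ι → Fin 4) → ZMod 2} {B : Finset ι} {y : ι → Fin 4}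
    (hF : BalOn F B) (h : ∀ l ∈ B, Cl F B y {l}) :
    ∃ (s : ι → Fin 3) (c : ZMod 2), ∀ x, Ag B y x → F x = ∑ l ∈ B, ps (s l) (x l) + c := by
  have : ∀ l, ∃ s, ∃ c, l ∈ B → ∀ a, F (update y l a) = ps s a + c := by
    intro l
    by_cases hl : l ∈ B
    · obtain ⟨s, c, hs⟩ := hF l hl y
      exact ⟨s, c, fun _ => hs⟩
    · exact ⟨0, 0, fun h => absurd h hl⟩
  choose s c hs using this
  refine ⟨s, F y + ∑ l ∈ B, ps (s l) (y l), fun x hx => ?_⟩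
  have := chain (fun x => F x + ∑ l ∈ B, ps (s l) (x l)) B y B subset_rfl ?_ y x (Ag.refl _ _) hx
  · rw [← this]; grind
  · intro x hx m hm v
    have h1 := (h m hm).single (by simp) hm hx (Ag.refl B y |>.upd hm (x m))
      (fun i hi => by simp only [Finset.mem_singleton] at hi; subst hi; simp) v
    simp only [update_idem, hs m hm] at h1
    have h2 : ∑ l ∈ B, ps (s l) (update x m v l) =
        ∑ l ∈ B, ps (s l) (x l) + (ps (s m) v + ps (s m) (x m)) := by
      rw [← Finset.add_sum_erase B _ hm, ← Finset.add_sum_erase B (fun l => ps (s l) (x l)) hm]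
      have : ∑ l ∈ B.erase m, ps (s l) (update x m v l) = ∑ l ∈ B.erase m, ps (s l) (x l) :=
        Finset.sum_congr rfl (fun l hl => by rw [update_of_ne (Finset.ne_of_mem_erase hl)])
      rw [this]; simp; grind
    rw [h2]
    grind

lemma semi_of_singles {C : Set (ι → Fin 4)} (h : Code C) {D : Finset ι} {y} {k} (hk : k ∈ D) {p}
    (hs : ∀ l ∈ D.erase k, Cl (Fk C k p) (D.erase k) y {l}) : SemiOn C D y := by
  obtain ⟨s, c, hsc⟩ := additive_of_singles (h.lat (by simp) |>.bal p) hs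
  refine ⟨update s k p, c, fun x hx hxD => ?_⟩
  have hx2 : Ag (D.erase k) y (update x k (y k)) := by
    intro i hi
    by_cases e : i = k
    · subst e; simp
    · simp only [update_of_ne e]; exact hxD i (fun hD => hi (by simp [e, hD]))
  have h1 := hsc _ hx2
  simp only [sol_upd, ← (h.mem k).1 hx] at h1
  rw [← Finset.add_sum_erase D _ hk]
  have : ∑ l ∈ D.erase k, ps (update s k p l) (x l) = ∑ l ∈ D.erase k, ps (s l) (update x k (y k) l) :=
    Finset.sum_congr rfl (fun l hl => by
      rw [update_of_ne (Finset.ne_of_mem_erase hl), update_of_ne (Finset.ne_of_mem_erase hl)])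
  rw [this]; simp [h1]; grind

lemma ag_erase {D : Finset ι} {y x : ι → Fin 4} {k} (h : Ag D y x) :
    Ag (D.erase k) y (update x k (y k)) := by
  intro i hi
  by_cases e : i = k
  · subst e; simp
  · simp only [update_of_ne e]; exact h i (fun hD => hi (by simp [e, hD]))

lemma dif_of_clu {C : Set (ι → Fin 4)} (h : Code C) {D : Finset ι} {y} {k} (hk : k ∈ D) {Z}
    (hZ : Z ⊆ D.erase k) (hc : Clu (sol C k) (D.erase k) y Z) : Dif C D y Z := by
  intro x w hx hw hxC hwC hxw
  have hkZ : k ∉ Z := fun h' => by simpa using hZ h'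
  have := hc (update w k (y k)) (update (Z.piecewise x w) k (y k)) (update x k (y k))
    (ag_erase hw) (ag_erase hx) ?_ ?_
  · rw [pw_upd_off hkZ, pw_upd_off hkZ, pw_upd' hkZ, pw_upd' hkZ, sol_upd, sol_upd, pw_pw,
      Finset.piecewise_same] at this
    rw [h.mem k, this]
    simpa [hkZ] using (h.mem k).1 hxC
  · intro i hi
    by_cases e : i = k
    · subst e; simp
    · simp [e, hi]
  · rw [sol_upd, sol_upd, ← (h.mem k).1 hwC, ← (h.mem k).1 hxw]
    simp [hkZ]

lemma clu_of_dif {C : Set (ι → Fin 4)} (h : Code C) {D : Finset ι} {y} {k} (hk : k ∈ D) {Z}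
    (hkZ : k ∉ Z) (hZD : Z ⊆ D) (hc : Dif C D y Z) : Clu (sol C k) (D.erase k) y Z := by
  intro x x' w hx hw hxx hf
  have hD : D.erase k ⊆ D := Finset.erase_subset _ _
  set g := sol C k (Z.piecewise x w) with hg
  have e1 : update (Z.piecewise x w) k g ∈ C := h.sol_mem _ _
  have e2 : update x k (sol C k x) ∈ C := h.sol_mem _ _
  have e3 : update x' k (sol C k x) ∈ C := by rw [hf]; exact h.sol_mem _ _
  have hx' : Ag D y x' := (hx.mono hD).trans (hxx.mono hZD)
  have := hc (update (Z.piecewise x w) k g) (update x' k (sol C k x))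
    ((hx.mono hD).pw (hw.mono hD) Z |>.upd hk _) (hx'.upd hk _) e1 e3 (by
      rw [pw_upd_off hkZ, pw_upd' hkZ, pw_pw, ← pw_ag hxx, Finset.piecewise_same]; exact e2)
  rw [pw_upd_off hkZ, pw_upd' hkZ, pw_pw', h.sol_eq] at this
  exact this

/-- B : disconnected implies semilinear or decomposed -/
theorem thmB {C : Set (ι → Fin 4)} (h : Code C) {D : Finset ι} {y} {k} (hk : k ∈ D) {p}
    (hd : Disc (Fk C k p) (D.erase k) y) :
    SemiOn C D y ∨ ∃ K, 2 ≤ K.card ∧ K.card + 2 ≤ D.card ∧ Comp (Fk C k p) (D.erase k) y K ∧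
      Dif C D y K := by
  by_cases hs : ∀ l ∈ D.erase k, Cl (Fk C k p) (D.erase k) y {l}
  · exact Or.inl (semi_of_singles h hk hs)
  right
  push Not at hs
  obtain ⟨l, hl, hn⟩ := hs
  obtain ⟨Z, hlZ, hZ⟩ := exists_comp (Fk C k p) (D.erase k) y hl
  have hne : Z ≠ D.erase k := by
    intro e
    obtain ⟨P, hP, hPn, hPne, hcl⟩ := hd
    exact hPne (e ▸ hZ.2.2.2 P (e ▸ hP) hPn hcl)
  refine ⟨Z, ?_, ?_, hZ, dif_of_clu h hk hZ.1 (CLU (h.lat (by simp)) hZ)⟩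
  · by_contra hlt
    have : Z.card = 1 := by have := Finset.card_pos.2 hZ.2.1; omega
    obtain ⟨a, ha⟩ := Finset.card_eq_one.1 this
    subst ha
    simp at hlZ; subst hlZ
    exact hn hZ.2.2.1
  · have h1 := Finset.card_lt_card (Finset.ssubset_iff_subset_ne.2 ⟨hZ.1, hne⟩)
    rw [Finset.card_erase_of_mem hk] at h1
    omega

lemma ps_pair {a a' : Fin 4} (h : a ≠ a') : ∃ w e, ∀ v, ps w v = e ↔ (v = a ∨ v = a') := by
  revert a a'; decide

/-- T1 -/
theorem T1 {f : (ι → Fin 4) → Fin 4} {V : Finset ι} {y : ι → Fin 4} (hf : Lat f V)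
    (hconn : ∀ p, Conn (fun x => ps p (f x)) V y) {K : Finset ι} (hKV : K ⊆ V) (hK : K.Nonempty)
    (hKV' : K ≠ V) {a a' : Fin 4} (haa : a ≠ a')
    (H : ∀ x x' w, Ag V y x → Ag V y w → Ag K x x' → f x = a → f x' = a →
      (f (K.piecewise x w) = a → f (K.piecewise x' w) = a) ∧
      (f (K.piecewise x w) = a' → f (K.piecewise x' w) = a')) : Clu f V y K := by
  classical
  obtain ⟨l0, hl0⟩ := hK
  obtain ⟨m0, hm0V, hm0⟩ : ∃ m ∈ V, m ∉ K := by
    by_contra h; push Not at h; exact hKV' (subset_antisymm hKV h)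
  obtain ⟨w, e, hwe⟩ := ps_pair haa
  obtain ⟨q, hq, -⟩ := exists_third w w
  have bij : ∀ l ∈ V, ∀ x c, ∃ v, f (update x l v) = c := fun l hl x c =>
    (Finite.injective_iff_surjective.1 (hf l hl x)) c
  -- representative
  have ex : ∀ x, ∃ v, Ag V y x → ∀ u, Ag V y u → ∀ b, b = a ∨ b = a' →
      (f (K.piecewise x u) = b ↔ f (K.piecewise (update y l0 v) u) = b) := by
    intro x
    by_cases hx : Ag V y x
    swap
    · exact ⟨0, fun h => absurd h hx⟩
    obtain ⟨c, hc⟩ := bij m0 hm0V x a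
    obtain ⟨v, hv⟩ := bij l0 (hKV hl0) (K.piecewise y (update x m0 c)) a
    refine ⟨v, fun _ u hu => ?_⟩
    rw [← pw_upd hl0] at hv
    have hxc := hx.upd hm0V c
    have hyv := (Ag.refl V y).upd (hKV hl0) v
    have A1 : Ag K (update x m0 c) (K.piecewise (update y l0 v) (update x m0 c)) := Ag_pw
    have h1 := H _ _ u hxc hu A1 hc hv
    have h2 := H _ _ u (hyv.pw hxc K) hu A1.symm hv hc
    rw [pw_pw, pw_upd_off hm0] at h1 h2
    rintro b (rfl | rfl)
    · exact ⟨h1.1, h2.1⟩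
    · exact ⟨h1.2, h2.2⟩
  choose ρ hρ using ex
  let hat : (ι → Fin 4) → ι → Fin 4 := fun x => K.piecewise (update y l0 (ρ x)) x
  have hatV : ∀ x, Ag V y x → Ag V y (hat x) := fun x hx =>
    ((Ag.refl V y).upd (hKV hl0) _).pw hx K
  have h0 : ∀ x, Ag V y x → ∀ b, b = a ∨ b = a' → (f x = b ↔ f (hat x) = b) := by
    intro x hx b hb
    have := hρ x hx x hx b hb
    rwa [Finset.piecewise_same] at this
  -- uniqueness of rho
  have ρu : ∀ x x', Ag V y x → Ag V y x' → (∃ u, Ag V y u ∧ f (K.piecewise x u) = a ∧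
      f (K.piecewise x' u) = a) → ρ x = ρ x' := by
    rintro x x' hx hx' ⟨u, hu, h1, h2⟩
    have h1 := (hρ x hx u hu a (Or.inl rfl)).1 h1
    have h2 := (hρ x' hx' u hu a (Or.inl rfl)).1 h2
    rw [pw_upd hl0] at h1 h2
    exact hf l0 (hKV hl0) _ (h1.trans h2.symm)
  have ρu' : ∀ x x', Ag V y x → Ag V y x' → ρ x = ρ x' → ∀ u, Ag V y u →
      f (K.piecewise x u) = a → f (K.piecewise x' u) = a := by
    intro x x' hx hx' he u hu h
    have h1 := (hρ x hx u hu a (Or.inl rfl)).1 h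
    rw [he] at h1
    exact (hρ x' hx' u hu a (Or.inl rfl)).2 h1
  have ρoff : ∀ x, Ag V y x → ∀ m ∈ V, m ∉ K → ∀ v, ρ (update x m v) = ρ x := by
    intro x hx m hm hmK v
    obtain ⟨c, hc⟩ := bij m0 hm0V x a
    refine ρu _ _ (hx.upd hm v) hx ⟨update x m0 c, hx.upd hm0V c, ?_, ?_⟩
    · rw [pw_upd_off hmK, pw_upd' hm0, Finset.piecewise_same]; exact hc
    · rw [pw_upd' hm0, Finset.piecewise_same]; exact hc
  have Sc : ∀ x, Ag V y x → (ps w (f (hat x)) = ps w (f x)) := by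
    intro x hx
    have h1 := h0 x hx a (Or.inl rfl)
    have h2 := h0 x hx a' (Or.inr rfl)
    have h3 := hwe (f x)
    have h4 := hwe (f (hat x))
    have h5 : ps w (f (hat x)) = e ↔ ps w (f x) = e := by rw [h3, h4, h1, h2]
    clear * - h5
    generalize ps w (f (hat x)) = s at *
    generalize ps w (f x) = t at *
    revert s t e; decide
  have key := thmA_e (hf.bal w) (hconn w) (e + 1)
    (r := fun x => ps q (f x) + ps q (f (hat x))) ?_
  · -- conclude f x = f (hat x)
    have fhat : ∀ x, Ag V y x → f x = f (hat x) := by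
      intro x hx
      by_cases hS : ps w (f x) = e
      · rcases (hwe _).1 hS with hh | hh
        · rw [hh, (h0 x hx _ (Or.inl rfl)).1 hh]
        · rw [hh, (h0 x hx _ (Or.inr rfl)).1 hh]
      · have hS := z2ne.1 hS
        have hh := hatV x hx
        have hhat : hat (hat x) = hat x := by
          have hhρ : ρ (hat x) = ρ x := by
            obtain ⟨c, hc⟩ := bij m0 hm0V (hat x) a
            have hA := hh.upd hm0V c
            have h1 : f (K.piecewise (hat x) (update (hat x) m0 c)) = a := by
              rw [pw_upd' hm0, Finset.piecewise_same, hc]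
            refine ρu _ _ hh hx ⟨_, hA, h1, ?_⟩
            rw [hρ x hx _ hA a (Or.inl rfl)]
            simp only [hat, pw_pw] at h1
            exact h1
          simp only [hat]
          simp only [hat] at hhρ
          rw [hhρ, pw_pw']
        have := key x (hat x) hx hh hS (by rw [Sc x hx, hS])
        simp only [hhat] at this
        refine ps_ext hq ?_ (Sc x hx).symm
        grind
    intro x x' u hx hu hxx hff
    have hx' : Ag V y x' := hx.trans (hxx.mono hKV)
    have e1 := fhat x hx
    have e2 := fhat x' hx'
    have hρρ : ρ x = ρ x' := by
      rw [e1, e2] at hff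
      simp only [hat] at hff
      rw [← pw_ag hxx, pw_upd hl0, pw_upd hl0] at hff
      exact hf l0 (hKV hl0) _ hff
    have pwρ : ∀ x, Ag V y x → ρ (K.piecewise x u) = ρ x := by
      intro x hx
      obtain ⟨c, hc⟩ := bij m0 hm0V x a
      refine ρu _ _ (hx.pw hu K) hx ⟨update x m0 c, hx.upd hm0V c, ?_, ?_⟩
      · rw [pw_pw, pw_upd' hm0, Finset.piecewise_same]; exact hc
      · rw [pw_upd' hm0, Finset.piecewise_same]; exact hc
    rw [fhat _ (hx.pw hu K), fhat _ (hx'.pw hu K)]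
    simp only [hat, pwρ x hx, pwρ x' hx', hρρ, pw_pw']
  · intro x hx l hl v h1 h2
    by_cases hv : v = x l
    · subst hv; simp
    have hne := hf.ne hl hv
    have s1 := ps_sep hq.symm (h1.trans h2.symm) hne
    have hp : ps w (f (hat x)) = ps w (f (hat (update x l v))) := by
      rw [Sc x hx, Sc _ (hx.upd hl v), h1, h2]
    have hne2 : f (hat x) ≠ f (hat (update x l v)) := by
      by_cases hlK : l ∈ K
      · have : ρ x ≠ ρ (update x l v) := by
          intro he
          obtain ⟨c, hc⟩ := bij m0 hm0V x a
          have h3 := ρu' x _ hx (hx.upd hl v) he (update x m0 c) (hx.upd hm0V c) (by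
            rw [pw_upd' hm0, Finset.piecewise_same]; exact hc)
          rw [pw_upd' hm0, pw_upd hlK, Finset.piecewise_same] at h3
          have hlm : l ≠ m0 := fun h => hm0 (h ▸ hlK)
          rw [update_comm hlm] at h3
          exact hf.ne (x := update x m0 c) hl (v := v) (by simpa [hlm] using hv) (hc.trans h3.symm)
        simp only [hat, pw_upd_on hlK]
        rw [pw_upd hl0, pw_upd hl0]
        exact fun h => this (hf l0 (hKV hl0) _ h)
      · simp only [hat]
        rw [ρoff x hx l hl hlK v, pw_upd' hlK]
        exact hf.ne hl (by simpa [hlK] using hv)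
    have s2 := ps_sep hq.symm hp hne2
    simp only [s1, s2]; grind

end
end QG

namespace QG
open Function
set_option linter.unusedSectionVars false
set_option linter.unusedVariables false
section
variable {ι : Type*} [DecidableEq ι] [Fintype ι]

def chi (V : Finset ι) (P : ι → Fin 3) (c : ZMod 2) (x : ι → Fin 4) : ZMod 2 :=
  ∑ l ∈ V, ps (P l) (x l) + c

lemma chi_upd {V : Finset ι} {P : ι → Fin 3} {c : ZMod 2} {x : ι → Fin 4} {l} (hl : l ∈ V) (v) :
    chi V P c (update x l v) = chi V P c x + (ps (P l) v + ps (P l) (x l)) := by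
  unfold chi
  rw [← Finset.add_sum_erase V _ hl, ← Finset.add_sum_erase V (fun i => ps (P i) (x i)) hl]
  have : ∑ i ∈ V.erase l, ps (P i) (update x l v i) = ∑ i ∈ V.erase l, ps (P i) (x i) :=
    Finset.sum_congr rfl (fun i hi => by rw [update_of_ne (Finset.ne_of_mem_erase hi)])
  rw [this, update_self]; grind

lemma chi_bal {V : Finset ι} {P : ι → Fin 3} {c : ZMod 2} : BalOn (chi V P c) V := fun l hl x =>
  ⟨P l, chi V P c x + ps (P l) (x l), fun v => by simp only [chi_upd hl]; ring⟩

lemma chi_not_conn {F : (ι → Fin 4) → ZMod 2} {V : Finset ι} {y} {P : ι → Fin 3} {c : ZMod 2}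
    (hV : 2 ≤ V.card) (h : ∀ x, Ag V y x → F x = chi V P c x) (hc : Conn F V y) : False := by
  obtain ⟨l, hl, m, hm, hlm⟩ := Finset.one_lt_card.1 hV
  have : Cl F V y {l} := by
    intro i hi hiV j hj hij x hx
    rw [not_Nn]
    have hji : j ≠ i := by rintro rfl; exact hij hi
    intro a a' b b'
    rw [h _ ((hx.upd hiV _).upd hj _), h _ ((hx.upd hiV _).upd hj _),
      h _ ((hx.upd hiV _).upd hj _), h _ ((hx.upd hiV _).upd hj _)]
    simp only [chi_upd hj, chi_upd hiV, update_of_ne hji]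
    grind
  have e := hc {l} (by simpa using hl) ⟨l, by simp⟩ this
  have hm' : m ∈ ({l} : Finset ι) := e ▸ hm
  simp at hm'; exact hlm hm'.symm

lemma Lat.surj {f : (ι → Fin 4) → Fin 4} {V : Finset ι} (h : Lat f V) {l} (hl : l ∈ V) (x c) :
    ∃ v, f (update x l v) = c := Finite.injective_iff_surjective.1 (h l hl x) c

lemma ps_q_choice {a a' : Fin 4} (h : a ≠ a') {w : Fin 3} {e : ZMod 2}
    (hw : ∀ v, ps w v = e ↔ (v = a ∨ v = a')) (b : Fin 4) (hb : ps w b = e + 1) (t : ZMod 2) :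
    ∃ q, q ≠ w ∧ ps q a = ps q b + t := by
  revert a a' w e b t; decide

variable {f : (ι → Fin 4) → Fin 4} {V : Finset ι} {y : ι → Fin 4}

lemma fin4_pair {P : Fin 3} {a b c : Fin 4} (h : ps P a = ps P b) (h' : ps P c = ps P b)
    (hab : a ≠ b) : c = a ∨ c = b := by revert P a b c; decide

lemma T2_same (hf : Lat f V) (hconn : ∀ p, Conn (fun x => ps p (f x)) V y) (hV : 2 ≤ V.card)
    {a a' : Fin 4} (haa : a ≠ a') {P : ι → Fin 3} {c c' : ZMod 2}
    (h0 : ∀ x, Ag V y x → f x = a → chi V P c x = 0)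
    (h1 : ∀ x, Ag V y x → f x = a' → chi V P c' x = 0) : False := by
  obtain ⟨w, e, hwe⟩ := ps_pair haa
  obtain ⟨l, hl, -⟩ := Finset.one_lt_card.1 hV
  have hcc : ∀ x, chi V P c' x = chi V P c x + (c + c') := by
    intro x; unfold chi; grind
  by_cases hc : c = c'
  · subst hc
    refine chi_not_conn (P := P) (c := c + e) hV (fun x hx => ?_) (hconn w)
    have hx0 : chi V P (c + e) x = chi V P c x + e := by unfold chi; ring
    rw [hx0]
    have := (hf.bal w l hl x).add (e + 1) |>.sub' (chi_bal (P := P) (c := c) l hl x) (fun v hv => by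
      have hv : ps w (f (update x l v)) = e := by grind
      rcases (hwe _).1 hv with h | h
      · exact h0 _ (hx.upd hl v) h
      · exact h1 _ (hx.upd hl v) h) (x l)
    simp only [update_eq_self] at this
    grind
  · have hc := z2ne.1 hc
    have hcc : ∀ x, chi V P c' x = chi V P c x + 1 := by intro x; rw [hcc]; grind
    -- a point in S^c
    obtain ⟨v0, hv0⟩ := (hf.bal w l hl y).ex (e + 1)
    have hx0 := (Ag.refl V y).upd hl v0
    obtain ⟨q, hq, hqt⟩ := ps_q_choice haa hwe _ hv0 (chi V P c (update y l v0))
    have key := thmA_e (hf.bal w) (hconn w) (e + 1) (r := fun x => chi V P c x + ps q (f x)) ?_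
    · refine chi_not_conn (P := P) (c := c + ps q a) hV (fun x hx => ?_) (hconn q)
      have hx2 : chi V P (c + ps q a) x = chi V P c x + ps q a := by unfold chi; ring
      rw [hx2]
      by_cases hS : ps w (f x) = e
      · rcases (hwe _).1 hS with h | h
        · rw [h, h0 x hx h]; simp
        · have h3 := h1 x hx h
          rw [hcc] at h3
          have h4 := ps_sep hq.symm (a := a) (b := a') (by
            rw [(hwe a).2 (Or.inl rfl), (hwe a').2 (Or.inr rfl)]) haa
          rw [h]; grind
      · have := key x _ hx hx0 (z2ne.1 hS) hv0
        grind
    · intro x hx m hm v hS hS'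
      by_cases hv : v = x m
      · subst hv; simp
      have hne := hf.ne hm hv
      have s1 := ps_sep hq.symm (hS.trans hS'.symm) hne
      obtain ⟨u, hu⟩ := hf.surj hm x a
      obtain ⟨u', hu'⟩ := hf.surj hm x a'
      have k1 := h0 _ (hx.upd hm u) hu
      have k2 := h1 _ (hx.upd hm u') hu'
      rw [hcc] at k2
      have nw : ∀ z, ps w (f z) = e + 1 → f z ≠ a ∧ f z ≠ a' := by
        intro z hz
        have : ps w (f z) ≠ e := by rw [hz]; simp
        rw [Ne, hwe] at this
        push Not at this; exact this
      have d1 : u ≠ u' := by rintro rfl; exact haa (hu.symm.trans hu')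
      have d2 : u ≠ v := by rintro rfl; exact (nw _ hS').1 hu
      have d3 : u' ≠ v := by rintro rfl; exact (nw _ hS').2 hu'
      have d4 : u ≠ x m := by rintro rfl; rw [update_eq_self] at hu; exact (nw _ hS).1 hu
      have d5 : u' ≠ x m := by rintro rfl; rw [update_eq_self] at hu'; exact (nw _ hS).2 hu'
      have := (chi_bal (P := P) (c := c) m hm x).sum4 d1 d2 d4 d3 d5 hv
      simp only [update_eq_self] at this
      simp only [s1]
      grind

lemma T2_L0 (hf : Lat f V) {a : Fin 4} {P P' : ι → Fin 3} {c c' : ZMod 2}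
    (h0 : ∀ x, Ag V y x → f x = a → chi V P c x = 0) {z : ι → Fin 4} (E : Finset ι) :
    E ⊆ V → (∀ l ∈ E, P l ≠ P' l) → ∀ x, Ag V y x → Ag E x z →
    (∀ l ∈ E, ps (P l) (x l) = ps (P l) (z l)) → chi V P c x = 0 →
    (if f z = a then (1 : ZMod 2) else 0) + chi V P' c' z =
      (if f x = a then (1 : ZMod 2) else 0) + chi V P' c' x := by
  induction E using Finset.induction_on with
  | empty =>
    intro _ _ x _ h _ _
    have : z = x := funext fun i => h i (by simp)
    rw [this]
  | insert m E hm ih =>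
    intro hE hPP x hx hxz hp hc0
    have hmV : m ∈ V := hE (by simp)
    have hpm := hp m (by simp)
    have hc1 : chi V P c (update x m (z m)) = 0 := by rw [chi_upd hmV, hc0, hpm]; grind
    rw [ih (fun i hi => hE (by simp [hi])) (fun i hi => hPP i (by simp [hi])) (update x m (z m))
      (hx.upd hmV _) ?_ ?_ hc1]
    · by_cases hv : z m = x m
      · rw [hv, update_eq_self]
      rw [chi_upd hmV, ps_sep (hPP m (by simp)) hpm.symm hv]
      obtain ⟨u, hu⟩ := hf.surj hmV x a
      have hu0 := h0 _ (hx.upd hmV u) hu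
      rw [chi_upd hmV, hc0] at hu0
      rcases fin4_pair (c := u) hpm.symm (by grind) hv with h | h
      · subst h
        have hne := hf.ne hmV hv
        rw [hu] at hne
        rw [if_pos hu, if_neg hne]; grind
      · subst h
        have hne := hf.ne hmV hv
        rw [update_eq_self] at hu
        rw [hu] at hne
        rw [if_pos hu, if_neg hne.symm]; grind
    · intro i hi
      by_cases e : i = m
      · subst e; simp
      · rw [update_of_ne e]; exact hxz i (by simp [e, hi])
    · intro l hl
      have : l ≠ m := by rintro rfl; exact hm hl
      rw [update_of_ne this]; exact hp l (by simp [hl])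

lemma ps_inter {p p' : Fin 3} (h : p ≠ p') (a b : Fin 4) : ∃ v, ps p v = ps p a ∧ ps p' v = ps p' b := by
  revert p p' a b; decide

lemma chi_congr {P : ι → Fin 3} {c : ZMod 2} {x z : ι → Fin 4}
    (h : ∀ l ∈ V, ps (P l) (x l) = ps (P l) (z l)) : chi V P c x = chi V P c z := by
  unfold chi; rw [Finset.sum_congr rfl h]

lemma T2_trick (hf : Lat f V) {a a' : Fin 4} (haa : a ≠ a') {P P' : ι → Fin 3} {c c' : ZMod 2}
    (h0 : ∀ x, Ag V y x → f x = a → chi V P c x = 0)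
    (h1 : ∀ x, Ag V y x → f x = a' → chi V P' c' x = 0) {D : Finset ι} (hD : D ⊆ V)
    (hDP : ∀ l ∈ D, P l ≠ P' l) {x z} (hx : Ag V y x) (hxz : Ag D x z) (hfx : f x = a)
    (hfz : f z = a') (e1 : chi V P' c' x = 0) (e2 : chi V P c z = 0) : False := by
  have : ∀ l, ∃ v, (l ∈ D → ps (P l) v = ps (P l) (x l) ∧ ps (P' l) v = ps (P' l) (z l)) ∧
      (l ∉ D → v = x l) := by
    intro l
    by_cases hl : l ∈ D
    · obtain ⟨v, hv⟩ := ps_inter (hDP l hl) (x l) (z l)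
      exact ⟨v, fun _ => hv, fun h => absurd hl h⟩
    · exact ⟨x l, fun h => absurd h hl, fun _ => rfl⟩
  choose t ht ht' using this
  have hxt : Ag D x t := fun l hl => ht' l hl
  have hzt : Ag D z t := hxz.symm.trans hxt
  have hz : Ag V y z := hx.trans (hxz.mono hD)
  have k1 := T2_L0 (P' := P') (c' := c') hf h0 D hD hDP x hx hxt (fun l hl => (ht l hl).1.symm)
    (h0 x hx hfx)
  have k2 := T2_L0 (P := P') (P' := P) (c' := c) hf h1 D hD (fun l hl => (hDP l hl).symm) z hz hzt
    (fun l hl => (ht l hl).2.symm) (h1 z hz hfz)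
  have t1 : chi V P' c' t = 0 := by
    rw [← h1 z hz hfz]
    refine chi_congr fun l _ => ?_
    by_cases hl : l ∈ D
    · exact (ht l hl).2
    · rw [ht' l hl, hxz l hl]
  have t2 : chi V P c t = 0 := by
    rw [← h0 x hx hfx]
    refine chi_congr fun l _ => ?_
    by_cases hl : l ∈ D
    · exact (ht l hl).1
    · rw [ht' l hl]
  rw [t1, e1, if_pos hfx] at k1
  rw [t2, e2, if_pos hfz] at k2
  have r1 : f t = a := by by_contra h; rw [if_neg h] at k1; exact absurd k1 (by decide)
  have r2 : f t = a' := by by_contra h; rw [if_neg h] at k2; exact absurd k2 (by decide)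
  exact haa (r1.symm.trans r2)

/-- constancy of the second character on `D`-sections -/
lemma T2_const (hf : Lat f V) {a a' : Fin 4} (haa : a ≠ a') {P P' : ι → Fin 3} {c c' : ZMod 2}
    (h0 : ∀ x, Ag V y x → f x = a → chi V P c x = 0)
    (h1 : ∀ x, Ag V y x → f x = a' → chi V P' c' x = 0) {D : Finset ι} (hD : D ⊆ V)
    (hDne : D.Nonempty)
    (hDP : ∀ l ∈ D, P l ≠ P' l) {m} (hm : m ∈ V) (hmD : m ∉ D) (hmP : P m = P' m)
    {x x'} (hx : Ag V y x) (hxx : Ag D x x') (hfx : f x = a)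
    (hfx' : f x' = a) (e1 : chi V P' c' x = 0) : chi V P' c' x' = 0 := by
  rcases z2c (chi V P' c' x') with h | e2
  · exact h
  exfalso
  have hx' : Ag V y x' := hx.trans (hxx.mono hD)
  have par : ∀ (p : Fin 3) (v : Fin 4), ∃ b, b ≠ v ∧ ps p b = ps p v := by decide
  obtain ⟨β, hβ, hβp⟩ := par (P m) (x m)
  obtain ⟨l, hl⟩ := hDne
  have hlV := hD hl
  obtain ⟨γ, hγ, hγp⟩ := par (P l) (x' l)
  have hlm : l ≠ m := fun h => hmD (h ▸ hl)
  have hxm : x' m = x m := hxx m hmD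
  have c0 := h0 x hx hfx
  have c0' := h0 x' hx' hfx'
  -- update x m β ∈ A1
  have k1 : f (update x m β) = a' := by
    obtain ⟨u, hu⟩ := hf.surj hm x a'
    have hu1 := h1 _ (hx.upd hm u) hu
    rw [chi_upd hm, e1, ← hmP] at hu1
    rcases fin4_pair (c := u) hβp (by grind) hβ with h | h
    · rwa [← h]
    · rw [h, update_eq_self] at hu; exact absurd (hfx.symm.trans hu) haa
  -- the modified x'
  have k2 : f (update (update x' l γ) m β) = a := by
    obtain ⟨u, hu⟩ := hf.surj hm (update x' l γ) a
    have hu1 := h0 _ ((hx'.upd hlV γ).upd hm u) hu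
    rw [chi_upd hm, chi_upd hlV, c0', hγp, update_of_ne hlm.symm, hxm] at hu1
    rcases fin4_pair (c := u) hβp (by grind) hβ with h | h
    · rwa [← h]
    · rw [h, ← hxm] at hu
      have : update (update x' l γ) m (x' m) = update x' l γ := by
        conv_lhs => rw [show x' m = update x' l γ m by rw [update_of_ne hlm.symm], update_eq_self]
      rw [this] at hu
      exact absurd (hfx'.trans hu.symm) (hf.ne hlV hγ)
  refine T2_trick hf haa h0 h1 hD hDP ((hx'.upd hlV γ).upd hm β) ?_ k2 k1 ?_ ?_
  · intro i hi
    have hil : i ≠ l := by rintro rfl; exact hi hl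
    by_cases him : i = m
    · subst him; simp
    · simp only [update_of_ne him, update_of_ne hil]; exact (hxx i hi).symm
  · rw [chi_upd hm, chi_upd hlV, update_of_ne hlm.symm, hxm, e2, ← hmP, hβp,
      ps_sep (hDP l hl) hγp hγ]
    grind
  · rw [chi_upd hm, c0, hβp]; grind

lemma T2_const' (hf : Lat f V) {a a' : Fin 4} (haa : a ≠ a') {P P' : ι → Fin 3} {c c' : ZMod 2}
    (h0 : ∀ x, Ag V y x → f x = a → chi V P c x = 0)
    (h1 : ∀ x, Ag V y x → f x = a' → chi V P' c' x = 0) {D : Finset ι} (hD : D ⊆ V)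
    (hDne : D.Nonempty)
    (hDP : ∀ l ∈ D, P l ≠ P' l) {m} (hm : m ∈ V) (hmD : m ∉ D) (hmP : P m = P' m)
    {x x'} (hx : Ag V y x) (hxx : Ag D x x') (hfx : f x = a)
    (hfx' : f x' = a) : chi V P' c' x = chi V P' c' x' := by
  have hx' : Ag V y x' := hx.trans (hxx.mono hD)
  have k1 := T2_const hf haa h0 h1 hD hDne hDP hm hmD hmP hx hxx hfx hfx'
  have k2 := T2_const hf haa h0 h1 hD hDne hDP hm hmD hmP hx' hxx.symm hfx' hfx
  rcases z2c (chi V P' c' x) with h | h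
  · rw [k1 h, h]
  · rcases z2c (chi V P' c' x') with h' | h'
    · rw [k2 h', h']
    · rw [h, h']

/-- membership criterion -/
lemma T2_mem (hf : Lat f V) {a a' : Fin 4} (haa : a ≠ a') {P P' : ι → Fin 3} {c c' : ZMod 2}
    (h0 : ∀ x, Ag V y x → f x = a → chi V P c x = 0)
    (h1 : ∀ x, Ag V y x → f x = a' → chi V P' c' x = 0) {D : Finset ι} (hD : D ⊆ V)
    (hDne : D.Nonempty)
    (hDP : ∀ l ∈ D, P l ≠ P' l) {m} (hm : m ∈ V) (hmD : m ∉ D) (hmP : P m = P' m)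
    {x x'} (hx : Ag V y x) (hxx : Ag D x x') (hfx : f x = a)
    (e0 : chi V P c x' = 0) (e1 : chi V P' c' x' = chi V P' c' x) : f x' = a := by
  have hx' : Ag V y x' := hx.trans (hxx.mono hD)
  obtain ⟨l, hl⟩ := hDne
  obtain ⟨v, hv⟩ := hf.surj (hD hl) x' a
  have k1 := h0 _ (hx'.upd (hD hl) v) hv
  have k2 := T2_const' hf haa h0 h1 hD ⟨l, hl⟩ hDP hm hmD hmP hx (hxx.upd hl v) hfx hv
  rw [chi_upd (hD hl)] at k1 k2
  have : v = x' l := ps_ext (hDP l hl) (by grind) (by grind)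
  rw [this, update_eq_self] at hv
  exact hv

theorem T2 (hf : Lat f V) (hconn : ∀ p, Conn (fun x => ps p (f x)) V y) (hV : 3 ≤ V.card)
    (hirr : ∀ K, K ⊆ V → 2 ≤ K.card → K ≠ V → ¬ Clu f V y K)
    {a a' : Fin 4} (haa : a ≠ a') {P P' : ι → Fin 3} {c c' : ZMod 2}
    (h0 : ∀ x, Ag V y x → f x = a → chi V P c x = 0)
    (h1 : ∀ x, Ag V y x → f x = a' → chi V P' c' x = 0) : False := by
  let D := V.filter (fun l => P l ≠ P' l)
  have hD : D ⊆ V := Finset.filter_subset _ _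
  have hDP : ∀ l ∈ D, P l ≠ P' l := fun l hl => (Finset.mem_filter.1 hl).2
  have hDP' : ∀ l ∈ V, l ∉ D → P l = P' l := fun l hl h => by
    by_contra h'; exact h (Finset.mem_filter.2 ⟨hl, h'⟩)
  by_cases hDe : D = ∅
  · refine T2_same hf hconn (by omega) haa h0 (c' := c') (fun x hx h => ?_)
    rw [← h1 x hx h]
    unfold chi
    congr 1
    exact Finset.sum_congr rfl fun l hl => by rw [hDP' l hl (by simp [hDe])]
  have hDne := Finset.nonempty_iff_ne_empty.2 hDe
  by_cases hDV : D = V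
  · by_cases hA : ∃ x, Ag V y x ∧ f x = a ∧ chi V P' c' x = 0
    · obtain ⟨x, hx, hfx, e1⟩ := hA
      refine T2_same hf hconn (by omega) haa h0 (c' := c + 1) (fun z hz h => ?_)
      have : chi V P c z ≠ 0 := fun e2 => T2_trick hf haa h0 h1 hD hDP hx
        (by rw [hDV]; exact hx.symm.trans hz) hfx h e1 e2
      have := z2ne.1 this
      unfold chi at this ⊢; grind
    · push Not at hA
      refine T2_same hf hconn (by omega) haa (P := P') (c := c' + 1) (fun z hz h => ?_) h1
      have := z2ne.1 (hA z hz h)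
      unfold chi at this ⊢; grind
  obtain ⟨m, hm, hmD⟩ : ∃ m ∈ V, m ∉ D := by
    by_contra h; push Not at h; exact hDV (subset_antisymm hD h)
  have hmP := hDP' m hm hmD
  have hpwD : ∀ {Q : ι → Fin 3} {d : ZMod 2} {K : Finset ι} {x x' w : ι → Fin 4}, Ag K x x' →
      chi V Q d x + chi V Q d x' = chi V Q d (K.piecewise x w) + chi V Q d (K.piecewise x' w) := by
    intro Q d K x x' w hxx
    unfold chi
    have : ∀ a b c e : ZMod 2, a + b = c + e → a + d + (b + d) = c + d + (e + d) := by
      intro a b c e; grind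
    apply this
    rw [← Finset.sum_add_distrib, ← Finset.sum_add_distrib]
    refine Finset.sum_congr rfl fun l _ => ?_
    by_cases hl : l ∈ K
    · simp [hl]
    · simp [hl, hxx l hl, z2aa]
  by_cases hD2 : 2 ≤ D.card
  · refine hirr D hD hD2 hDV (T1 hf hconn hD hDne hDV haa ?_)
    intro x x' w hx hw hxx hfx hfx'
    have hx' : Ag V y x' := hx.trans (hxx.mono hD)
    have q0 := h0 x hx hfx
    have q0' := h0 x' hx' hfx'
    have q1 := T2_const' hf haa h0 h1 hD hDne hDP hm hmD hmP hx hxx hfx hfx'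
    have r0 := hpwD (Q := P) (d := c) (w := w) hxx
    have r1 := hpwD (Q := P') (d := c') (w := w) hxx
    have hA : Ag D (D.piecewise x w) (D.piecewise x' w) := (Ag_pw.symm).trans Ag_pw
    constructor
    · intro h
      have s0 := h0 _ (hx.pw hw D) h
      exact T2_mem hf haa h0 h1 hD hDne hDP hm hmD hmP (hx.pw hw D) hA h (by grind) (by grind)
    · intro h
      have s0 := h1 _ (hx.pw hw D) h
      exact T2_mem hf haa.symm h1 h0 hD hDne (fun l hl => (hDP l hl).symm) hm hmD hmP.symm
        (hx.pw hw D) hA h (by grind) (by grind)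
  · have hD1 : D.card = 1 := by have := hDne.card_pos; omega
    obtain ⟨d, hd⟩ := Finset.card_eq_one.1 hD1
    have hdD : d ∈ D := by simp [hd]
    have hdV := hD hdD
    let K := V.erase d
    have hKV : K ⊆ V := Finset.erase_subset _ _
    have hKc : K.card = V.card - 1 := Finset.card_erase_of_mem hdV
    have hdK : d ∉ K := by simp [K]
    have hmK : m ∈ K := by
      simp only [K, Finset.mem_erase]; refine ⟨?_, hm⟩; rintro rfl; exact hmD hdD
    refine hirr K hKV (by omega) (fun h => hdK (h ▸ hdV))
      (T1 hf hconn hKV ⟨m, hmK⟩ (fun h => hdK (h ▸ hdV)) haa ?_)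
    -- d-values
    choose v0 hv0 using fun x => hf.surj hdV x a
    choose v1 hv1 using fun x => hf.surj hdV x a'
    obtain ⟨s, hs, hs'⟩ := exists_third (P d) (P' d)
    have hsum := fun v => ps_sum (hDP d hdD) hs.symm hs'.symm v
    -- epsilon at x
    let ep : (ι → Fin 4) → ZMod 2 := fun x => chi V P c x + chi V P' c' x
    have epK : ∀ l ∈ K, ∀ x v, ep (update x l v) = ep x := by
      intro l hl x v
      have hlV := hKV hl
      have : P l = P' l := hDP' l hlV (by rw [hd]; simp; rintro rfl; exact hdK hl)
      simp only [ep, chi_upd hlV, this]; grind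
    have epd : ∀ x v, ep (update x d v) = ep x + (ps s v + ps s (x d)) := by
      intro x v
      simp only [ep, chi_upd hdV]
      have := hsum v
      have := hsum (x d)
      grind
    -- complementarity
    have comp : ∀ x, Ag V y x → ep (update x d (v1 x)) = ep (update x d (v0 x)) + 1 := by
      intro x hx
      have hmd : m ≠ d := by rintro rfl; exact hdK hmK
      have inj : ∀ b, ∀ v : (ι → Fin 4) → Fin 4, (∀ x, f (update x d (v x)) = b) →
          Injective fun β => v (update x m β) := by
        intro b v hv β β' h
        have e1 := hv (update x m β)
        have e2 := hv (update x m β')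
        simp only at h
        rw [h, update_comm hmd] at e1
        rw [update_comm hmd] at e2
        exact hf m hm _ (e1.trans e2.symm)
      have epm : ∀ v β, ep (update (update x m β) d v) = ps s v + (ep x + ps s (x d)) := by
        intro v β
        rw [epd, epK m hmK, update_of_ne hmd.symm]; ring
      have b1 := ((bal_perm (inj a' v1 hv1) s).add (ep x + ps s (x d) + 1))
      have b0 := ((bal_perm (inj a v0 hv0) s).add (ep x + ps s (x d) + 1))
      have := b1.sub' b0 (fun β hβ => by
        by_contra hne
        have hne := z2ne.1 hne
        have hxβ := hx.upd hm β
        have g1 : ep (update (update x m β) d (v1 (update x m β))) = 0 := by rw [epm]; grind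
        have g0 : ep (update (update x m β) d (v0 (update x m β))) = 0 := by rw [epm]; grind
        have z1 := h1 _ (hxβ.upd hdV _) (hv1 (update x m β))
        have z0 := h0 _ (hxβ.upd hdV _) (hv0 (update x m β))
        refine T2_trick hf haa h0 h1 hD hDP (hxβ.upd hdV _) ?_ (hv0 (update x m β))
          (hv1 (update x m β)) ?_ ?_
        · intro i hi
          have : i ≠ d := by rintro rfl; exact hi hdD
          simp [this]
        · simp only [ep] at g0; rw [z0] at g0; simpa using g0
        · simp only [ep] at g1; rw [z1] at g1; simpa using g1) (x m)
      simp only [update_eq_self] at this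
      rw [epd, epd]; grind
    intro x x' w hx hw hxx hfx hfx'
    have hx' : Ag V y x' := hx.trans (hxx.mono hKV)
    have hxd : x' d = x d := hxx d hdK
    have pwd : ∀ x, Ag V y x → K.piecewise x w = update x d (w d) := by
      intro x hx
      funext i
      by_cases h : i = d
      · subst h; simp [hdK]
      · by_cases hi : i ∈ V
        · have : i ∈ K := by simp [K, h, hi]
          simp [this, h]
        · have : i ∉ K := fun h' => hi (hKV h')
          simp [this, h, hx i hi, hw i hi]
    rw [pwd x hx, pwd x' hx']
    have hv0x : v0 x = x d := hf d hdV x ((hv0 x).trans (by simp [hfx]))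
    have hv0x' : v0 x' = x d := hf d hdV x' ((hv0 x').trans (by rw [← hxd]; simp [hfx']))
    constructor
    · intro h
      have : w d = x d := hf d hdV x (h.trans (by simp [hfx]))
      rw [this, ← hxd, update_eq_self, hfx']
    · intro h
      have e1 : w d = v1 x := hf d hdV x (h.trans (hv1 x).symm)
      have : v1 x = v1 x' := by
        have c1 := comp x hx
        have c2 := comp x' hx'
        rw [epd, epd, hv0x] at c1
        rw [epd, epd, hv0x', hxd] at c2
        have z1 := h1 _ (hx.upd hdV _) (hv1 x)
        have z1' := h1 _ (hx'.upd hdV _) (hv1 x')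
        rw [chi_upd hdV] at z1 z1'
        have z0 := h0 _ hx hfx
        have z0' := h0 _ hx' hfx'
        have epx : ep x' = ep x := chain ep V y K hKV (fun x _ m hm v => epK m hm x v) x x' hx hxx
        have epx2 := epx
        simp only [ep, z0, z0', zero_add] at epx2
        refine ps_ext hs' (by grind) (?_ : ps (P' d) _ = ps (P' d) _)
        rw [hxd] at z1'
        grind
      rw [e1, this]; exact hv1 x'

/-- uniqueness from two layers -/
theorem uniq {g : (ι → Fin 4) → Fin 4} (hf : Lat f V) (hg : Lat g V)
    (hconn : ∀ p, Conn (fun x => ps p (f x)) V y)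
    {a a' : Fin 4} (haa : a ≠ a') (ha : ∀ x, Ag V y x → (f x = a ↔ g x = a))
    (ha' : ∀ x, Ag V y x → (f x = a' ↔ g x = a')) {x0} (hx0 : Ag V y x0) (h0 : f x0 ≠ a)
    (h0' : f x0 ≠ a') (he : f x0 = g x0) : ∀ x, Ag V y x → f x = g x := by
  obtain ⟨w, e, hwe⟩ := ps_pair haa
  obtain ⟨q, hq, -⟩ := exists_third w w
  have Sc : ∀ x, Ag V y x → ps w (g x) = ps w (f x) := by
    intro x hx
    have h5 : ps w (g x) = e ↔ ps w (f x) = e := by rw [hwe, hwe, ha x hx, ha' x hx]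
    clear * - h5
    generalize ps w (g x) = s at *
    generalize ps w (f x) = t at *
    revert s t e; decide
  have key := thmA_e (hf.bal w) (hconn w) (e + 1) (r := fun x => ps q (f x) + ps q (g x)) (by
    intro x hx m hm v hS hS'
    by_cases hv : v = x m
    · subst hv; simp
    have s1 := ps_sep hq.symm (hS.trans hS'.symm) (hf.ne hm hv)
    have s2 := ps_sep hq.symm (((Sc x hx).trans (hS.trans hS'.symm)).trans (Sc _ (hx.upd hm v)).symm)
      (hg.ne hm hv)
    simp only [s1, s2]; grind)
  intro x hx
  by_cases hS : ps w (f x) = e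
  · rcases (hwe _).1 hS with h | h
    · rw [h, (ha x hx).1 h]
    · rw [h, (ha' x hx).1 h]
  · have h1 : ps w (f x0) ≠ e := by rw [Ne, hwe]; push Not; exact ⟨h0, h0'⟩
    have := key x x0 hx hx0 (z2ne.1 hS) (z2ne.1 h1)
    simp only [he, z2aa] at this
    exact ps_ext hq (by grind) (Sc x hx).symm

end
end QG

namespace QG
open Function
set_option linter.unusedSectionVars false
set_option linter.unusedVariables false
section
variable {ι : Type*} [DecidableEq ι] [Fintype ι]
variable {f : (ι → Fin 4) → Fin 4} {B V Z D K P : Finset ι} {y z : ι → Fin 4}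
  {F : (ι → Fin 4) → ZMod 2} {C : Set (ι → Fin 4)}

lemma CL (hf : Lat f B) (hc : Clu f B y Z) (hZ : Z ⊆ B) {u l m : ι} (hu : u ∈ B) (huZ : u ∉ Z)
    (hl : l ∈ Z) (hm : m ∈ Z) {z z'} (hz : Ag B y z) (hzz : Ag (insert u Z) z z') {q}
    (hN : Nn (fun x => ps q (f x)) u l z) : Nn (fun x => ps q (f x)) u m z' := by
  have hlu : l ≠ u := fun h => huZ (h ▸ hl)
  have hmu : m ≠ u := fun h => huZ (h ▸ hm)
  have key : ∀ b, ∃ v, ∀ a, f (update (update z u a) l b) = f (update (update z' u a) m v) := by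
    intro b
    obtain ⟨v, hv⟩ := hf.surj (hZ hm) (update z' u 0) (f (update (update z u 0) l b))
    refine ⟨v, fun a => ?_⟩
    have h1 : Ag Z (update (update z u 0) l b) (update (update z' u 0) m v) := by
      intro i hi
      have h1 : i ≠ l := fun h => hi (h ▸ hl)
      have h2 : i ≠ m := fun h => hi (h ▸ hm)
      by_cases h3 : i = u
      · subst h3; simp [h1, h2]
      · simp [h1, h2, h3, hzz i (by simp [h3, hi])]
    have := hc _ _ (update z u a) ((hz.upd hu 0).upd (hZ hl) b) (hz.upd hu a) h1 hv.symm
    convert this using 2 <;> funext i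
    · by_cases hi : i ∈ Z
      · by_cases h1 : i = l
        · subst h1; simp [hi]
        · have : i ≠ u := fun h => huZ (h ▸ hi)
          simp [hi, h1, this]
      · have h1 : i ≠ l := fun h => hi (h ▸ hl)
        simp [hi, h1]
    · by_cases hi : i ∈ Z
      · by_cases h1 : i = m
        · subst h1; simp [hi]
        · have : i ≠ u := fun h => huZ (h ▸ hi)
          simp [hi, h1, this]
      · have h1 : i ≠ m := fun h => hi (h ▸ hm)
        by_cases h3 : i = u
        · subst h3; simp [hi, hmu.symm]
        · simp [h1, h3, hi, hzz i (by simp [h3, hi])]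
  obtain ⟨a, a', b, b', H⟩ := hN
  obtain ⟨v, hv⟩ := key b
  obtain ⟨v', hv'⟩ := key b'
  refine ⟨a, a', v, v', ?_⟩
  simpa only [← hv, ← hv'] using H

lemma Nn_ag {l m : ι} {x : ι → Fin 4} (h : Ag {l, m} z x) : Nn F l m x ↔ Nn F l m z := by
  have : ∀ a b, update (update x l a) m b = update (update z l a) m b := by
    intro a b; funext i
    by_cases h1 : i = m
    · subst h1; simp
    · by_cases h2 : i = l
      · subst h2; simp [h1]
      · simp [h1, h2, h i (by simp [h1, h2])]
  unfold Nn; simp only [this]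

lemma Cl.link (h : Cl F B y P) {l m x} (hl : l ∈ B) (hm : m ∈ B) (hlm : l ≠ m) (hx : Ag B y x)
    (hN : Nn F l m x) : l ∈ P ↔ m ∈ P := by
  constructor
  · intro h1; by_contra h2; exact h l h1 hl m hm h2 x hx hN
  · intro h1; by_contra h2; exact h m h1 hm l hl h2 x hx ((Nn_symm hlm).1 hN)

lemma conn_of {l0 : ι} (hl : l0 ∈ B) (H : ∀ P, Cl F B y P → ∀ m ∈ B, (l0 ∈ P ↔ m ∈ P)) :
    Conn F B y := by
  rintro P hP ⟨a, ha⟩ hcl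
  refine hP.antisymm fun m hm => (H P hcl m hm).1 ((H P hcl a (hP ha)).2 ha)

lemma Disc.not_conn (h : Disc F B y) : ¬ Conn F B y := fun h' => not_disc.2 h' h

lemma Disc.single (h : Disc F B y) {j l0 : ι} (hj : j ∈ B)
    (H : ∀ P, Cl F B y P → ∀ m ∈ B, m ≠ j → (l0 ∈ P ↔ m ∈ P)) : Cl F B y {j} := by
  obtain ⟨P, hP, ⟨a, ha⟩, hne, hcl⟩ := h
  by_cases h0 : l0 ∈ P
  · have : B \ P = {j} := by
      have hjP : j ∉ P := fun hj' => hne (hP.antisymm fun m hm => by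
        by_cases hmj : m = j
        · exact hmj ▸ hj'
        · exact (H P hcl m hm hmj).1 h0)
      ext m; simp only [Finset.mem_sdiff, Finset.mem_singleton]
      constructor
      · rintro ⟨h1, h2⟩; by_contra hmj; exact h2 ((H P hcl m h1 hmj).1 h0)
      · rintro rfl; exact ⟨hj, hjP⟩
    rw [← this]; exact hcl.compl
  · have : P = {j} := by
      have : ∀ m ∈ P, m = j := fun m hm => by
        by_contra hmj; exact h0 ((H P hcl m (hP hm) hmj).2 hm)
      ext m; simp only [Finset.mem_singleton]
      refine ⟨this m, ?_⟩
      rintro rfl; exact this a ha ▸ ha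
    rwa [← this]

lemma R2 (hF : BalOn F V) {l j j' : ι} (hl : l ∈ V) (hj : j ∈ V) (hj' : j' ∈ V) (hlj : l ≠ j)
    (hlj' : l ≠ j') (hjj : j ≠ j') {b' b4 : Fin 4}
    (h' : ∀ z, Ag V y z → z j' = b' → Cl F (V.erase j') z {l})
    (h : ∀ z, Ag V y z → z j ≠ b4 → Cl F (V.erase j) z {l}) : Cl F V y {l} := by
  let E : Fin 4 → Fin 4 → ZMod 2 := fun a v =>
    F (update (update y j' b') l a) + F (update (update (update y j' b') l a) l v)
  have k1 : ∀ z, Ag V y z → z j ≠ b4 → ∀ v, F z + F (update z l v) = E (z l) v := by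
    intro z hz hzj v
    rw [(h z hz hzj).single (by simp) (by simp [hl, hlj]) (Ag.refl _ z)
      (x' := update z j' b') ((Ag.refl _ z).upd (by simp [hj', hjj.symm]) _) (by simp [hlj']) v]
    refine (h' _ (hz.upd hj' b') (by simp)).single (by simp) (by simp [hl, hlj']) (Ag.refl _ _)
      (x' := update (update y j' b') l (z l)) ?_ (by simp [hlj']) v
    intro i hi
    by_cases h1 : i = j'
    · subst h1; simp [hlj'.symm]
    · have h2 : i ∉ V := fun hV => hi (by simp [hV, h1])
      have h3 : i ≠ l := fun e => h2 (e ▸ hl)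
      simp [h1, h3, hz i h2]
  have k2 : ∀ z, Ag V y z → ∀ v, F z + F (update z l v) = E (z l) v := by
    intro z hz v
    by_cases hzj : z j = b4
    · have s1 := (hF j hj z).sum
      have s2 := (hF j hj (update z l v)).sum
      have e : ∀ b, b ≠ b4 → F (update z j b) + F (update (update z l v) j b) = E (z l) v := by
        intro b hb
        have := k1 (update z j b) (hz.upd hj b) (by simpa using hb) v
        rwa [update_comm hlj.symm, update_of_ne hlj] at this
      have e4 : F (update z j b4) + F (update (update z l v) j b4) = F z + F (update z l v) := by
        rw [← hzj, update_eq_self]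
        congr 2
        funext i; by_cases hi : i = j
        · subst hi; simp [hlj.symm]
        · simp [hi]
      rw [← e4]
      clear e4 k1 h hzj
      have h0 := e 0
      have h1 := e 1
      have h2 := e 2
      have h3 := e 3
      clear e
      fin_cases b4 <;> simp at * <;> grind
    · exact k1 z hz hzj v
  intro l' hl' _ m hm hml x hx
  rw [Finset.mem_singleton] at hl'
  subst hl'
  have hml : m ≠ l' := by simpa using hml
  rw [not_Nn]
  intro a a' b b'
  have e1 := k2 (update (update x l' a) m b) ((hx.upd hl a).upd hm b) a'
  have e2 := k2 (update (update x l' a) m b') ((hx.upd hl a).upd hm b') a'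
  rw [update_comm hml, update_idem, update_of_ne hml.symm, update_self] at e1 e2
  grind

/-- two values for which `{l}` is not closed. -/
lemma R2' (hF : BalOn F V) {l j j' : ι} (hl : l ∈ V) (hj : j ∈ V) (hj' : j' ∈ V) (hlj : l ≠ j)
    (hlj' : l ≠ j') (hjj : j ≠ j') {b' : Fin 4}
    (h' : ∀ z, Ag V y z → z j' = b' → Cl F (V.erase j') z {l}) (hn : ¬ Cl F V y {l}) :
    ∃ b b', b ≠ b' ∧ ∀ z, Ag V y z → (z j = b ∨ z j = b') → ¬ Cl F (V.erase j) z {l} := by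
  by_contra! H
  have ag : ∀ z, Ag V y z → Ag (V.erase j) (update y j (z j)) z := by
    intro z hz i hi
    by_cases h1 : i = j
    · subst h1; simp
    · simp [h1, hz i (fun h => hi (by simp [h, h1]))]
  have key : ∀ b b', b ≠ b' → ¬ Cl F (V.erase j) (update y j b) {l} →
      Cl F (V.erase j) (update y j b') {l} := by
    intro b b' hb h1
    obtain ⟨z, hz, hzz, hc⟩ := H b b' hb
    rcases hzz with h2 | h2
    · exact absurd (hc.congr (h2 ▸ (ag z hz)).symm) h1
    · exact hc.congr (h2 ▸ (ag z hz)).symm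
  have : ∃ b4, ∀ b, b ≠ b4 → Cl F (V.erase j) (update y j b) {l} := by
    by_cases h0 : ∀ b, Cl F (V.erase j) (update y j b) {l}
    · exact ⟨0, fun b _ => h0 b⟩
    · push Not at h0
      obtain ⟨b4, h0⟩ := h0
      exact ⟨b4, fun b hb => key b4 b hb.symm h0⟩
  obtain ⟨b4, hb⟩ := this
  exact hn (R2 hF hl hj hj' hlj hlj' hjj h' fun z hz h => (hb _ h).congr (ag z hz))

lemma persp2 (h : Code C) {k m : ι} (hk : k ∈ D) (hm : m ∈ D) (hkm : k ≠ m) {p q : Fin 3} {c0}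
    (hcl : Cl (Fk C k p) (D.erase k) z {m}) (hline : ∀ v, Fk C k p (update z m v) = ps q v + c0) :
    Cl (Fk C m q) (D.erase m) z {k} := by
  have hmD : m ∈ D.erase k := by simp [hm, hkm.symm]
  have k1 : ∀ w, Ag (D.erase k) z w → ∀ v, Fk C k p w + Fk C k p (update w m v) =
      ps q (w m) + ps q v := by
    intro w hw v
    rw [hcl.single (by simp) hmD hw (x' := update z m (w m)) ((Ag.refl _ z).upd hmD _) (by simp) v,
      update_idem, hline, hline]; grind
  intro k' hk' _ l hl hlk x hx
  rw [Finset.mem_singleton] at hk'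
  subst hk'
  have hlk : l ≠ k' := by simpa using hlk
  have hlm := Finset.ne_of_mem_erase hl
  have hlD := Finset.mem_of_mem_erase hl
  have key : ∀ a b, Fk C m q (update (update x k' a) l b) =
      ps p a + (Fk C k' p (update (update x l b) m 0) + ps q 0) := by
    intro a b
    have e1 := h.sol_mem m (update (update x k' a) l b)
    set v := sol C m (update (update x k' a) l b) with hv
    rw [h.mem k', update_of_ne hkm, update_of_ne hlk.symm, update_self] at e1
    have e2 := k1 (update (update (update x l b) m v) k' (z k')) (by
      intro i hi
      by_cases h1 : i = k'
      · subst h1; simp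
      · have h2 : i ∉ D := fun h => hi (by simp [h, h1])
        have h3 : i ≠ m := fun h => h2 (h ▸ hm)
        have h4 : i ≠ l := fun h => h2 (h ▸ hlD)
        simp [h1, h3, h4, hx i (by simp [h2])]) 0
    rw [update_comm hkm, update_of_ne hkm.symm, update_self] at e2
    simp only [Fk, sol_upd, update_idem] at e2 ⊢
    rw [update_comm hlk.symm, update_comm hkm, sol_upd] at e1
    rw [← hv, e1]
    grind
  rw [not_Nn]
  intro a a' b b'
  rw [key, key, key, key]; grind

lemma line_inv {g : Fin 4 → Fin 4} (hg : Injective g) (p : Fin 3) :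
    ∃ q c, ∀ v, ps q (g v) = ps p v + c := by
  let e := Equiv.ofBijective g (Finite.injective_iff_bijective.1 hg)
  obtain ⟨q, c, h⟩ := bal_perm e.symm.injective p
  refine ⟨q, c, fun v => ?_⟩
  have := h (e v)
  simp only [Equiv.symm_apply_apply] at this
  have e2 : e v = g v := rfl
  rw [e2] at this; grind

lemma klein (h : Code C) {m n k : ι} (hmn : m ≠ n) (hmk : m ≠ k) (hnk : n ≠ k)
    (hK : ∀ q, ¬ Nn (Fk C m q) n k z) (p) : ¬ Nn (Fk C k p) m n z := by
  obtain ⟨q, c, hq⟩ := line_inv (h.lat (k := m) (V := {k}) (by simpa using hmk) k (by simp) z) p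
  have h1 : Cl (Fk C m q) (({m, n, k} : Finset ι).erase m) z {k} := by
    intro k' hk' _ l hl hlk x hx
    rw [Finset.mem_singleton] at hk'
    subst hk'
    have hln : l = n := by
      simp at hl hlk; tauto
    subst hln
    rw [Nn_symm hnk.symm, Nn_ag (z := z)]
    · exact hK q
    · refine hx.mono fun i hi => ?_
      simp at hi ⊢; tauto
  have := persp2 h (D := {m, n, k}) (by simp) (by simp) hmk h1 hq
  exact this m (by simp) (by simp [hmk]) n (by simp [hnk]) (by simp [hmn.symm]) z (Ag.refl _ z)

lemma Dif.compl (h : Dif C D y K) : Dif C D y (D \ K) := by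
  intro x w hx hw hxC hwC h1
  have e : ∀ x w, Ag D y x → Ag D y w → (D \ K).piecewise x w = K.piecewise w x := by
    intro x w hx hw; funext i
    by_cases h1 : i ∈ D <;> by_cases h2 : i ∈ K <;> simp [h1, h2, hx i, hw i]
  rw [e x w hx hw] at h1
  rw [e w x hw hx]
  exact h w x hw hx hwC hxC h1

lemma red_NH (h : Code C) {k l : ι} (hk : k ∈ K) (hKD : K ⊆ D) (hd : Dif C D y K) (hl : l ∈ D)
    (hlK : l ∉ K) {p} (hdisc : Disc (Fk C k p) ((insert l K).erase k) y) :
    Disc (Fk C k p) (D.erase k) y := by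
  have hclu := clu_of_dif h (hKD hk) (Z := D \ K) (by simp [hk]) Finset.sdiff_subset hd.compl
  have hlk : l ≠ k := fun e => hlK (e ▸ hk)
  have hsub : D \ K ⊆ D.erase k := fun i hi => by
    simp at hi ⊢; exact ⟨fun e => hi.2 (e ▸ hk), hi.1⟩
  have : ∃ P, P ⊆ K.erase k ∧ P.Nonempty ∧ Cl (Fk C k p) ((insert l K).erase k) y P := by
    obtain ⟨P, h1, h2, h3, h4⟩ := hdisc
    by_cases hlP : l ∈ P
    · refine ⟨_, fun i hi => ?_, ?_, h4.compl⟩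
      · simp only [Finset.mem_sdiff, Finset.mem_erase, Finset.mem_insert] at hi ⊢
        refine ⟨hi.1.1, hi.1.2.resolve_left ?_⟩
        rintro rfl; exact hi.2 hlP
      · rw [Finset.sdiff_nonempty]; exact fun h' => h3 (h1.antisymm h')
    · refine ⟨P, fun i hi => ?_, h2, h4⟩
      have := h1 hi
      simp only [Finset.mem_erase, Finset.mem_insert] at this ⊢
      refine ⟨this.1, this.2.resolve_left ?_⟩
      rintro rfl; exact hlP hi
  obtain ⟨P, h1, h2, h4⟩ := this
  have hlP : l ∉ P := fun e => hlK (Finset.mem_of_mem_erase (h1 e))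
  refine ⟨P, h1.trans (Finset.erase_subset_erase _ hKD), h2, ?_, ?_⟩
  · intro e; exact hlP (e ▸ (by simp [hl, hlk]))
  have hf := h.lat (k := k) (V := D.erase k) (by simp)
  intro a ha haD m hm hmP x hx hN
  have haK : a ∈ K := Finset.mem_of_mem_erase (h1 ha)
  have hak : a ≠ k := Finset.ne_of_mem_erase haD
  have hmk : m ≠ k := Finset.ne_of_mem_erase hm
  have agw : Ag ((insert l K).erase k) y (K.piecewise x y) := by
    intro i hi
    by_cases h9 : i ∈ K
    · have : i = k := by by_contra h3; exact hi (by simp [h9, h3])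
      subst this; rw [Finset.piecewise_eq_of_mem _ _ _ h9]; exact hx i (by simp)
    · simp [h9]
  have agz : Ag (D \ K) x (K.piecewise x y) := by
    intro i hi
    by_cases h1 : i ∈ K
    · rw [Finset.piecewise_eq_of_mem _ _ _ h1]
    · have h2 : i ∉ D := fun h2 => hi (by simp [h1, h2])
      simp [h1, hx i (by simp [h2])]
  by_cases hmK : m ∈ K
  · obtain ⟨v, hv⟩ := hf.surj (l := l) (by simp [hl, hlk]) (K.piecewise x y) (sol C k x)
    have hagx : Ag (D \ K) x (update (K.piecewise x y) l v) := agz.upd (by simp [hl, hlK]) v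
    have e : ∀ s t, sol C k (update (update x a s) m t) =
        sol C k (update (update (update (K.piecewise x y) l v) a s) m t) := by
      intro s t
      have := hclu _ _ (update (update x a s) m t) hx ((hx.upd haD s).upd hm t) hagx hv.symm
      rw [pw_upd' (by simp [hmK]), pw_upd' (by simp [haK]), pw_upd' (by simp [hmK]),
        pw_upd' (by simp [haK]), Finset.piecewise_same] at this
      rw [this]; congr 3
      have := pw_of_ag hagx.symm
      exact this
    refine h4 a ha (by simp [hak, haK]) m (by simp [hmk, hmK]) hmP _ (agw.upd (l := l) (by simp [hlk]) v) ?_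
    unfold Nn at hN ⊢
    simpa only [Fk, e] using hN
  · have := CL hf hclu hsub haD (by simp [haK]) (l := m) (m := l)
      (by simp [Finset.mem_of_mem_erase hm, hmK]) (by simp [hl, hlK]) hx
      (agz.mono (Finset.subset_insert _ _)) hN
    exact h4 a ha (by simp [hak, haK]) l (by simp [hlk]) hlP _ agw this

lemma semi_disc (h : Code C) {k : ι} (hk : k ∈ D) (hD : 3 ≤ D.card) (hs : SemiOn C D y) :
    ∃ p, Disc (Fk C k p) (D.erase k) y := by
  obtain ⟨P, c, H⟩ := hs
  refine ⟨P k, ?_⟩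
  by_contra hc
  rw [not_disc] at hc
  refine chi_not_conn (P := P) (c := c) (by rw [Finset.card_erase_of_mem hk]; omega) ?_ hc
  intro x hx
  have := H _ (h.sol_mem k x) ((hx.mono (Finset.erase_subset _ _)).upd hk _)
  rw [← Finset.add_sum_erase D _ hk, update_self] at this
  have e : ∑ i ∈ D.erase k, ps (P i) (update x k (sol C k x) i) = ∑ i ∈ D.erase k, ps (P i) (x i) :=
    Finset.sum_congr rfl (fun i hi => by rw [update_of_ne (Finset.ne_of_mem_erase hi)])
  rw [e] at this
  simp only [Fk, chi]; grind

def Irr (C : Set (ι → Fin 4)) (D : Finset ι) (y : ι → Fin 4) : Prop :=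
  ¬ SemiOn C D y ∧ ∀ K, K ⊆ D → 2 ≤ K.card → K.card + 2 ≤ D.card → ¬ Dif C D y K

lemma Irr.conn (hi : Irr C D y) (h : Code C) {k} (hk : k ∈ D) (p) :
    Conn (Fk C k p) (D.erase k) y := by
  rw [← not_disc]
  intro hd
  rcases thmB h hk hd with h1 | ⟨K, h1, h2, h3, h4⟩
  · exact hi.1 h1
  · exact hi.2 K (h3.1.trans (Finset.erase_subset _ _)) h1 h2 h4

lemma Irr.noclu (hi : Irr C D y) (h : Code C) {k} (hk : k ∈ D) {K} (hK : K ⊆ D.erase k)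
    (h2 : 2 ≤ K.card) (hne : K ≠ D.erase k) : ¬ Clu (sol C k) (D.erase k) y K := by
  intro hc
  have := Finset.card_lt_card (hK.ssubset_of_ne hne)
  rw [Finset.card_erase_of_mem hk] at this
  exact hi.2 K (hK.trans (Finset.erase_subset _ _)) h2 (by omega) (dif_of_clu h hk hK hc)

lemma Irr.layers (hi : Irr C D y) (h : Code C) (hD : 4 ≤ D.card) {k} (hk : k ∈ D) {a a' : Fin 4}
    (haa : a ≠ a') (h0 : SemiOn C (D.erase k) (update y k a))
    (h1 : SemiOn C (D.erase k) (update y k a')) : False := by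
  obtain ⟨P, c, h0⟩ := h0
  obtain ⟨P', c', h1⟩ := h1
  have key : ∀ {a : Fin 4} {P : ι → Fin 3} {c : ZMod 2},
      (∀ x ∈ C, Ag (D.erase k) (update y k a) x → ∑ l ∈ D.erase k, ps (P l) (x l) = c) →
      ∀ x, Ag (D.erase k) y x → sol C k x = a → chi (D.erase k) P c x = 0 := by
    intro a P c H x hx hs
    have := H _ (h.sol_mem k x) (by
      intro i hi
      by_cases h1 : i = k
      · subst h1; simp [hs]
      · simp [h1, hx i hi])
    have e : ∑ i ∈ D.erase k, ps (P i) (update x k (sol C k x) i) =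
        ∑ i ∈ D.erase k, ps (P i) (x i) :=
      Finset.sum_congr rfl (fun i hi => by rw [update_of_ne (Finset.ne_of_mem_erase hi)])
    rw [e] at this
    simp only [chi]; grind
  exact T2 (h.lat (by simp)) (hi.conn h hk) (by rw [Finset.card_erase_of_mem hk]; omega)
    (fun K => hi.noclu h hk) haa (key h0) (key h1)

end
end QG

namespace QG
open Function
set_option linter.unusedSectionVars false
set_option linter.unusedVariables false
section
variable {ι : Type*} [DecidableEq ι] [Fintype ι]
variable {f : (ι → Fin 4) → Fin 4} {B V Z D K P U : Finset ι} {y z z0 y0 : ι → Fin 4}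
  {F : (ι → Fin 4) → ZMod 2} {C : Set (ι → Fin 4)} {i x : ι} {a : Fin 4} {p qs : Fin 3}

abbrev Pf (f : (ι → Fin 4) → Fin 4) (p : Fin 3) : (ι → Fin 4) → ZMod 2 := fun x => ps p (f x)

lemma agE {j : ι} {z z' : ι → Fin 4} (h : Ag V y z) (h' : Ag V y z') (e : z' j = z j) :
    Ag (V.erase j) z z' := by
  intro l hl
  by_cases h1 : l = j
  · subst h1; exact e
  · have : l ∉ V := fun h2 => hl (by simp [h1, h2])
    rw [h l this, h' l this]

/-- line labels -/
def Lb (F : (ι → Fin 4) → ZMod 2) (l : ι) (z : ι → Fin 4) (s : Fin 3) : Prop :=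
  ∃ c, ∀ v, F (update z l v) = ps s v + c

lemma Lb.uniq {l : ι} {s t} (h : Lb F l z s) (h' : Lb F l z t) : s = t := by
  obtain ⟨c, h⟩ := h
  obtain ⟨d, h'⟩ := h'
  exact (ps_fac (fun v => (h v).symm.trans (h' v))).1

lemma Lb_not_Nn {l m : ι} (hlm : l ≠ m) {s} (h : ∀ b, Lb F l (update z m b) s) : ¬ Nn F l m z := by
  rw [not_Nn]
  intro v v' b b'
  obtain ⟨c, h1⟩ := h b
  obtain ⟨c', h2⟩ := h b'
  simp only [update_comm hlm, h1, h2]; grind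

lemma not_Nn_Lb {l m : ι} (hlm : l ≠ m) (h : ¬ Nn F l m z) {s b} (hb : Lb F l (update z m b) s) (b') :
    Lb F l (update z m b') s := by
  rw [not_Nn] at h
  obtain ⟨c, h1⟩ := hb
  refine ⟨c + F (update (update z m b) l 0) + F (update (update z m b') l 0), fun v => ?_⟩
  have := h v 0 b b'
  have h2 := h1 v
  simp only [update_comm hlm] at *
  grind

lemma Lb_ne (hf : Lat f V) {l : ι} (hl : l ∈ V) {p q : Fin 3} (hpq : p ≠ q) {s t}
    (h : Lb (Pf f p) l z s) (h' : Lb (Pf f q) l z t) : s ≠ t := by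
  rintro rfl
  obtain ⟨c, h⟩ := h
  obtain ⟨d, h'⟩ := h'
  have : ∃ v v' : Fin 4, v ≠ v' ∧ ps s v = ps s v' := by clear h h'; revert s; decide
  obtain ⟨v, v', hv, e⟩ := this
  refine hv (hf l hl z (ps_ext hpq ?_ ?_))
  · exact (h v).trans (e ▸ (h v').symm)
  · exact (h' v).trans (e ▸ (h' v').symm)

lemma pattern (hf : Lat f B) {w} (hd : Disc (Pf f w) B z) {j l0 : ι} (hj : j ∈ B) (hl : l0 ∈ B)
    (hlj : l0 ≠ j) {z'} (hz : Ag B z z') (H : ∀ m ∈ B, m ≠ j → m ≠ l0 → Nn (Pf f w) l0 m z') :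
    Cl (Pf f w) B z {j} ∧ Clu f B z (B.erase j) := by
  have k : ∀ B', B' ⊆ B → l0 ∈ B' → ∀ z1, Ag B' z1 z' → ∀ P, Cl (Pf f w) B' z1 P → ∀ m ∈ B', m ≠ j →
      (l0 ∈ P ↔ m ∈ P) := by
    intro B' hB hl z1 hz P hP m hm hmj
    by_cases e : m = l0
    · rw [e]
    · exact hP.link hl hm (Ne.symm e) hz (H m (hB hm) hmj e)
  have h1 := hd.single hj (k B subset_rfl hl z hz)
  refine ⟨h1, CLU (p := w) hf (Comp.of_conn (Finset.erase_subset _ _) ⟨l0, by simp [hl, hlj]⟩ ?_ hz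
    (conn_of (l0 := l0) (by simp [hl, hlj]) fun P hP m hm =>
      k _ (Finset.erase_subset _ _) (by simp [hl, hlj]) z' (Ag.refl _ _) P hP m hm
        (Finset.ne_of_mem_erase hm)))⟩
  rw [← Finset.sdiff_singleton_eq_erase]; exact h1.compl

/-- consequence of a pattern: planes through `j` all look the same -/
lemma pattern_CL (hf : Lat f B) {j : ι} (hj : j ∈ B) (hc : Clu f B z (B.erase j)) {l m : ι}
    (hl : l ∈ B) (hlj : l ≠ j) (hm : m ∈ B) (hmj : m ≠ j) {z1 z2} (h1 : Ag B z z1) (h2 : Ag B z z2) {r}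
    (hN : Nn (Pf f r) j l z1) : Nn (Pf f r) j m z2 :=
  CL hf hc (Finset.erase_subset _ _) hj (by simp) (by simp [hl, hlj]) (by simp [hm, hmj]) h1
    (by rw [Finset.insert_erase hj]; exact h1.symm.trans h2) hN

structure Crx (f : (ι → Fin 4) → Fin 4) (V : Finset ι) (y0 : ι → Fin 4) (i x : ι) (a : Fin 4)
    (p qs : Fin 3) (z0 : ι → Fin 4) (U : Finset ι) : Prop where
  hf : Lat f V
  conn : ∀ p, Conn (Pf f p) V y0
  hi : i ∈ V
  hx : x ∈ V
  hix : x ≠ i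
  hU : ∀ m, m ∈ U ↔ m ∈ V ∧ m ≠ i ∧ m ≠ x
  z1 : ∀ m ∈ U, ∀ z, Ag V y0 z → z i = a → ¬ Nn (Pf f p) x m z ∧ ∀ q, q ≠ p → Nn (Pf f q) x m z
  hq : qs ≠ p
  h0 : Ag V y0 z0
  h0i : z0 i = a
  z2 : Disc (Pf f qs) U z0
  NH : ∀ j ∈ V, ∀ z, Ag V y0 z → ∃ q, Disc (Pf f q) (V.erase j) z
  ns : ¬ ∀ l ∈ V.erase i, Cl (Pf f p) (V.erase i) (update y0 i a) {l}
  noK : ∀ j ∈ U, ∀ j' ∈ U, j ≠ j' → ∀ b b' b'', b ≠ b' →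
    (∀ z, Ag V y0 z → z j = b → Clu f (V.erase j) z {x, i}) →
    (∀ z, Ag V y0 z → z j = b' → Clu f (V.erase j) z {x, i}) →
    (∀ z, Ag V y0 z → z j' = b'' → Clu f (V.erase j') z {x, i}) → False

namespace Crx
variable (h : Crx f V y0 i x a p qs z0 U)
include h

lemma two {j j' l : ι} (hj : j ∈ U) (hj' : j' ∈ U) (hl : l ∈ U) (hjj : j ≠ j') (hlj : l ≠ j)
    (hlj' : l ≠ j')
    (H : ∀ P, Cl (Pf f qs) U z0 P → ∀ m ∈ U, ∀ m' ∈ U, m ≠ j → m' ≠ j → (m ∈ P ↔ m' ∈ P))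
    (H' : ∀ P, Cl (Pf f qs) U z0 P → ∀ m ∈ U, ∀ m' ∈ U, m ≠ j' → m' ≠ j' → (m ∈ P ↔ m' ∈ P)) :
    False := by
  have := h.z2.single hj' (l0 := l) fun P hP m hm hmj => H' P hP l hl m hm hlj' hmj
  have := (H _ this j' hj' l hl hjj.symm hlj).1 (by simp)
  simp [hlj'] at this

lemma cl_x (z) (hz : Ag V y0 z) (hi : z i = a) : Cl (Pf f p) (V.erase i) z {x} := by
  intro l hl hlV m hm hml w hw
  simp only [Finset.mem_singleton] at hl hml; subst hl
  rw [Finset.mem_erase] at hm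
  exact (h.z1 m ((h.hU m).2 ⟨hm.2, hm.1, hml⟩) w (hz.trans (hw.mono (Finset.erase_subset _ _)))
    ((hw i (by simp)).trans hi)).1

lemma ne_single {l m : ι} (hl : l ∈ V) (hm : m ∈ V) (hlm : l ≠ m) (q) : ¬ Cl (Pf f q) V y0 {l} := by
  intro hc
  have := h.conn q {l} (by simpa) (by simp) hc
  rw [← this] at hm
  exact hlm (Finset.mem_singleton.1 hm).symm

lemma s1 {j : ι} (hj : j ∈ U) (hd : ∀ z, Ag V y0 z → Disc (Pf f p) (V.erase j) z) :
    ((∃ l ∈ U, ∃ l' ∈ U, l ≠ l' ∧ l ≠ j ∧ l' ≠ j) ∧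
      ∀ P, Cl (Pf f qs) U z0 P → ∀ m ∈ U, ∀ m' ∈ U, m ≠ j → m' ≠ j → (m ∈ P ↔ m' ∈ P)) ∨
    ∃ b b', b ≠ b' ∧ ∀ z, Ag V y0 z → (z j = b ∨ z j = b') → Clu f (V.erase j) z {x, i} := by
  obtain ⟨hjV, hji, hjx⟩ := (h.hU j).1 hj
  obtain ⟨b, b', hbb, hb⟩ := R2' (h.hf.bal p) h.hx hjV h.hi hjx.symm h.hix hji
    (fun z hz e => h.cl_x z hz e) (h.ne_single h.hx hjV hjx.symm p)
  rw [or_iff_not_imp_left]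
  intro hQ
  refine ⟨b, b', hbb, fun z hz hzj => ?_⟩
  have hlat := h.hf.mono (Finset.erase_subset j V)
  obtain ⟨Z, hxZ, hZ⟩ := exists_comp (Pf f p) (V.erase j) z (l := x) (by simp [h.hx, hjx.symm])
  have hclu := CLU hlat hZ
  have hag : ∀ w v, Ag V y0 w → Ag (V.erase j) z (update (update w j (z j)) i v) := fun w v hw =>
    (agE hz (hw.upd hjV _) (by simp)).upd (by simp [h.hi, hji.symm]) v
  have hagV : ∀ w v, Ag V y0 w → Ag V y0 (update (update w j (z j)) i v) := fun w v hw =>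
    (hw.upd hjV _).upd h.hi v
  have hZx : Z ≠ {x} := fun e => hb z hz hzj (e ▸ hZ.2.2.1)
  have hiZ : i ∈ Z := by
    by_contra hiZ
    have h1 := hZ.conn (hag z a hz)
    refine hZx (h1 {x} (by simpa) (by simp) ?_).symm
    refine (h.cl_x _ (hagV z a hz) (by simp)).mono ?_ (Ag.refl _ _)
    intro l hl
    have := hZ.1 hl
    simp only [Finset.mem_erase] at this ⊢
    exact ⟨fun e => hiZ (e ▸ hl), this.2⟩
  obtain ⟨u, hu, huZ⟩ : ∃ u ∈ V.erase j, u ∉ Z := by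
    by_contra! H
    obtain ⟨P, h1, h2, h3, h4⟩ := hd z hz
    exact h3 ((hZ.2.2.2 P (h1.trans H) h2 h4).trans (hZ.1.antisymm H))
  by_cases hA : ∃ m ∈ Z, m ≠ x ∧ m ≠ i
  · exfalso; apply hQ
    obtain ⟨m0, hm0, hmx, hmi⟩ := hA
    have hZU : ∀ m ∈ V.erase j, m ≠ x → m ≠ i → m ∈ U ∧ m ≠ j := fun m hm h1 h2 => by
      rw [Finset.mem_erase] at hm
      exact ⟨(h.hU m).2 ⟨hm.2, h2, h1⟩, hm.1⟩
    have hu' : ∀ w, w ∉ Z → w ≠ x ∧ w ≠ i := fun w hw =>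
      ⟨fun e => hw (e ▸ hxZ), fun e => hw (e ▸ hiZ)⟩
    have hlink : ∀ P, Cl (Pf f qs) U z0 P → ∀ w ∈ V.erase j, w ∉ Z → ∀ m ∈ Z, m ≠ x → m ≠ i →
        (w ∈ P ↔ m ∈ P) := by
      intro P hP w hw hwZ m hm hmx hmi
      obtain ⟨hwU, hwj⟩ := hZU w hw (hu' w hwZ).1 (hu' w hwZ).2
      obtain ⟨hmU, hmj⟩ := hZU m (hZ.1 hm) hmx hmi
      have hN : Nn (Pf f qs) w x (update (update z0 j (z j)) i a) := (Nn_symm (hu' w hwZ).1.symm).1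
        ((h.z1 w hwU _ (hagV _ _ h.h0) (by simp)).2 _ h.hq)
      refine hP.link hwU hmU (fun e => hwZ (e ▸ hm)) ?_ (CL hlat hclu hZ.1 hw hwZ hxZ hm (hag _ _ h.h0) (Ag.refl _ _) hN)
      intro l hl
      by_cases e : l = i
      · subst e; simp [h.h0i]
      · rw [update_of_ne e, update_of_ne (fun e : l = j => hl (e ▸ hj))]
    obtain ⟨huU, huj⟩ := hZU u hu (hu' u huZ).1 (hu' u huZ).2
    obtain ⟨hmU, hmj⟩ := hZU m0 (hZ.1 hm0) hmx hmi
    refine ⟨⟨u, huU, m0, hmU, fun e => huZ (e ▸ hm0), huj, hmj⟩, ?_⟩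
    intro P hP
    have key : ∀ m ∈ U, m ≠ j → (m ∈ P ↔ m0 ∈ P) := by
      intro m hm hmj
      obtain ⟨h1, h2, h3⟩ := (h.hU m).1 hm
      by_cases hmZ : m ∈ Z
      · rw [← hlink P hP u hu huZ m hmZ h3 h2, hlink P hP u hu huZ m0 hm0 hmx hmi]
      · exact hlink P hP m (by simp [hmj, h1]) hmZ m0 hm0 hmx hmi
    intro m hm m' hm' h1 h2
    rw [key m hm h1, key m' hm' h2]
  · have : Z = {x, i} := by
      ext m; simp only [Finset.mem_insert, Finset.mem_singleton]
      constructor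
      · intro hm; by_contra! h1; exact hA ⟨m, hm, h1.1, h1.2⟩
      · rintro (rfl | rfl) <;> assumption
    rwa [this] at hclu

lemma step1 (hU : 2 ≤ U.card) : ∃ j ∈ U, ∃ z, Ag V y0 z ∧ Conn (Pf f p) (V.erase j) z := by
  by_contra! H
  have hd : ∀ j ∈ U, ∀ z, Ag V y0 z → Disc (Pf f p) (V.erase j) z := fun j hj z hz => by
    by_contra h1; exact H j hj z hz (not_disc.1 h1)
  have cc : ∀ j ∈ U, ∀ j' ∈ U, j ≠ j' →
      ¬ ((∃ b b', b ≠ b' ∧ ∀ z, Ag V y0 z → (z j = b ∨ z j = b') → Clu f (V.erase j) z {x, i}) ∧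
      (∃ b b', b ≠ b' ∧ ∀ z, Ag V y0 z → (z j' = b ∨ z j' = b') → Clu f (V.erase j') z {x, i})) := by
    rintro j hj j' hj' hjj ⟨⟨b, b', hb, h1⟩, ⟨b2, _, _, h2⟩⟩
    exact h.noK j hj j' hj' hjj b b' b2 hb (fun z hz e => h1 z hz (Or.inl e))
      (fun z hz e => h1 z hz (Or.inr e)) (fun z hz e => h2 z hz (Or.inl e))
  have qq : ∀ j ∈ U, ∀ j' ∈ U, j ≠ j' → (∃ l ∈ U, l ≠ j ∧ l ≠ j') →
      ¬ ((∀ P, Cl (Pf f qs) U z0 P → ∀ m ∈ U, ∀ m' ∈ U, m ≠ j → m' ≠ j → (m ∈ P ↔ m' ∈ P)) ∧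
        (∀ P, Cl (Pf f qs) U z0 P → ∀ m ∈ U, ∀ m' ∈ U, m ≠ j' → m' ≠ j' → (m ∈ P ↔ m' ∈ P))) := by
    rintro j hj j' hj' hjj ⟨l, hl, h1, h2⟩ ⟨h3, h4⟩
    exact h.two hj hj' hl hjj h1 h2 h3 h4
  obtain ⟨j, hj, j', hj', hjj⟩ := Finset.one_lt_card.1 hU
  have s := fun j hj => h.s1 hj (hd j hj)
  have : ∃ j ∈ U, ∃ l ∈ U, ∃ l' ∈ U, l ≠ l' ∧ l ≠ j ∧ l' ≠ j := by
    rcases s j hj with h1 | h1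
    · exact ⟨j, hj, h1.1⟩
    rcases s j' hj' with h2 | h2
    · exact ⟨j', hj', h2.1⟩
    exact (cc j hj j' hj' hjj ⟨h1, h2⟩).elim
  obtain ⟨j1, hj1, j2, hj2, j3, hj3, h23, h21, h31⟩ := this
  have q12 := qq j1 hj1 j2 hj2 h21.symm ⟨j3, hj3, h31, h23.symm⟩
  have q13 := qq j1 hj1 j3 hj3 h31.symm ⟨j2, hj2, h21, h23⟩
  have q23 := qq j2 hj2 j3 hj3 h23 ⟨j1, hj1, h21.symm, h31.symm⟩
  have c12 := cc j1 hj1 j2 hj2 h21.symm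
  have c13 := cc j1 hj1 j3 hj3 h31.symm
  have c23 := cc j2 hj2 j3 hj3 h23
  have s1 := s j1 hj1
  have s2 := s j2 hj2
  have s3 := s j3 hj3
  rcases s1 with a | a <;> rcases s2 with b | b <;> rcases s3 with c | c
  all_goals first
    | exact q12 ⟨a.2, b.2⟩ | exact q13 ⟨a.2, c.2⟩ | exact q23 ⟨b.2, c.2⟩
    | exact c12 ⟨a, b⟩ | exact c13 ⟨a, c⟩ | exact c23 ⟨b, c⟩

lemma lab1 {j1 : ι} (hj1 : j1 ∈ U) {z1 : ι → Fin 4} (hz1 : Ag V y0 z1)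
    (hc : Conn (Pf f p) (V.erase j1) z1) : ∃ q, q ≠ p ∧ ∀ z, Ag V y0 z → z j1 = z1 j1 → ∀ m ∈ V,
      m ≠ i → m ≠ j1 → ¬ Nn (Pf f q) i m z ∧ ∀ r, r ≠ q → Nn (Pf f r) i m z := by
  obtain ⟨hjV, hji, hjx⟩ := (h.hU j1).1 hj1
  obtain ⟨q, hd⟩ := h.NH j1 hjV z1 hz1
  have hlat := h.hf.mono (Finset.erase_subset j1 V)
  have hqp : q ≠ p := by rintro rfl; exact hd.not_conn hc
  have hiB : i ∈ V.erase j1 := by simp [h.hi, hji.symm]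
  have hxB : x ∈ V.erase j1 := by simp [h.hx, hjx.symm]
  obtain ⟨h1, h2⟩ := pattern hlat hd hiB hxB h.hix
    ((Ag.refl (V.erase j1) z1).upd hiB a) (fun m hm hmi hmx =>
      (h.z1 m ((h.hU m).2 ⟨Finset.mem_of_mem_erase hm, hmi, hmx⟩) _ (hz1.upd h.hi a) (by simp)).2 q hqp)
  have : ¬ Cl (Pf f p) (V.erase j1) z1 {i} := fun hcl => by
    have := hc {i} (by simpa using hiB) (by simp) hcl
    rw [← this] at hxB; exact h.hix (Finset.mem_singleton.1 hxB)
  unfold Cl at this; push Not at this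
  obtain ⟨l, hl, -, m0, hm0, hm0i, w, hw, hN⟩ := this
  rw [Finset.mem_singleton] at hl hm0i; subst hl
  refine ⟨q, hqp, fun z hz hzj m hm hmi hmj => ?_⟩
  have hmB : m ∈ V.erase j1 := by simp [hm, hmj]
  have n1 : ¬ Nn (Pf f q) l m z :=
    h1 l (by simp) hiB m hmB (by simpa using hmi) z (agE hz1 hz hzj)
  have n2 : Nn (Pf f p) l m z := pattern_CL hlat hiB h2 hm0 hm0i hmB hmi hw (agE hz1 hz hzj) hN
  refine ⟨n1, fun r hr => ?_⟩
  by_contra n3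
  by_cases e : r = p
  · exact n3 (e ▸ n2)
  · exact Nn_third hr.symm hqp e n1 n3 n2

lemma claim2 {j1 j2 : ι} {b1} {q} (hj1 : j1 ∈ U) (hj2 : j2 ∈ U) (hjj : j2 ≠ j1) (hqp : q ≠ p)
    (lab : ∀ z, Ag V y0 z → z j1 = b1 → ∀ m ∈ V,
      m ≠ i → m ≠ j1 → ¬ Nn (Pf f q) i m z ∧ ∀ r, r ≠ q → Nn (Pf f r) i m z) :
    ∃ z2, Ag V y0 z2 ∧ ∀ m ∈ V, m ≠ j2 → m ≠ j1 → ∀ z, Ag V y0 z → z j2 = z2 j2 →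
      ∀ r, r ≠ p → Nn (Pf f r) j1 m z := by
  obtain ⟨hjV, hji, hjx⟩ := (h.hU j1).1 hj1
  obtain ⟨hj2V, hj2i, hj2x⟩ := (h.hU j2).1 hj2
  have hlat := h.hf.mono (Finset.erase_subset j2 V)
  obtain ⟨b, _, _, hb⟩ := R2' (h.hf.bal q) h.hi hj2V hjV hj2i.symm hji.symm hjj
    (b' := b1) (fun z hz e => by
      intro l hl hlV m hm hml w hw
      simp only [Finset.mem_singleton] at hl hml; subst hl
      rw [Finset.mem_erase] at hm
      exact (lab w (hz.trans (hw.mono (Finset.erase_subset _ _))) ((hw j1 (by simp)).trans e)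
        m hm.2 hml hm.1).1) (h.ne_single h.hi h.hx h.hix.symm q)
  set z2 := update y0 j2 b with hz2
  have ag2 : Ag V y0 z2 := (Ag.refl _ _).upd hj2V b
  have hiB : i ∈ V.erase j2 := by simp [h.hi, hj2i.symm]
  have hxB : x ∈ V.erase j2 := by simp [h.hx, hj2x.symm]
  have hjB : j1 ∈ V.erase j2 := by simp [hjV, hjj.symm]
  obtain ⟨w, hd⟩ := h.NH j2 hj2V z2 ag2
  have hwp : w = p := by
    by_contra hwp
    obtain ⟨h1, h2⟩ := pattern hlat hd hiB hxB h.hix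
      ((Ag.refl (V.erase j2) z2).upd hiB a) (fun m hm hmi hmx =>
        (h.z1 m ((h.hU m).2 ⟨Finset.mem_of_mem_erase hm, hmi, hmx⟩) _ (ag2.upd h.hi a) (by simp)).2 w hwp)
    by_cases hwq : w = q
    · subst hwq; exact hb z2 ag2 (Or.inl (by simp [hz2])) h1
    · exact h1 i (by simp) hiB x hxB (by simpa using h.hix) _ ((Ag.refl _ z2).upd hjB b1)
        ((lab _ (ag2.upd hjV b1) (by simp) x h.hx h.hix hjx.symm).2 w hwq)
  subst hwp
  obtain ⟨h1, h2⟩ := pattern hlat hd hjB hiB hji.symm ((Ag.refl (V.erase j2) z2).upd hjB b1)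
    (fun m hm hmj hmi => (lab _ (ag2.upd hjV b1) (by simp) m (Finset.mem_of_mem_erase hm) hmi hmj).2 _
      hqp.symm)
  refine ⟨z2, ag2, fun m hm hm2 hm1 z hz e r hr => ?_⟩
  refine pattern_CL hlat hjB h2 hxB hjx.symm (by simp [hm, hm2]) hm1
    ((Ag.refl (V.erase j2) z2).upd hiB a) (agE ag2 hz e) ((Nn_symm hjx.symm).1 ?_)
  exact (h.z1 j1 hj1 _ (ag2.upd h.hi a) (by simp)).2 r hr

lemma big {j1 : ι} {b1} {q} (hj1 : j1 ∈ U) (hqp : q ≠ p)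
    (lab : ∀ z, Ag V y0 z → z j1 = b1 → ∀ m ∈ V,
      m ≠ i → m ≠ j1 → ¬ Nn (Pf f q) i m z ∧ ∀ r, r ≠ q → Nn (Pf f r) i m z) (hU : 3 ≤ U.card) :
    False := by
  have key : ∀ j2 ∈ U, j2 ≠ j1 → ∀ P, Cl (Pf f qs) U z0 P → ∀ m ∈ U, ∀ m' ∈ U, m ≠ j2 → m' ≠ j2 →
      (m ∈ P ↔ m' ∈ P) := by
    intro j2 hj2 hjj
    obtain ⟨z2, ag2, H⟩ := h.claim2 hj1 hj2 hjj hqp lab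
    have : ∀ P, Cl (Pf f qs) U z0 P → ∀ m ∈ U, m ≠ j2 → (j1 ∈ P ↔ m ∈ P) := by
      intro P hP m hm hm2
      by_cases e : m = j1
      · rw [e]
      · exact hP.link hj1 hm (Ne.symm e) ((Ag.refl _ _).upd hj2 (z2 j2))
          (H m ((h.hU m).1 hm).1 hm2 e _ (h.h0.upd ((h.hU j2).1 hj2).1 _) (by simp) _ h.hq)
    intro P hP m hm m' hm' h1 h2
    rw [← this P hP m hm h1, this P hP m' hm' h2]
  have : 1 < (U.erase j1).card := by rw [Finset.card_erase_of_mem hj1]; omega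
  obtain ⟨j2, h2, j3, h3, h23⟩ := Finset.one_lt_card.1 this
  rw [Finset.mem_erase] at h2 h3
  exact h.two h2.2 h3.2 hj1 h23 h2.1.symm h3.1.symm (key j2 h2.2 h2.1) (key j3 h3.2 h3.1)

lemma small {j1 : ι} {b1} {q} (hj1 : j1 ∈ U) (hqp : q ≠ p)
    (lab : ∀ z, Ag V y0 z → z j1 = b1 → ∀ m ∈ V,
      m ≠ i → m ≠ j1 → ¬ Nn (Pf f q) i m z ∧ ∀ r, r ≠ q → Nn (Pf f r) i m z) (hU : U.card = 2) :
    False := by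
  obtain ⟨j2, hj2, hjj⟩ := Finset.exists_mem_ne (by omega : 1 < U.card) j1
  have hUe : ∀ m ∈ U, m = j1 ∨ m = j2 := by
    have : ({j1, j2} : Finset ι) = U := Finset.eq_of_subset_of_card_le
      (by intro m; simp; rintro (rfl | rfl) <;> assumption) (by rw [Finset.card_pair hjj.symm]; omega)
    intro m hm; rw [← this] at hm; simpa using hm
  obtain ⟨hj1V, hj1i, hj1x⟩ := (h.hU j1).1 hj1
  obtain ⟨hj2V, hj2i, hj2x⟩ := (h.hU j2).1 hj2
  have hVe : ∀ m ∈ V, m = i ∨ m = x ∨ m = j1 ∨ m = j2 := by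
    intro m hm
    by_contra! H
    rcases hUe m ((h.hU m).2 ⟨hm, H.1, H.2.1⟩) with e | e
    exacts [H.2.2.1 e, H.2.2.2 e]
  -- Z3
  have Z3 : ∀ z, Ag V y0 z → z i = a → Nn (Pf f p) j1 j2 z := by
    by_contra! H
    obtain ⟨z, hz, hzi, hN⟩ := H
    apply h.ns
    have hN' : ∀ w, Ag V y0 w → w i = a → ¬ Nn (Pf f p) j1 j2 w := by
      intro w hw hwi hNw
      have c := (h.cl_x z hz hzi).compl
      have e1 : Ag {j1, j2} z (update (update z j1 (w j1)) j2 (w j2)) :=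
        ((Ag.refl _ z).upd (by simp) _).upd (by simp) _
      refine hN ((Nn_ag e1).1 (c.persist (x := w) ?_ ?_ (by simp [*]) (by simp [*]) (agE hz hw (by rw [hwi, hzi])) ?_ ?_ hNw))
      · simp [*]
      · simp [*]
      · exact ((Ag.refl _ z).upd (by simp [*]) _).upd (by simp [*]) _
      · intro m hm
        simp only [Finset.mem_sdiff, Finset.mem_erase, Finset.mem_singleton] at hm
        rcases hVe m hm.1.2 with e | e | e | e
        · exact absurd e hm.1.1
        · exact absurd e hm.2
        · subst e; rw [update_of_ne hjj.symm]; simp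
        · subst e; simp
    intro l hl
    have hs : Ag V y0 (update y0 i a) := (Ag.refl _ _).upd h.hi a
    by_cases hlx : l = x
    · subst hlx; exact h.cl_x _ hs (by simp)
    intro l' hl' hlV m hm hml w hw
    simp only [Finset.mem_singleton] at hl' hml; subst hl'
    have hwV := hs.trans (hw.mono (Finset.erase_subset _ _))
    have hwi : w i = a := by simpa using hw i (by simp)
    rw [Finset.mem_erase] at hl hm
    have hlU := (h.hU l').2 ⟨hl.2, hl.1, hlx⟩
    by_cases hmx : m = x
    · subst hmx; rw [Nn_symm (Ne.symm hml)]; exact (h.z1 l' hlU w hwV hwi).1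
    have hmU := (h.hU m).2 ⟨hm.2, hm.1, hmx⟩
    rcases hUe _ hlU with e | e <;> rcases hUe _ hmU with e' | e' <;> subst e <;> subst e'
    · exact absurd rfl hml
    · exact hN' w hwV hwi
    · rw [Nn_symm (Ne.symm hml)]; exact hN' w hwV hwi
    · exact absurd rfl hml
  obtain ⟨z2, ag2, H2⟩ := h.claim2 hj1 hj2 hjj hqp lab
  have nq : ∀ z, Ag V y0 z → z i = a → ¬ Nn (Pf f q) j1 j2 z := by
    intro z hz hzi
    obtain ⟨w, hd⟩ := h.NH x h.hx z hz
    have hlat := h.hf.mono (Finset.erase_subset x V)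
    have hiB : i ∈ V.erase x := by simp [h.hi, h.hix.symm]
    have h1B : j1 ∈ V.erase x := by simp [hj1V, hj1x]
    have h2B : j2 ∈ V.erase x := by simp [hj2V, hj2x]
    have hwq : w = q := by
      by_contra hwq
      obtain ⟨k1, k2⟩ := pattern hlat hd h1B hiB hj1i.symm ((Ag.refl _ z).upd h1B b1)
        (fun m hm hm1 hmi => (lab _ (hz.upd hj1V b1) (by simp) m (Finset.mem_of_mem_erase hm) hmi hm1).2 _ hwq)
      by_cases hwp : w = p
      · subst hwp
        exact k1 j1 (by simp) h1B j2 h2B (by simpa using hjj) z (Ag.refl _ _) (Z3 z hz hzi)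
      · exact k1 j1 (by simp) h1B i hiB (by simpa using hj1i.symm) _ ((Ag.refl _ z).upd h2B (z2 j2))
          (H2 i h.hi hj2i.symm hj1i.symm _ (hz.upd hj2V _) (by simp) _ hwp)
    subst hwq
    obtain ⟨k1, k2⟩ := pattern hlat hd h2B h1B hjj.symm ((Ag.refl _ z).upd h2B (z2 j2))
      (fun m hm hm2 hm1 => H2 m (Finset.mem_of_mem_erase hm) hm2 hm1 _ (hz.upd hj2V _) (by simp) _ hqp)
    rw [Nn_symm hjj.symm]
    exact k1 j2 (by simp) h2B j1 h1B (by simpa using hjj.symm) z (Ag.refl _ _)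
  -- labels
  set zs := update y0 i a with hzs
  have hs : Ag V y0 zs := (Ag.refl _ _).upd h.hi a
  have hsi : zs i = a := by simp [hzs]
  have ex : ∀ r z, ∃ s, Lb (Pf f r) j1 z s := fun r z => h.hf.bal r j1 hj1V z
  have hbb : ∃ b b' s s', s ≠ s' ∧ Lb (Pf f p) j1 (update zs j2 b) s ∧ Lb (Pf f p) j1 (update zs j2 b') s' := by
    by_contra! H
    obtain ⟨s, hs0⟩ := ex p (update zs j2 0)
    refine Lb_not_Nn hjj.symm (s := s) (fun b => ?_) (Z3 zs hs hsi)
    obtain ⟨s', hs'⟩ := ex p (update zs j2 b)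
    by_cases e : s = s'
    · rwa [e]
    · exact absurd hs' (H 0 b s s' e hs0)
  obtain ⟨b, b', s, s', hss, hb, hb'⟩ := hbb
  have mv : ∀ b s, Lb (Pf f p) j1 (update zs j2 b) s → ∀ c, Lb (Pf f p) j1 (update (update zs x c) j2 b) s := by
    intro b s hL c
    rw [update_comm hj2x.symm]
    have : update zs j2 b = update (update zs j2 b) x (zs x) := by
      rw [update_comm hj2x, update_eq_self]
    rw [this] at hL
    refine not_Nn_Lb hj1x ?_ hL c
    rw [Nn_symm hj1x]
    exact (h.z1 j1 hj1 _ (hs.upd hj2V b) (by rw [update_of_ne hj2i.symm, hsi])).1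
  have third : ∀ c, ∀ t, Lb (Pf f q) j1 (update zs x c) t → t ≠ s ∧ t ≠ s' := by
    intro c t ht
    have hsc : Ag V y0 (update zs x c) := hs.upd h.hx c
    have : ∀ b, Lb (Pf f q) j1 (update (update zs x c) j2 b) t := by
      rw [← update_eq_self j2 (update zs x c)] at ht
      exact not_Nn_Lb hjj.symm (nq _ hsc (by rw [update_of_ne h.hix.symm, hsi])) ht
    exact ⟨Lb_ne h.hf hj1V hqp (this b) (mv b s hb c), Lb_ne h.hf hj1V hqp (this b') (mv b' s' hb' c)⟩
  obtain ⟨t, ht⟩ := ex q (update zs x 0)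
  refine Lb_not_Nn (z := zs) hj1x (s := t) (fun c => ?_) ((Nn_symm hj1x).2 ((h.z1 j1 hj1 zs hs hsi).2 q hqp))
  obtain ⟨t', ht'⟩ := ex q (update zs x c)
  obtain ⟨h1, h2⟩ := third 0 t ht
  obtain ⟨h3, h4⟩ := third c t' ht'
  rcases fin3_cases hss h1.symm h2.symm t' with e | e | e
  · exact absurd e h3
  · exact absurd e h4
  · rwa [← e]

theorem crux (hU : 2 ≤ U.card) : False := by
  obtain ⟨j1, hj1, z1, hz1, hc⟩ := h.step1 hU
  obtain ⟨q, hqp, lab⟩ := h.lab1 hj1 hz1 hc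
  rcases hU.lt_or_eq with h1 | h1
  · exact h.big hj1 hqp lab h1
  · exact h.small hj1 hqp lab h1.symm

end Crx
end
end QG

namespace QG
open Function
set_option linter.unusedSectionVars false
set_option linter.unusedVariables false
section
variable {ι : Type*} [DecidableEq ι] [Fintype ι]
variable {f : (ι → Fin 4) → Fin 4} {B V Z D K P U : Finset ι} {y z z0 y0 : ι → Fin 4}
  {F : (ι → Fin 4) → ZMod 2} {C : Set (ι → Fin 4)}

lemma noK (h : Code C) (hi : Irr C D y0) {i x k j j' : ι} (hiD : i ∈ D) (hxD : x ∈ D) (hkD : k ∈ D)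
    (hjD : j ∈ D) (hjD' : j' ∈ D) (hxi : x ≠ i) (hik : i ≠ k) (hxk : x ≠ k) (hji : j ≠ i) (hjx : j ≠ x)
    (hjk : j ≠ k) (hji' : j' ≠ i) (hjx' : j' ≠ x) (hjk' : j' ≠ k) (hjj : j ≠ j') {b b' b''} (hb : b ≠ b')
    (h1 : ∀ z, Ag (D.erase k) y0 z → z j = b → Clu (sol C k) ((D.erase k).erase j) z {x, i})
    (h2 : ∀ z, Ag (D.erase k) y0 z → z j = b' → Clu (sol C k) ((D.erase k).erase j) z {x, i})
    (h3 : ∀ z, Ag (D.erase k) y0 z → z j' = b'' → Clu (sol C k) ((D.erase k).erase j') z {x, i}) :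
    False := by
  set K : Finset ι := {x, i} with hK
  have hKm : ∀ l, l ∈ K ↔ l = x ∨ l = i := by simp [hK]
  have hjK : j ∉ K := by simp [hK, hji, hjx]
  have hkK : k ∉ K := by simp [hK, hik.symm, hxk.symm]
  have hjV : j ∈ D.erase k := by simp [*]
  have hjV' : j' ∈ D.erase k := by simp [*]
  have hKD : K ⊆ D.erase j := by
    intro l hl; rcases (hKm l).1 hl with rfl | rfl
    · simp [hxD, hjx.symm]
    · simp [hiD, hji.symm]
  have hKV : K ⊆ D.erase k := by
    intro l hl; rcases (hKm l).1 hl with rfl | rfl <;> simp [*]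
  have hne : K ≠ D.erase j := by
    intro e
    have : j' ∈ K := by rw [e]; simp [hjD', hjj.symm]
    simp [hK, hji', hjx'] at this
  have step : ∀ j0 X X' u u', Clu (sol C k) ((D.erase k).erase j0) u K → Ag (D.erase k) y0 u →
      Ag (D.erase k) y0 u' → j0 ∉ K → u' j0 = u j0 → sol C k (K.piecewise X u) = sol C k (K.piecewise X' u) →
      sol C k (K.piecewise X u') = sol C k (K.piecewise X' u') := by
    intro j0 X X' u u' hc hu hu' hj0 e he
    have := hc (K.piecewise X u) (K.piecewise X' u) u' ?_ (agE hu hu' e) ?_ he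
    · simpa only [pw_pw] using this
    · refine agE hu ?_ (by simp [hj0])
      intro l hl; rw [Finset.piecewise_eq_of_notMem _ _ _ (fun h' => hl (hKV h')), hu l hl]
    · intro l hl; simp [hl]
  refine hi.noclu h hjD hKD (by rw [hK, Finset.card_pair hxi]) hne ?_
  refine T1 (h.lat (by simp)) (hi.conn h hjD) hKD ⟨x, by simp [hK]⟩ hne hb ?_
  intro X X' w hX hw hXX hXb hXb'
  have ps1 : ∀ X b, sol C j X = b ↔ sol C k (update X j b) = X k := by
    intro X b; rw [h.persp hjk.symm, update_eq_self]
  have n : ∀ X : ι → Fin 4, Ag (D.erase j) y0 X → ∀ b, Ag (D.erase k) y0 (update (update X j b) k (y0 k)) := by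
    intro X hX b
    refine ag_erase (D := D) ?_
    intro l hl
    rw [update_of_ne (fun e : l = j => hl (e ▸ hjD)), hX l (fun h' => hl (Finset.mem_of_mem_erase h'))]
  have hX' := hX.trans (hXX.mono hKD)
  -- start
  have s0 : sol C k (K.piecewise X (update (update X j b) k (y0 k))) =
      sol C k (K.piecewise X' (update (update X j b) k (y0 k))) := by
    rw [pw_upd' hkK, pw_upd' hjK, pw_upd' hkK, pw_upd' hjK, sol_upd, sol_upd, Finset.piecewise_same,
      pw_ag hXX, Finset.piecewise_same, (ps1 X b).1 hXb, (ps1 X' b).1 hXb', hXX k hkK]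
  have sb : ∀ u, Ag (D.erase k) y0 u → u j = b → sol C k (K.piecewise X u) = sol C k (K.piecewise X' u) := by
    intro u hu e
    have e1 : update (update X j b) k (y0 k) j = b := by rw [update_of_ne hjk]; simp
    exact step j X X' _ u (h1 _ (n X hX b) e1) (n X hX b) hu hjK (by rw [e, e1]) s0
  have sb' : ∀ u, Ag (D.erase k) y0 u → u j = b' → sol C k (K.piecewise X u) = sol C k (K.piecewise X' u) := by
    intro u hu e
    have hj'K : j' ∉ K := by simp [hK, hji', hjx']
    have a1 : Ag (D.erase k) y0 (update (update u j b) j' b'') := (hu.upd hjV _).upd hjV' _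
    have a2 : Ag (D.erase k) y0 (update u j' b'') := hu.upd hjV' _
    have q1 := sb _ a1 (by rw [update_of_ne hjj]; simp)
    have q2 := step j' X X' _ (update u j' b'') (h3 _ a1 (by simp)) a1 a2 hj'K (by simp) q1
    have e2 : update u j' b'' j = b' := by rw [update_of_ne hjj, e]
    exact step j X X' _ u (h2 _ a2 e2) a2 hu hjK (by rw [e, e2]) q2
  have conv : ∀ X b, sol C j (K.piecewise X w) = b ↔
      sol C k (K.piecewise X (update (update w j b) k (y0 k))) = w k := by
    intro X b
    rw [ps1, pw_upd' hkK, pw_upd' hjK, sol_upd, Finset.piecewise_eq_of_notMem _ _ _ hkK]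
  have nj : ∀ b, update (update w j b) k (y0 k) j = b := fun b => by rw [update_of_ne hjk]; simp
  rw [conv, conv, conv, conv, sb _ (n w hw b) (nj b), sb' _ (n w hw b') (nj b')]
  exact ⟨id, id⟩

def Cherry (C : Set (ι → Fin 4)) (D : Finset ι) (y : ι → Fin 4) : Prop :=
  ∃ k ∈ D, ∃ x ∈ D, x ≠ k ∧ ∃ p, (∀ m ∈ D, m ≠ k → m ≠ x → ∀ z, Ag (D.erase k) y z →
    ¬ Nn (Fk C k p) x m z ∧ ∀ q, q ≠ p → Nn (Fk C k q) x m z) ∧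
    ∃ q, q ≠ p ∧ ∃ z0, Ag (D.erase k) y z0 ∧ Disc (Fk C k q) ((D.erase k).erase x) z0

theorem crux (h : Code C) (hi : Irr C D y0) (hD : 5 ≤ D.card)
    (NH : ∀ j ∈ D, ∀ z, ∀ k ∈ D.erase j, ∃ p, Disc (Fk C k p) ((D.erase j).erase k) z) {i : ι}
    (hiD : i ∈ D) {a : Fin 4} (ns : ¬ SemiOn C (D.erase i) (update y0 i a))
    (hc : Cherry C (D.erase i) (update y0 i a)) : False := by
  obtain ⟨k, hk, x, hx, hxk, p, z1, q, hq, z0, hz0, z2⟩ := hc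
  have hs : Ag (D.erase k) y0 (update y0 i a) := by
    rw [Finset.mem_erase] at hk; exact (Ag.refl _ _).upd (by simp [hiD, hk.1.symm]) a
  rw [Finset.erase_right_comm] at hz0
  have hk' := Finset.mem_erase.1 hk
  have hx' := Finset.mem_erase.1 hx
  have := Crx.crux (f := sol C k) (V := D.erase k) (y0 := y0) (i := i) (x := x) (a := a) (p := p) (qs := q)
    (z0 := z0) (U := ((D.erase i).erase k).erase x) ⟨h.lat (by simp), fun p => hi.conn h hk'.2 p,
      by simp [hiD, hk'.1.symm], by simp [hx'.2, hxk], hx'.1, by simp; tauto, ?_, hq,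
      hs.trans (hz0.mono (Finset.erase_subset _ _)), by simpa using hz0 i (by simp), z2, ?_, ?_, ?_⟩ ?_
  · exact this
  · intro m hm z hz hzi
    simp only [Finset.mem_erase] at hm
    refine z1 m (by simp [hm]) hm.2.1 hm.1 z ?_
    rw [Finset.erase_right_comm]; exact agE hs hz (by simp [hzi])
  · intro j hj z hz
    rw [Finset.mem_erase] at hj
    rw [Finset.erase_right_comm]
    exact NH j hj.2 z k (by simp [hk'.2, hj.1.symm])
  · intro H
    refine ns (semi_of_singles h hk (p := p) ?_)
    rw [Finset.erase_right_comm]; exact H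
  · intro j hj j' hj' hjj b b' b'' hb h1 h2 h3
    simp only [Finset.mem_erase] at hj hj'
    exact noK h hi hiD hx'.2 hk'.2 hj.2.2.2 hj'.2.2.2 hx'.1 hk'.1.symm hxk hj.2.2.1 hj.1 hj.2.1
      hj'.2.2.1 hj'.1 hj'.2.1 hjj hb h1 h2 h3
  · rw [Finset.card_erase_of_mem (by simp [hx'.2, hx'.1, hxk]), Finset.card_erase_of_mem hk,
      Finset.card_erase_of_mem hiD]; omega
end
end QG

namespace QG
open Function
set_option linter.unusedSectionVars false
set_option linter.unusedVariables false
section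
variable {ι : Type*} [DecidableEq ι] [Fintype ι]
variable {f : (ι → Fin 4) → Fin 4} {B V Z D D' K P U : Finset ι} {y z z0 y0 : ι → Fin 4}
  {F : (ι → Fin 4) → ZMod 2} {C : Set (ι → Fin 4)} {k m n : ι}

lemma core (h : Code C) (hm : m ∈ D) (hn : n ∈ D) (hk : k ∈ D) (hmn : m ≠ n) (hmk : m ≠ k) (hnk : n ≠ k)
    (hd : Dif C D y {m, n}) {w} (hz : Ag (D.erase m) y z) (hN : Nn (Fk C k w) m n z) (hkD : k ∈ D')
    (hmD : m ∈ D') (hcl : ∀ c, Cl (Fk C k w) (D'.erase k) (update z n c) {m}) :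
    ∃ p, (∀ l ∈ D, l ≠ m → l ≠ n → ∀ z, Ag (D.erase m) y z →
      ¬ Nn (Fk C m p) n l z ∧ ∀ q, q ≠ p → Nn (Fk C m q) n l z) ∧
      ∃ q, q ≠ p ∧ ∃ c, Cl (Fk C m q) (D'.erase m) (update z n c) {k} := by
  have hU := clu_of_dif h hm (by simp) Finset.sdiff_subset hd.compl
  have hf : Lat (sol C m) (D.erase m) := h.lat (by simp)
  have hnB : n ∈ D.erase m := by simp [hn, hmn.symm]
  have hkB : k ∈ D.erase m := by simp [hk, hmk.symm]
  have cl : ∀ {q l l' z z'}, l ∈ D → l ≠ m → l ≠ n → l' ∈ D → l' ≠ m → l' ≠ n → Ag (D.erase m) y z →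
      Ag (D.erase m) y z' → Nn (Fk C m q) n l z → Nn (Fk C m q) n l' z' := by
    intro q l l' z z' h1 h2 h3 h4 h5 h6 h7 h8 h9
    refine CL hf hU ?_ hnB (by simp) (by simp [*]) (by simp [*]) h7 ?_ h9
    · intro i; simp; tauto
    · refine (h7.symm.trans h8).mono ?_
      intro i; simp; tauto
  obtain ⟨p, hp⟩ := hf.ls hnB hkB hnk z
  have : ∃ q0, Nn (Fk C m q0) n k z := by
    by_contra! H; exact klein h hmn hmk hnk H w hN
  obtain ⟨q0, hq0⟩ := this
  have hqp : q0 ≠ p := by rintro rfl; exact hp hq0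
  refine ⟨p, fun l hl hlm hln z' hz' => ?_, ?_⟩
  · have n1 : ¬ Nn (Fk C m p) n l z' := fun h' => hp (cl hl hlm hln hk hmk.symm hnk.symm hz' hz h')
    have n2 : Nn (Fk C m q0) n l z' := cl hk hmk.symm hnk.symm hl hlm hln hz hz' hq0
    refine ⟨n1, fun q hq => ?_⟩
    by_contra n3
    exact Nn_third hq.symm hqp.symm (fun e => n3 (e ▸ n2)) n1 n3 n2
  · by_contra! H
    refine Lb_not_Nn hmn (s := p) (fun c => ?_) hN
    obtain ⟨s, hs⟩ := (h.lat (k := k) (V := {m}) (by simpa using hmk.symm)).bal w m (by simp) (update z n c)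
    by_cases e : s = p
    · subst e; exact hs
    · obtain ⟨c0, hs⟩ := hs
      exact absurd (persp2 h hkD hmD hmk.symm (hcl c) hs) (H s e c)

lemma pair_N (hc : Comp F B y {m, n}) (hmn : m ≠ n) : ∃ z, Ag B y z ∧ Nn F m n z := by
  have hm : m ∈ B := hc.1 (by simp)
  have : ¬ Cl F B y {m} := fun h' => by
    have := hc.2.2.2 {m} (by simp) (by simp) h'
    have h2 : n ∈ ({m} : Finset ι) := by rw [this]; simp
    exact hmn (Finset.mem_singleton.1 h2).symm
  unfold Cl at this; push Not at this
  obtain ⟨l, hl, -, j, hj, hjl, z, hz, hN⟩ := this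
  rw [Finset.mem_singleton] at hl hjl; subst hl
  by_cases e : j = n
  · subst e; exact ⟨z, hz, hN⟩
  · exact absurd hN (hc.2.2.1 l (by simp) hm j hj (by simp [hjl, e]) z hz)

lemma S2 (h : Code C) (hk : k ∈ D) {p} (hc : Comp (Fk C k p) (D.erase k) y K) (hK : K.card = 2)
    (hD : 4 ≤ D.card) : Cherry C D y := by
  obtain ⟨m, n, hmn, rfl⟩ := Finset.card_eq_two.1 hK
  have hd := dif_of_clu h hk hc.1 (CLU (h.lat (by simp)) hc)
  have hmB := hc.1 (by simp : m ∈ ({m, n} : Finset ι))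
  have hnB := hc.1 (by simp : n ∈ ({m, n} : Finset ι))
  obtain ⟨z, hz, hN⟩ := pair_N hc hmn
  rw [Finset.mem_erase] at hmB hnB
  have hz2 : Ag (D.erase k) y (update z m (y m)) := hz.upd (by simp [hmB]) _
  have hz1 : Ag (D.erase m) y (update z m (y m)) := ag_erase (hz.mono (Finset.erase_subset _ _))
  obtain ⟨p', h1, q, hq, c, h2⟩ := core h hmB.2 hnB.2 hk hmn hmB.1 hnB.1 hd hz1 (Nn_upd_left.2 hN)
    (D' := D.erase n) (by simp [hk, hnB.1.symm]) (by simp [hmB, hmn]) (by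
      intro c l hl hlB j hj hjl x hx
      simp only [Finset.mem_singleton] at hl hjl; subst hl
      simp only [Finset.mem_erase] at hj
      refine hc.2.2.1 l (by simp) (by simp [hmB]) j (by simp [hj]) (by simp [hj, hjl]) x ?_
      exact (hz2.upd (by simp [hnB]) c).trans (hx.mono (by intro i; simp; tauto)))
  refine ⟨m, hmB.2, n, hnB.2, hmn.symm, p', fun l h3 h4 h5 => h1 l h3 h4 h5, q, hq, _,
    hz1.upd (l := n) (by simp [hnB, hmn.symm]) c, {k}, by simp [hk, hnB.1.symm, hmB.1.symm], by simp, ?_, ?_⟩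
  · intro e
    have := congrArg Finset.card e
    rw [Finset.card_erase_of_mem (by simp [hnB, hmn.symm]), Finset.card_erase_of_mem hmB.2] at this
    simp at this; omega
  · rw [Finset.erase_right_comm]; exact h2

def Rp (C : Set (ι → Fin 4)) (D : Finset ι) (y : ι → Fin 4) (k : ι) : Prop :=
  ∃ Z, Z ⊆ D.erase k ∧ Z.card = 3 ∧ Dif C D y Z ∧ SemiOn C (insert k Z) y ∧
    ∀ l ∈ Z, SemiOn C (insert l (D \ Z)) y

lemma T311 (h : Code C) (hD : D.card = 6) (hk : k ∈ D) {p} (hc : Comp (Fk C k p) (D.erase k) y Z)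
    (hZ : Z.card = 3) (hs : ∀ l ∈ D.erase k, l ∉ Z → Cl (Fk C k p) (D.erase k) y {l})
    (NH : ∃ w, Disc (Fk C k w) ((insert k Z).erase k) y) : Cherry C D y ∨ Rp C D y k := by
  have hcl := CLU (h.lat (by simp)) hc
  have hd := dif_of_clu h hk hc.1 hcl
  have hkZ : k ∉ Z := fun e => by simpa using hc.1 e
  obtain ⟨w, hw⟩ := NH
  rcases thmB h (Finset.mem_insert_self k Z) hw with hse | ⟨K, hK1, hK2, hK3, hK4⟩
  · right
    refine ⟨Z, hc.1, hZ, hd, hse, fun l hl => ?_⟩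
    refine semi_of_singles h (k := k) (p := p) (by simp [hk, hkZ]) ?_
    have hlV := Finset.mem_erase.1 (hc.1 hl)
    have hB : (insert l (D \ Z)).erase k ⊆ D.erase k := by
      intro i; simp; rintro h1 (rfl | h2); exacts [hlV, ⟨h1, h2.1⟩]
    intro j hj
    by_cases hjZ : j ∈ Z
    · intro j' hj' hjB m hm hml x hx
      simp only [Finset.mem_singleton] at hj' hml; subst hj'
      refine hc.2.2.1 j' hjZ (hB hj) m (hB hm) ?_ x (hx.mono hB)
      simp only [Finset.mem_erase, Finset.mem_insert, Finset.mem_sdiff] at hm hj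
      rcases hm.2 with e | e
      · subst e; exact absurd ((hj.2.resolve_right (by simp [hjZ])).symm) hml
      · exact e.2
    · exact (hs j (hB hj) hjZ).mono hB (Ag.refl _ _)
  left
  rw [Finset.erase_insert hkZ] at hK3
  have hK2 : K.card = 2 := by rw [Finset.card_insert_of_notMem hkZ] at hK2; omega
  have hcK : Clu (sol C k) Z y K := CLU (h.lat hkZ) hK3
  have hKZ := hK3.1
  have hcK' : Clu (sol C k) (D.erase k) y K := by
    intro x x' w hx hw hxx hf
    have e1 := hcl x x' y hx (Ag.refl _ _) (hxx.mono hKZ) hf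
    have e2 := hcK _ _ (Z.piecewise w y) Ag_pw Ag_pw (by
      intro i hi; by_cases h1 : i ∈ Z <;> simp [h1, hxx i hi]) e1
    have e : ∀ x, K.piecewise (Z.piecewise x y) (Z.piecewise w y) = Z.piecewise (K.piecewise x w) y := by
      intro x; funext i
      by_cases h1 : i ∈ Z <;> by_cases h2 : i ∈ K
      · simp [h1, h2]
      · simp [h1, h2]
      · exact absurd (hKZ h2) h1
      · simp [h1, h2]
    rw [e, e] at e2
    have e3 := hcl _ _ w ((Ag_pw (P := Z) (x := K.piecewise x w) (w := y)).mono hc.1) hw (by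
      intro i hi; simp [hi]) e2
    have e4 : ∀ x, Z.piecewise (Z.piecewise (K.piecewise x w) y) w = K.piecewise x w := by
      intro x; funext i
      by_cases h1 : i ∈ Z <;> by_cases h2 : i ∈ K
      · simp [h1, h2]
      · simp [h1, h2]
      · exact absurd (hKZ h2) h1
      · simp [h1, h2]
    rwa [e4, e4] at e3
  have hdK := dif_of_clu h hk (hKZ.trans hc.1) hcK'
  obtain ⟨l, hl⟩ : ∃ l, Z \ K = {l} := by
    rw [← Finset.card_eq_one, Finset.card_sdiff_of_subset hKZ]; omega
  obtain ⟨m, n, hmn, rfl⟩ := Finset.card_eq_two.1 hK2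
  obtain ⟨z, hz, hN⟩ := pair_N hK3 hmn
  have hZe : ∀ i, i ∈ Z ↔ i = m ∨ i = n ∨ i = l := by
    intro i
    have := Finset.ext_iff.1 hl i
    have h2 := @hKZ i
    simp at this h2; tauto
  have hlK : l ∈ Z ∧ l ∉ ({m, n} : Finset ι) := by
    rw [← Finset.mem_sdiff, hl]; simp
  have hlm : l ≠ m := by rintro rfl; simp at hlK
  have hln : l ≠ n := by rintro rfl; simp at hlK
  have hmZ : m ∈ Z := hKZ (by simp)
  have hnZ : n ∈ Z := hKZ (by simp)
  have hmB := Finset.mem_erase.1 (hc.1 hmZ)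
  have hnB := Finset.mem_erase.1 (hc.1 hnZ)
  have hlB := Finset.mem_erase.1 (hc.1 hlK.1)
  have hz2 : Ag Z y (update z m (y m)) := hz.upd hmZ _
  have hz1 : Ag (D.erase m) y (update z m (y m)) :=
    ag_erase (hz.mono (hc.1.trans (Finset.erase_subset _ _)))
  obtain ⟨p', h1, q, hq, c, h2⟩ := core h hmB.2 hnB.2 hk hmn hmB.1 hnB.1 hdK hz1 (Nn_upd_left.2 hN)
    (D' := {k, m, l}) (by simp) (by simp) (by
      intro c j hj hjB i hi hij x hx
      simp only [Finset.mem_singleton] at hj hij; subst hj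
      simp only [Finset.mem_erase, Finset.mem_insert, Finset.mem_singleton] at hi
      have hil : i = l := by tauto
      subst hil
      refine hK3.2.2.1 j (by simp) hmZ i hlK.1 hlK.2 x ?_
      refine (hz2.upd hnZ c).trans (hx.mono ?_)
      intro a; rw [hZe]; simp; tauto)
  have hcU := clu_of_dif h hmB.2 (by simp [hmZ]) Finset.sdiff_subset hd.compl
  have hlat : Lat (sol C m) (D.erase m) := h.lat (by simp)
  have hUe : ∀ i, i ∈ (D.erase m).erase n ↔ i ∈ insert l (D \ Z) := by
    intro i; simp only [Finset.mem_erase, Finset.mem_insert, Finset.mem_sdiff, hZe]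
    by_cases e : i = l
    · subst e; simp [hln, hlm, hlB]
    · tauto
  refine ⟨m, hmB.2, n, hnB.2, hmn.symm, p', fun l h3 h4 h5 => h1 l h3 h4 h5, q, hq, _,
    hz1.upd (l := n) (by simp [hnB, hmn.symm]) c, {l}, by simp [hln, hlm, hlB], by simp, ?_, ?_⟩
  · intro e
    have := (Finset.ext_iff.1 e k).2 (by simp [hk, hmB.1.symm, hnB.1.symm])
    exact hlB.1 (Finset.mem_singleton.1 this).symm
  · intro l' hl' hlU j hj hjl x hx hNx
    simp only [Finset.mem_singleton] at hl' hjl; subst hl'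
    have hjU := (Finset.mem_insert.1 ((hUe j).1 hj)).resolve_left hjl
    refine h2 k (by simp) (by simp [hmB.1.symm]) l' (by simp [hlm]) (by simpa using hlB.1) _ (Ag.refl _ _) ?_
    rw [Nn_symm hlB.1.symm]
    refine CL hlat hcU ?_ (by simp [hlB, hlm]) (by simp [hlK.1]) hjU (by simp [hk, hkZ]) (z := x) ?_ ?_ hNx
    · intro i hi
      have := (hUe i).2 (Finset.mem_insert_of_mem hi)
      exact Finset.mem_of_mem_erase this
    · exact (hz1.upd (by simp [hnB, hmn.symm]) c).trans (hx.mono (Finset.erase_subset _ _))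
    · exact hx.symm.mono (fun i hi => (hUe i).1 hi)

theorem lemE (h : Code C) (hD : 4 ≤ D.card) (hD6 : D.card ≤ 6) (hns : ¬ SemiOn C D y) (hk : k ∈ D)
    (NH : ∀ D', D' ⊆ D → 3 ≤ D'.card → k ∈ D' → ∃ p, Disc (Fk C k p) (D'.erase k) y) :
    Cherry C D y ∨ (D.card = 6 ∧ Rp C D y k) := by
  have hV : (D.erase k).card = D.card - 1 := Finset.card_erase_of_mem hk
  have hlat : Lat (sol C k) (D.erase k) := h.lat (by simp)
  have NHZ : ∀ Z, Z ⊆ D.erase k → 3 ≤ Z.card → ∃ w, Disc (Fk C k w) ((insert k Z).erase k) y := by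
    intro Z hZ hc
    refine NH _ (Finset.insert_subset hk (hZ.trans (Finset.erase_subset _ _))) ?_ (by simp)
    have := Finset.card_le_card (Finset.subset_insert k Z); omega
  obtain ⟨p, hp⟩ := NH D subset_rfl (by omega) hk
  rcases thmB h hk hp with hse | ⟨Z, hZ2, hZD, hZ, hdZ⟩
  · exact absurd hse hns
  by_cases hZ3 : Z.card = 2
  · exact Or.inl (S2 h hk hZ hZ3 hD)
  have hkZ : k ∉ Z := fun e => by simpa using hZ.1 e
  have hcard := Finset.card_sdiff_of_subset hZ.1
  by_cases h1 : Z.card + 2 = D.card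
  · obtain ⟨x, hx⟩ := Finset.card_eq_one.1 (by omega : (D.erase k \ Z).card = 1)
    have hx1 : x ∈ D.erase k \ Z := by rw [hx]; simp
    have hxV := (Finset.mem_sdiff.1 hx1).1
    have hxZ := (Finset.mem_sdiff.1 hx1).2
    have hm : ∀ m ∈ D.erase k, m ≠ x → m ∈ Z := by
      intro m hm hmx; by_contra h2
      have : m ∈ D.erase k \ Z := by simp only [Finset.mem_sdiff]; exact ⟨hm, h2⟩
      rw [hx] at this; simp [hmx] at this
    have hxc : ∀ q, Cl (Fk C k q) (D.erase k) y {x} ↔ ∀ m ∈ Z, ∀ z, Ag (D.erase k) y z → ¬ Nn (Fk C k q) x m z := by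
      intro q; constructor
      · intro hc m hm' z hz
        exact hc x (by simp) hxV m (hZ.1 hm') (by simp; intro e; exact hxZ (e ▸ hm')) z hz
      · intro H l hl _ m hmV hml z hz
        simp only [Finset.mem_singleton] at hl hml; subst hl
        exact H m (hm m hmV hml) z hz
    have hxp : Cl (Fk C k p) (D.erase k) y {x} := by rw [← hx]; exact hZ.2.2.1.compl
    obtain ⟨w, hw⟩ := NHZ Z hZ.1 (by omega)
    rw [Finset.erase_insert hkZ] at hw
    have hwp : w ≠ p := by
      rintro rfl; exact hw.not_conn (hZ.conn (Ag.refl _ _))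
    have hxk := Finset.mem_erase.1 hxV
    by_cases hq : ∃ q, ¬ Cl (Fk C k q) (D.erase k) y {x}
    · left
      obtain ⟨q, hq⟩ := hq
      rw [hxc] at hq; push Not at hq
      obtain ⟨m0, hm0, z1, hz1, hN⟩ := hq
      have hqp : q ≠ p := by rintro rfl; exact (hxc q).1 hxp m0 hm0 z1 hz1 hN
      refine ⟨k, hk, x, hxk.2, hxk.1, p, fun m hmD hmk hmx z hz => ?_, w, hwp, y, Ag.refl _ _, ?_⟩
      · have hmZ := hm m (by simp [*]) hmx
        have n1 := (hxc p).1 hxp m hmZ z hz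
        have n2 : Nn (Fk C k q) x m z := by
          refine CL hlat (CLU hlat hZ) hZ.1 hxV hxZ hm0 hmZ hz1 ((hz1.symm.trans hz).mono ?_) hN
          intro i hi; by_cases e : i = x
          · simp [e]
          · simp [hm i hi e]
        refine ⟨n1, fun r hr => ?_⟩
        by_contra n3
        exact Nn_third hr.symm hqp.symm (fun e => n3 (e ▸ n2)) n1 n3 n2
      · have : (D.erase k).erase x = Z := by
          ext i; simp only [Finset.mem_erase, ne_eq]
          exact ⟨fun hi => hm i (by simp [hi]) hi.1, fun hi =>
            ⟨fun e => hxZ (e ▸ hi), Finset.mem_erase.1 (hZ.1 hi)⟩⟩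
        rwa [this]
    · push Not at hq
      have hdw : Disc (Fk C k w) (D.erase k) y := ⟨{x}, by simpa using hxk, by simp, by
        intro e; rw [← e] at hV; simp at hV; omega, hq w⟩
      rcases thmB h hk hdw with hse | ⟨K, hK2, hKD, hK, hdK⟩
      · exact absurd hse hns
      have hxK : x ∉ K := by
        intro hxK
        rcases hK.sub_or_disj (hq w) with h2 | h2
        · have := Finset.card_le_card h2; simp at this; omega
        · exact Finset.disjoint_left.1 h2 hxK (by simp)
      have hKZ : K ⊆ Z := fun i hi => hm i (hK.1 hi) (fun e => hxK (e ▸ hi))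
      have hne : K ≠ Z := by
        rintro rfl; exact hw.not_conn (hK.conn (Ag.refl _ _))
      have hlt := Finset.card_lt_card (hKZ.ssubset_of_ne hne)
      by_cases hK3 : K.card = 2
      · exact Or.inl (S2 h hk hK hK3 hD)
      have hD6' : D.card = 6 := by omega
      refine (T311 h hD6' hk hK (by omega) ?_ (NHZ K hK.1 (by omega))).imp id fun h => ⟨hD6', h⟩
      intro l hl hlK
      by_cases hlx : l = x
      · subst hlx; exact hq w
      have : (D.erase k \ K) \ {x} = {l} := by
        symm
        refine Finset.eq_of_subset_of_card_le (by
          rw [Finset.singleton_subset_iff, Finset.mem_sdiff, Finset.mem_sdiff]; exact ⟨⟨hl, hlK⟩, by simpa⟩) ?_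
        rw [Finset.card_sdiff_of_subset (by
          rw [Finset.singleton_subset_iff, Finset.mem_sdiff]; exact ⟨hxV, hxK⟩), Finset.card_sdiff_of_subset hK.1]
        simp; omega
      rw [← this]
      exact hK.2.2.1.compl.sdiff (hq w) Finset.sdiff_subset
  · have hD6' : D.card = 6 := by omega
    have hc2 : (D.erase k \ Z).card = 2 := by omega
    by_cases hs : ∀ l ∈ D.erase k, l ∉ Z → Cl (Fk C k p) (D.erase k) y {l}
    · exact (T311 h hD6' hk hZ (by omega) hs (NHZ Z hZ.1 (by omega))).imp id fun h => ⟨hD6', h⟩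
    · push Not at hs
      obtain ⟨l, hl, hlZ, hncl⟩ := hs
      obtain ⟨K, hlK, hK⟩ := exists_comp (Fk C k p) (D.erase k) y hl
      have hsub : K ⊆ D.erase k \ Z := by
        rcases hK.sub_or_disj hZ.2.2.1.compl with h2 | h2
        · exact h2
        · exact absurd (Finset.mem_sdiff.2 ⟨hl, hlZ⟩) (Finset.disjoint_left.1 h2 hlK)
      have hle := Finset.card_le_card hsub
      left
      refine S2 h hk hK ?_ hD
      have : K.card ≠ 1 := by
        intro e
        obtain ⟨j, rfl⟩ := Finset.card_eq_one.1 e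
        rw [Finset.mem_singleton] at hlK; subst hlK
        exact hncl hK.2.2.1
      have := Finset.card_pos.2 hK.2.1
      omega
end
end QG

namespace QG
open Function
set_option linter.unusedSectionVars false
set_option linter.unusedVariables false
section
variable {ι : Type*} [DecidableEq ι] [Fintype ι]
variable {D : Finset ι} {y : ι → Fin 4} {C : Set (ι → Fin 4)} {k i : ι}

lemma irr_layer (h : Code C) (hi : Irr C D y) (hD : 5 ≤ D.card) (hD7 : D.card ≤ 7) (hiD : i ∈ D)
    (NH : ∀ D' : Finset ι, 3 ≤ D'.card → D'.card < D.card → ∀ z, ∀ k ∈ D', ∃ p, Disc (Fk C k p) (D'.erase k) z)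
    {a} (ns : ¬ SemiOn C (D.erase i) (update y i a)) (hk : k ∈ D.erase i) :
    D.card = 7 ∧ Rp C (D.erase i) (update y i a) k := by
  have hc := Finset.card_erase_of_mem hiD
  rcases lemE h (by omega) (by omega) ns hk (fun D' h1 h2 h3 => NH D' h2
    ((Finset.card_le_card h1).trans_lt (by omega)) _ k h3) with h1 | h1
  · refine (crux h hi hD (fun j hj z k hk => NH _ ?_ ?_ z k hk) hiD ns h1).elim <;>
      rw [Finset.card_erase_of_mem hj] <;> omega
  · exact ⟨by omega, h1.2⟩

theorem NH (h : Code C) : ∀ (N : ℕ) (D : Finset ι), D.card = N → 3 ≤ N → N ≤ 6 → ∀ y, ∀ k ∈ D,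
    ∃ p, Disc (Fk C k p) (D.erase k) y := by
  intro N
  induction N using Nat.strong_induction_on with
  | _ N IH =>
  intro D hN h3 h6 y k hk
  have hV := Finset.card_erase_of_mem hk
  have NH : ∀ D' : Finset ι, 3 ≤ D'.card → D'.card < D.card → ∀ z, ∀ k ∈ D', ∃ p, Disc (Fk C k p) (D'.erase k) z :=
    fun D' h1 h2 z k hk => IH D'.card (by omega) D' rfl h1 (by omega) z k hk
  by_cases e3 : N = 3
  · obtain ⟨l, m, hlm, hlm2⟩ := Finset.card_eq_two.1 (by omega : (D.erase k).card = 2)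
    obtain ⟨p, hp⟩ := (h.lat (k := k) (V := D.erase k) (by simp)).ls (l := l) (m := m)
      (by simp [hlm2]) (by simp [hlm2]) hlm y
    refine ⟨p, {l}, by simp [hlm2], by simp, ?_, ?_⟩
    · intro e; rw [hlm2] at e; have := congrArg Finset.card e; rw [Finset.card_pair hlm] at this; simp at this
    · rw [hlm2]
      intro l' hl' _ j hj hjl x hx
      simp only [Finset.mem_singleton, Finset.mem_insert] at hl' hjl hj
      subst hl'
      rw [hj.resolve_left hjl, Nn_ag hx]; exact hp
  by_contra! hc
  have aux : ∀ K, K ⊆ D → 2 ≤ K.card → K.card + 2 ≤ D.card → k ∈ K → ¬ Dif C D y K := by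
    intro K hK h1 h2 hkK hd
    obtain ⟨l, hl, hlK⟩ := Finset.exists_mem_notMem_of_card_lt_card (by omega : K.card < D.card)
    have hci := Finset.card_insert_of_notMem hlK
    obtain ⟨p, hp⟩ := NH (insert l K) (by omega) (by omega) y k (by simp [hkK])
    exact hc p (red_NH h hkK hK hd hl hlK hp)
  have hi : Irr C D y := by
    refine ⟨fun hs => ?_, fun K hK h1 h2 hd => ?_⟩
    · obtain ⟨p, hp⟩ := semi_disc h hk (by omega) hs
      exact hc p hp
    · by_cases hkK : k ∈ K
      · exact aux K hK h1 h2 hkK hd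
      · have := Finset.card_sdiff_of_subset hK
        exact aux (D \ K) Finset.sdiff_subset (by omega) (by omega) (by simp [hk, hkK]) hd.compl
  have : ∃ a, ¬ SemiOn C (D.erase k) (update y k a) := by
    by_contra! H
    exact hi.layers h (by omega) hk (show (0 : Fin 4) ≠ 1 by decide) (H 0) (H 1)
  obtain ⟨a, ha⟩ := this
  obtain ⟨l, hl⟩ : (D.erase k).Nonempty := Finset.card_pos.1 (by omega)
  by_cases e4 : N = 4
  · obtain ⟨p, hp⟩ := NH (D.erase k) (by omega) (by omega) (update y k a) l hl
    rcases thmB h hl hp with h1 | ⟨K, h1, h2, -⟩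
    · exact ha h1
    · omega
  · have := irr_layer h hi (by omega) (by omega) hk NH ha hl
    omega

lemma no_irr (h : Code C) (h3 : 3 ≤ D.card) (h6 : D.card ≤ 6) : ¬ Irr C D y := by
  intro hi
  obtain ⟨k, hk⟩ : D.Nonempty := Finset.card_pos.1 (by omega)
  obtain ⟨p, hp⟩ := NH h _ D rfl h3 h6 y k hk
  exact hp.not_conn (hi.conn h hk p)

lemma irr7 (h : Code C) (hi : Irr C D y) (hD : D.card = 7) (hiD : i ∈ D) {a}
    (ns : ¬ SemiOn C (D.erase i) (update y i a)) (hk : k ∈ D.erase i) :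
    Rp C (D.erase i) (update y i a) k :=
  (irr_layer h hi (by omega) (by omega) hiD
    (fun D' h1 h2 z k hk => NH h _ D' rfl h1 (by omega) z k hk) ns hk).2
end
end QG

namespace QG
open Function
set_option linter.unusedSectionVars false
set_option linter.unusedVariables false
section
variable {ι : Type*} [DecidableEq ι] [Fintype ι]
variable {D : Finset ι} {y : ι → Fin 4} {C : Set (ι → Fin 4)} {k i : ι}

/-- the section of a code -/
def sec (C : Set (ι → Fin 4)) (D : Finset ι) (y : ι → Fin 4) : Set (ι → Fin 4) :=
  {x | x ∈ C ∧ Ag D y x}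

/-- sections of all codes, of semilinear ones and of the others -/
def CS (D : Finset ι) (y : ι → Fin 4) : Set (Set (ι → Fin 4)) := {S | ∃ C, Code C ∧ S = sec C D y}
def SS (D : Finset ι) (y : ι → Fin 4) : Set (Set (ι → Fin 4)) :=
  {S | ∃ C, Code C ∧ SemiOn C D y ∧ S = sec C D y}
def NS (D : Finset ι) (y : ι → Fin 4) : Set (Set (ι → Fin 4)) :=
  {S | ∃ C, Code C ∧ ¬ SemiOn C D y ∧ S = sec C D y}

lemma ps_inv (p : Fin 3) (b d : ZMod 2) : ∃ e, ps p e = b ∧ ps (p + 1) e = d := by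
  revert p b d; decide
lemma p1 (p : Fin 3) : p ≠ p + 1 := by revert p; decide

lemma sum_upd (g : ι → Fin 4 → ZMod 2) {B : Finset ι} {m : ι} (hm : m ∈ B) (x : ι → Fin 4) (v) :
    ∑ l ∈ B, g l (update x m v l) = ∑ l ∈ B, g l (x l) + (g m v + g m (x m)) := by
  rw [← Finset.add_sum_erase B _ hm, ← Finset.add_sum_erase B (fun l => g l (x l)) hm]
  have : ∑ l ∈ B.erase m, g l (update x m v l) = ∑ l ∈ B.erase m, g l (x l) :=
    Finset.sum_congr rfl (fun l hl => by rw [update_of_ne (Finset.ne_of_mem_erase hl)])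
  rw [this]; simp; grind

lemma sum_upd' (g : ι → Fin 4 → ZMod 2) {B : Finset ι} {m : ι} (hm : m ∉ B) (x : ι → Fin 4) (v) :
    ∑ l ∈ B, g l (update x m v l) = ∑ l ∈ B, g l (x l) :=
  Finset.sum_congr rfl (fun l hl => by rw [update_of_ne (fun e : l = m => hm (e ▸ hl))])

/-- the semilinear section with given parameters -/
def mk (k : ι) (D : Finset ι) (y : ι → Fin 4) (P : ι → Fin 3) (c : ZMod 2)
    (β : (↥(D.erase k) → ZMod 2) → ZMod 2) : Set (ι → Fin 4) :=
  {x | Ag D y x ∧ ∑ l ∈ D, ps (P l) (x l) = c ∧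
    ∑ l ∈ D, ps (P l + 1) (x l) = β (fun l => ps (P l) (x l))}

lemma semi_mk (h : Code C) (hk : k ∈ D) {P : ι → Fin 3} {c : ZMod 2}
    (hs : ∀ x ∈ C, Ag D y x → ∑ l ∈ D, ps (P l) (x l) = c) : ∃ β, sec C D y = mk k D y P c β := by
  choose inv hinv hinv' using ps_inv
  set G : (ι → Fin 4) → ZMod 2 :=
    fun x => ps (P k + 1) (sol C k x) + ∑ l ∈ D.erase k, ps (P l + 1) (x l) with hG
  have hsol : ∀ x, Ag D y x → ps (P k) (sol C k x) + ∑ l ∈ D.erase k, ps (P l) (x l) = c := by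
    intro x hx
    have := hs _ (h.sol_mem k x) (hx.upd hk _)
    rw [← Finset.add_sum_erase D _ hk, sum_upd' (fun l => ps (P l)) (by simp)] at this
    simpa using this
  have hG1 : ∀ x, Ag D y x → ∀ m ∈ D.erase k, ∀ v, ps (P m) v = ps (P m) (x m) →
      G (update x m v) = G x := by
    intro x hx m hm v hv
    by_cases hvm : v = x m
    · subst hvm; simp
    have e1 := hsol x hx
    have e2 := hsol _ (hx.upd (Finset.mem_of_mem_erase hm) v)
    rw [sum_upd (fun l => ps (P l)) hm] at e2
    have hne : sol C k (update x m v) ≠ sol C k x := by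
      intro e
      have := h.lat (V := D.erase k) (k := k) (by simp) m hm x (a₁ := v) (a₂ := x m) (by simpa using e)
      exact hvm this
    have e3 := ps_sep (p1 (P k)) (by grind) hne
    have e4 := ps_sep (p1 (P m)) hv hvm
    simp only [hG]
    rw [sum_upd (fun l => ps (P l + 1)) hm, e3, e4]
    grind
  let X : (ι → ZMod 2) → (ι → ZMod 2) → ι → Fin 4 :=
    fun b d l => if l ∈ D.erase k then inv (P l) (b l) (d l) else y l
  have hX : ∀ b d, Ag D y (X b d) := fun b d l hl => by
    simp only [X]; rw [if_neg (fun h' => hl (Finset.mem_of_mem_erase h'))]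
  have hG2 : ∀ b d, G (X b d) = G (X b 0) := by
    intro b d
    have : ∀ E : Finset ι, G (X b (fun l => if l ∈ E then d l else 0)) = G (X b 0) := by
      intro E
      induction E using Finset.induction_on with
      | empty => simp; rfl
      | insert m E hm ih =>
        rw [← ih]
        by_cases hmD : m ∈ D.erase k
        · rw [← hG1 (X b (fun l => if l ∈ E then d l else 0)) (hX _ _) m hmD (inv (P m) (b m) (d m))]
          · congr 1
            funext l
            by_cases hl : l = m
            · subst hl; simp [X, (Finset.mem_erase.1 hmD)]
            · simp [X, hl]
          · simp only [X, if_pos hmD, hinv]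
        · congr 1
          funext l
          by_cases hl : l = m
          · subst hl; simp only [X, if_neg hmD]
          · simp [X, hl]
    simpa using this Finset.univ
  refine ⟨fun b => G (X (fun l => if h : l ∈ D.erase k then b ⟨l, h⟩ else 0) 0), ?_⟩
  have hG3 : ∀ x, Ag D y x → G x = G (X (fun l => if h : l ∈ D.erase k then
      (fun l : ↥(D.erase k) => ps (P l) (x l)) ⟨l, h⟩ else 0) 0) := by
    intro x hx
    rw [← hG2 _ (fun l => ps (P l + 1) (x l))]
    simp only [hG]
    congr 1
    · congr 1
      apply sol_congr
      intro l hl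
      by_cases hlD : l ∈ D
      · simp only [X, Finset.mem_erase, ne_eq, hl, not_false_eq_true, hlD, and_self, if_true, dif_pos]
        exact ps_ext (p1 (P l)) (by rw [hinv]) (by rw [hinv'])
      · simp [X, hlD, hx l hlD]
    · refine Finset.sum_congr rfl fun l hl => ?_
      simp only [X, if_pos hl, hinv']
  ext x
  constructor
  · rintro ⟨hx, ha⟩
    refine ⟨ha, hs x hx ha, ?_⟩
    refine Eq.trans ?_ (hG3 x ha)
    rw [← Finset.add_sum_erase D _ hk]
    simp only [hG]
    rw [← (h.mem k).1 hx]
  · rintro ⟨ha, h1, h2⟩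
    refine ⟨(h.mem k).2 ?_, ha⟩
    replace h2 := h2.trans (hG3 x ha).symm
    rw [← Finset.add_sum_erase D _ hk] at h2
    rw [← hsol x ha, ← Finset.add_sum_erase D _ hk] at h1
    simp only [hG] at h2
    exact ps_ext (p1 (P k)) (add_right_cancel h1) (add_right_cancel h2)

lemma SS_card (hD : D.Nonempty) (y : ι → Fin 4) :
    (SS D y).ncard ≤ 2 * 3 ^ D.card * 2 ^ 2 ^ (D.card - 1) := by
  obtain ⟨k, hk⟩ := hD
  let F : (D → Fin 3) × ZMod 2 × ((↥(D.erase k) → ZMod 2) → ZMod 2) → Set (ι → Fin 4) :=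
    fun q => mk k D y (fun l => if h : l ∈ D then q.1 ⟨l, h⟩ else 0) q.2.1 q.2.2
  have hsub : SS D y ⊆ Set.range F := by
    rintro S ⟨C, h, ⟨P, c, hs⟩, rfl⟩
    obtain ⟨β, hβ⟩ := semi_mk (P := fun l => if l ∈ D then P l else 0) (c := c) h hk (y := y) (by
      intro x hx ha
      rw [← hs x hx ha]
      exact Finset.sum_congr rfl fun l hl => by simp [hl])
    exact ⟨⟨fun l => P l, c, β⟩, by rw [hβ]; simp [F]⟩
  calc (SS D y).ncard ≤ (Set.range F).ncard := Set.ncard_le_ncard hsub (Set.toFinite _)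
    _ ≤ (Set.univ : Set ((D → Fin 3) × ZMod 2 × ((↥(D.erase k) → ZMod 2) → ZMod 2))).ncard := by
      rw [← Set.image_univ]; exact Set.ncard_image_le
    _ = 2 * 3 ^ D.card * 2 ^ 2 ^ (D.card - 1) := by
      rw [Set.ncard_univ, Nat.card_eq_fintype_card]
      simp only [Fintype.card_prod, Fintype.card_fun, Fintype.card_fin, ZMod.card, Fintype.card_coe,
        Finset.card_erase_of_mem hk]
      ring

end
end QG

namespace QG
open Function
set_option linter.unusedSectionVars false
set_option linter.unusedVariables false
section
variable {ι : Type*} [DecidableEq ι] [Fintype ι]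
variable {D : Finset ι} {y : ι → Fin 4} {C C' : Set (ι → Fin 4)} {k i : ι}

lemma sec_ext (h : Code C) (h' : Code C') (hk : k ∈ D)
    (e : ∀ x, Ag (D.erase k) y x → sol C k x = sol C' k x) : sec C D y = sec C' D y := by
  ext x
  refine and_congr_left fun hx => ?_
  rw [h.mem k, h'.mem k, ← sol_upd C k x (y k), ← sol_upd C' k x (y k), e]
  intro l hl
  by_cases hlk : l = k
  · subst hlk; simp
  · rw [update_of_ne hlk]; exact hx l (fun h => hl (Finset.mem_erase.2 ⟨hlk, h⟩))

lemma sec_sol (h : Code C) (h' : Code C') (hk : k ∈ D) (e : sec C D y = sec C' D y) {x}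
    (hx : Ag D y x) : sol C k x = sol C' k x := by
  have : update x k (sol C k x) ∈ sec C D y := ⟨h.sol_mem _ _, hx.upd hk _⟩
  rw [e] at this
  exact h'.sol_eq.1 this.1

/-- renaming the letters in coordinate `k` -/
def tw (π : Equiv.Perm (Fin 4)) (k : ι) (C : Set (ι → Fin 4)) : Set (ι → Fin 4) :=
  {x | update x k (π (x k)) ∈ C}

lemma Code.tw_mem (h : Code C) (π : Equiv.Perm (Fin 4)) {k x v} :
    update x k v ∈ tw π k C ↔ v = π.symm (sol C k x) := by
  simp only [tw, Set.mem_ofPred_eq, update_self, update_idem]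
  rw [h.sol_eq, Equiv.eq_symm_apply]

lemma Code.tw (h : Code C) (π : Equiv.Perm (Fin 4)) (k : ι) : Code (tw π k C) := by
  intro x i
  by_cases hi : i = k
  · subst hi
    exact ⟨_, (h.tw_mem π).2 rfl, fun v hv => (h.tw_mem π).1 hv⟩
  · have : ∀ v, update x i v ∈ QG.tw π k C ↔ update (update x k (π (x k))) i v ∈ C := by
      intro v
      simp only [QG.tw, Set.mem_ofPred_eq]
      rw [update_of_ne (Ne.symm hi), update_comm hi]
    simp only [this]
    exact h _ _

lemma dif_count (hk : k ∈ D) {K : Finset ι} (hK : K ⊆ D.erase k) {k0} (hk0 : k0 ∈ K)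
    (A U W : Set (Set (ι → Fin 4)))
    (H : ∀ S ∈ A, ∃ C, Code C ∧ S = sec C D y ∧ Dif C D y K ∧
      (∀ π, sec (tw π k C) (insert k K) y ∈ U) ∧ sec C (insert k0 (D \ K)) y ∈ W) :
    A.ncard * 24 ≤ U.ncard * W.ncard := by
  have hkK : k ∉ K := fun h => by simpa using hK h
  have hKD : K ⊆ D := hK.trans (Finset.erase_subset _ _)
  choose! c hc hS hd hU hW using H
  have h24 : (Set.univ : Set (Equiv.Perm (Fin 4))).ncard = 24 := by
    rw [Set.ncard_univ, Nat.card_eq_fintype_card, Fintype.card_perm]; rfl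
  rw [← h24, ← Set.ncard_prod, ← Set.ncard_prod]
  refine Set.ncard_le_ncard_of_injOn
    (fun q => (sec (tw q.2 k (c q.1)) (insert k K) y, sec (c q.1) (insert k0 (D \ K)) y))
    (fun q hq => ⟨hU _ hq.1 _, hW _ hq.1⟩) ?_ (Set.toFinite _)
  rintro ⟨S, π⟩ ⟨hS1, -⟩ ⟨S', π'⟩ ⟨hS2, -⟩ e
  simp only [Prod.mk.injEq] at e hS1 hS2
  obtain ⟨e1, e2⟩ := e
  have h := hc _ hS1
  have h' := hc _ hS2
  rw [Prod.mk.injEq, hS _ hS1, hS _ hS2]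
  have c1 := clu_of_dif h hk hkK hKD (hd _ hS1)
  have c2 := clu_of_dif h' hk hkK hKD (hd _ hS2)
  generalize c S = C at *
  generalize c S' = C' at *
  have f1 : ∀ u, Ag K y u → π.symm (sol C k u) = π'.symm (sol C' k u) := by
    intro u hu
    have : update u k (π.symm (sol C k u)) ∈ sec (tw π k C) (insert k K) y :=
      ⟨(h.tw_mem π).2 rfl, (hu.mono (Finset.subset_insert _ _)).upd (Finset.mem_insert_self _ _) _⟩
    rw [e1] at this
    exact (h'.tw_mem π').1 this.1
  have f2 : ∀ w, Ag (insert k0 (D \ K)) y w → sol C k w = sol C' k w := fun w hw =>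
    sec_sol h h' (by simp [hk, hkK]) e2 hw
  have hl : Lat (sol C k) K := h.lat hkK
  have ag0 : ∀ a, Ag (insert k0 (D \ K)) y (update y k0 a) := fun a =>
    (Ag.refl _ _).upd (Finset.mem_insert_self _ _) _
  have ag1 : ∀ a, Ag K y (update y k0 a) := fun a => (Ag.refl _ _).upd hk0 _
  have hπ : π = π' := by
    rw [← inv_inj]
    ext v
    obtain ⟨a, ha⟩ := hl.surj hk0 y v
    have := f1 _ (ag1 a)
    rw [← f2 _ (ag0 a), ha] at this
    exact congrArg Fin.val this
  subst hπ
  replace f1 : ∀ u, Ag K y u → sol C k u = sol C' k u := fun u hu => π.symm.injective (f1 u hu)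
  refine ⟨sec_ext h h' hk fun x hx => ?_, rfl⟩
  have hu : Ag K y (K.piecewise x y) := fun l hl => by simp [hl]
  obtain ⟨a, ha⟩ := hl.surj hk0 y (sol C k (K.piecewise x y))
  have hup : ∀ z, Ag K y z → Ag (D.erase k) y z := fun z hz => hz.mono hK
  have g1 := c1 _ _ x (hup _ hu) hx (hu.symm.trans (ag1 a)) ha.symm
  have g2 := c2 _ _ x (hup _ hu) hx (hu.symm.trans (ag1 a)) (by
    rw [← f1 _ hu, ← ha, f2 _ (ag0 a)])
  have e3 : K.piecewise (K.piecewise x y) x = x := by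
    funext l; by_cases hl : l ∈ K <;> simp [hl]
  rw [e3] at g1 g2
  rw [g1, g2]
  apply f2
  intro l hl
  rw [Finset.mem_insert, Finset.mem_sdiff] at hl
  push Not at hl
  by_cases hlK : l ∈ K
  · simp [hlK, hl.1]
  · have : l ∉ D := fun h => hlK (hl.2 h)
    simp only [hlK, not_false_eq_true, Finset.piecewise_eq_of_notMem]
    exact hx l (fun h => this (Finset.mem_of_mem_erase h))

lemma sep2 (a a' : Fin 4) (h : a ≠ a') : ∃ q : Fin 3, ∀ v v', v ≠ a → v ≠ a' → v' ≠ a → v' ≠ a' →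
    ps q v = ps q v' → v = v' := by
  revert a a'; decide

lemma ex4 (a a' : Fin 4) : ∃ b, b ≠ a ∧ b ≠ a' := by revert a a'; decide

lemma irr_pair (hi : i ∈ D) {a a' : Fin 4} (haa : a ≠ a') (A U W : Set (Set (ι → Fin 4)))
    (hD : 2 ≤ D.card)
    (H : ∀ S ∈ A, ∃ C, Code C ∧ S = sec C D y ∧ Irr C D y ∧ sec C (D.erase i) (update y i a) ∈ U ∧
      sec C (D.erase i) (update y i a') ∈ W) : A.ncard ≤ 2 * (U.ncard * W.ncard) := by
  classical
  obtain ⟨q, hq⟩ := sep2 a a' haa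
  choose! c hc hS hI hU hW using H
  let z : Set (ι → Fin 4) → Set (ι → Fin 4) → ι → Fin 4 := fun L L' => Classical.epsilon fun x =>
    Ag (D.erase i) y x ∧ update x i a ∉ L ∧ update x i a' ∉ L'
  have h2 : (Set.univ : Set (ZMod 2)).ncard = 2 := by
    rw [Set.ncard_univ, Nat.card_eq_fintype_card]; rfl
  rw [← h2, ← Set.ncard_prod, ← Set.ncard_prod]
  refine Set.ncard_le_ncard_of_injOn
    (fun S => (ps q (sol (c S) i (z (sec (c S) (D.erase i) (update y i a))
      (sec (c S) (D.erase i) (update y i a')))), sec (c S) (D.erase i) (update y i a),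
      sec (c S) (D.erase i) (update y i a')))
    (fun S hS => ⟨trivial, hU _ hS, hW _ hS⟩) ?_ (Set.toFinite _)
  intro S hS1 S' hS2 e
  simp only [Prod.mk.injEq] at e
  obtain ⟨e0, e1, e2⟩ := e
  rw [← e1, ← e2] at e0
  have h := hc _ hS1
  have h' := hc _ hS2
  have hirr := hI _ hS1
  rw [hS _ hS1, hS _ hS2]
  generalize c S = C at *
  generalize c S' = C' at *
  have key : ∀ {C : Set (ι → Fin 4)}, Code C → ∀ b x, Ag (D.erase i) y x →
      (update x i b ∈ sec C (D.erase i) (update y i b) ↔ sol C i x = b) := by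
    intro C h b x hx
    rw [eq_comm, ← h.sol_eq]
    refine and_iff_left ?_
    intro l hl
    by_cases hli : l = i
    · subst hli; simp
    · simp [hli, hx l hl]
  set x0 := z (sec C (D.erase i) (update y i a)) (sec C (D.erase i) (update y i a')) with hx0
  have hz : Ag (D.erase i) y x0 ∧ update x0 i a ∉ sec C (D.erase i) (update y i a) ∧
      update x0 i a' ∉ sec C (D.erase i) (update y i a') := by
    refine Classical.epsilon_spec (p := fun x => Ag (D.erase i) y x ∧
      update x i a ∉ sec C (D.erase i) (update y i a) ∧
      update x i a' ∉ sec C (D.erase i) (update y i a')) ?_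
    obtain ⟨l, hl⟩ : (D.erase i).Nonempty := by
      rw [← Finset.card_pos, Finset.card_erase_of_mem hi]; omega
    obtain ⟨b, hb, hb'⟩ : ∃ b, b ≠ a ∧ b ≠ a' := ex4 a a'
    obtain ⟨v, hv⟩ := (h.lat (V := D.erase i) (k := i) (by simp)).surj hl y b
    have hA : Ag (D.erase i) y (update y l v) := (Ag.refl _ _).upd hl _
    exact ⟨_, hA, by rw [key h _ _ hA, hv]; exact hb, by rw [key h _ _ hA, hv]; exact hb'⟩
  have hz2 := hz.2
  rw [key h _ _ hz.1, key h _ _ hz.1] at hz2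
  have hz3 := hz.2
  rw [e1, e2, key h' _ _ hz.1, key h' _ _ hz.1] at hz3
  refine sec_ext h h' hi (uniq (h.lat (by simp)) (h'.lat (by simp)) (fun p => hirr.conn h hi p) haa
    ?_ ?_ hz.1 hz2.1 hz2.2 (hq _ _ hz2.1 hz2.2 hz3.1 hz3.2 e0))
  · intro x hx
    rw [← key h _ _ hx, ← key h' _ _ hx, e1]
  · intro x hx
    rw [← key h _ _ hx, ← key h' _ _ hx, e2]

lemma irr_count (hi : i ∈ D) (hD : 4 ≤ D.card) (A : Set (Set (ι → Fin 4)))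
    (G : Fin 4 → Set (Set (ι → Fin 4))) (B : ℕ) (hG : ∀ a, (G a).ncard ≤ B)
    (H : ∀ S ∈ A, ∃ C, Code C ∧ S = sec C D y ∧ Irr C D y ∧ ∀ a,
      ¬ SemiOn C (D.erase i) (update y i a) → sec C (D.erase i) (update y i a) ∈ G a) :
    A.ncard ≤ 4 * B ^ 2 := by
  have hp : ∀ a a' : Fin 4, a ≠ a' → {S | ∃ C, Code C ∧ S = sec C D y ∧ Irr C D y ∧
      sec C (D.erase i) (update y i a) ∈ G a ∧ sec C (D.erase i) (update y i a') ∈ G a'}.ncard ≤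
      2 * (B * B) := by
    intro a a' haa
    refine (irr_pair hi haa _ (G a) (G a') (by omega) (fun S hS => hS)).trans ?_
    gcongr <;> apply hG
  have := hp 0 1 (by decide)
  have := hp 2 3 (by decide)
  refine (Set.ncard_le_ncard (t := {S | ∃ C, Code C ∧ S = sec C D y ∧ Irr C D y ∧
      sec C (D.erase i) (update y i 0) ∈ G 0 ∧ sec C (D.erase i) (update y i 1) ∈ G 1} ∪
      {S | ∃ C, Code C ∧ S = sec C D y ∧ Irr C D y ∧
      sec C (D.erase i) (update y i 2) ∈ G 2 ∧ sec C (D.erase i) (update y i 3) ∈ G 3}) ?_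
      (Set.toFinite _)).trans ((Set.ncard_union_le _ _).trans ?_)
  · intro S hS
    obtain ⟨C, h, hS, hI, hg⟩ := H S hS
    have hl : ∀ a a' : Fin 4, a ≠ a' → SemiOn C (D.erase i) (update y i a) →
      SemiOn C (D.erase i) (update y i a') → False := fun a a' haa h1 h2 => hI.layers h hD hi haa h1 h2
    by_cases h01 : SemiOn C (D.erase i) (update y i 0) ∨ SemiOn C (D.erase i) (update y i 1)
    · right
      refine ⟨C, h, hS, hI, hg 2 fun h2 => ?_, hg 3 fun h2 => ?_⟩ <;>
      · rcases h01 with h0 | h0 <;> exact hl _ _ (by decide) h0 h2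
    · push Not at h01
      exact Or.inl ⟨C, h, hS, hI, hg 0 h01.1, hg 1 h01.2⟩
  · nlinarith

end
end QG

namespace QG
open Function
set_option linter.unusedSectionVars false
set_option linter.unusedVariables false

/-- bounds for the number of semilinear sections, of the others, and of all -/
def Tb (m : ℕ) : ℕ := 2 * 3 ^ m * 2 ^ 2 ^ (m - 1)
def nb (m : ℕ) : ℕ := if m ≤ 3 then 0 else if m = 4 then 93312 else if m = 5 then 48522240 else
  if m = 6 then 50970746880 else 2 ^ (2 ^ (m - 1) - 3)
def bb (m : ℕ) : ℕ := Tb m + nb m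
def Rb (n : ℕ) : ℕ := ∑ j ∈ Finset.range n, (n - 1).choose j *
  (if 2 ≤ j ∧ j + 2 ≤ n then bb (j + 1) * bb (n - j + 1) else 0)

lemma nb_of {m : ℕ} (h : 7 ≤ m) : nb m = 2 ^ (2 ^ (m - 1) - 3) := by
  simp only [nb]
  rw [if_neg (by omega), if_neg (by omega), if_neg (by omega), if_neg (by omega)]

lemma bb_le {m : ℕ} (h : 3 ≤ m) : bb m ≤ 3 ^ (m + 2) * 2 ^ 2 ^ (m - 1) := by
  by_cases h7 : 7 ≤ m
  · rw [bb, Tb, nb_of h7]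
    have h1 : 2 ^ (2 ^ (m - 1) - 3) ≤ 2 ^ 2 ^ (m - 1) := Nat.pow_le_pow_right (by norm_num) (Nat.sub_le _ _)
    have h2 : 1 ≤ 3 ^ m := Nat.one_le_pow _ _ (by norm_num)
    rw [pow_add 3 m 2]
    generalize 2 ^ (2 ^ (m - 1) - 3) = u at *
    generalize 2 ^ 2 ^ (m - 1) = v at *
    nlinarith
  · interval_cases m <;> decide +kernel

lemma Rb_le {n : ℕ} (h : 8 ≤ n) : Rb n ≤ 2 ^ (2 ^ (n - 1) - 4) := by
  have h1 : ∀ j ∈ Finset.range n, (n - 1).choose j *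
      (if 2 ≤ j ∧ j + 2 ≤ n then bb (j + 1) * bb (n - j + 1) else 0) ≤
      (n - 1).choose j * (2 ^ (2 * n + 12) * 2 ^ (2 ^ (n - 2) + 4)) := by
    intro j hj
    gcongr
    split_ifs with hj2
    · obtain ⟨p, rfl⟩ := Nat.exists_eq_add_of_le hj2.1
      obtain ⟨q, rfl⟩ := Nat.exists_eq_add_of_le hj2.2
      have e1 : 2 + p + 2 + q - (2 + p) + 1 = q + 3 := by omega
      have e2 : 2 + p + 2 + q - 2 = p + q + 2 := by omega
      rw [e1, e2]
      calc bb (2 + p + 1) * bb (q + 3) ≤ (3 ^ (2 + p + 1 + 2) * 2 ^ 2 ^ (2 + p)) *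
            (3 ^ (q + 3 + 2) * 2 ^ 2 ^ (q + 2)) :=
          Nat.mul_le_mul (bb_le (by omega)) (bb_le (by omega))
        _ = 3 ^ (p + q + 10) * 2 ^ (2 ^ (2 + p) + 2 ^ (q + 2)) := by ring
        _ ≤ 4 ^ (p + q + 10) * 2 ^ (2 ^ (p + q + 2) + 4) := by
          refine Nat.mul_le_mul (Nat.pow_le_pow_left (by norm_num) _)
            (Nat.pow_le_pow_right (by norm_num) ?_)
          have a1 : 1 ≤ 2 ^ p := Nat.one_le_two_pow
          have a2 : 1 ≤ 2 ^ q := Nat.one_le_two_pow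
          rw [pow_add, pow_add, pow_add, pow_add]
          nlinarith
        _ = 2 ^ (2 * (2 + p + 2 + q) + 12) * 2 ^ (2 ^ (p + q + 2) + 4) := by
          rw [show (4 : ℕ) = 2 ^ 2 by norm_num, ← pow_mul]; congr 2; ring
    · exact Nat.zero_le _
  have h3 : ∀ m, 8 ≤ m → 3 * m + 19 ≤ 2 ^ (m - 2) := by
    intro m hm
    induction m, hm using Nat.le_induction with
    | base => norm_num
    | succ m hm ih =>
      have : m + 1 - 2 = (m - 2) + 1 := by omega
      rw [this, pow_succ]; omega
  refine (Finset.sum_le_sum h1).trans ?_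
  rw [← Finset.sum_mul]
  have h2 := Nat.sum_range_choose (n - 1)
  rw [show n - 1 + 1 = n by omega] at h2
  rw [h2, ← pow_add, ← pow_add]
  have h4 := h3 n h
  have h5 : 2 ^ (n - 1) = 2 * 2 ^ (n - 2) := by rw [← pow_succ']; congr 1; omega
  exact Nat.pow_le_pow_right (by norm_num) (by omega)

section
variable {ι : Type*} [DecidableEq ι] [Fintype ι]
variable {D : Finset ι} {y : ι → Fin 4} {C C' : Set (ι → Fin 4)} {k i : ι}

lemma ncard_bU {α β : Type*} [Finite α] (s : Finset β) (A : Set α) (B : β → Set α)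
    (h : ∀ x ∈ A, ∃ j ∈ s, x ∈ B j) (g : β → ℕ) (hg : ∀ j ∈ s, (B j).ncard * 24 ≤ g j) :
    A.ncard * 24 ≤ ∑ j ∈ s, g j := by
  refine le_trans ?_ (Finset.sum_le_sum hg)
  rw [← Finset.sum_mul]
  refine Nat.mul_le_mul_right _ (le_trans (Set.ncard_le_ncard ?_ (Set.toFinite _))
    (Finset.set_ncard_biUnion_le s B))
  intro x hx
  simpa using h x hx

lemma CS_card (hD : D.Nonempty) {N : ℕ} (h : (NS D y).ncard ≤ N) : (CS D y).ncard ≤ Tb D.card + N := by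
  refine le_trans (Set.ncard_le_ncard (t := SS D y ∪ NS D y) ?_ (Set.toFinite _))
    ((Set.ncard_union_le _ _).trans (Nat.add_le_add (SS_card hD y) h))
  rintro S ⟨C, hC, rfl⟩
  by_cases hs : SemiOn C D y
  · exact Or.inl ⟨C, hC, hs, rfl⟩
  · exact Or.inr ⟨C, hC, hs, rfl⟩

lemma SemiOn.tw (h : SemiOn C D y) (π : Equiv.Perm (Fin 4)) (hk : k ∈ D) : SemiOn (tw π k C) D y := by
  obtain ⟨P, c, h⟩ := h
  obtain ⟨s, e, hs⟩ := bal_perm π.injective (P k)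
  refine ⟨update P k s, c + e, fun x hx ha => ?_⟩
  have := h _ hx (ha.upd hk _)
  rw [← Finset.add_sum_erase D _ hk, sum_upd' (fun l => ps (P l)) (by simp)] at this
  rw [← Finset.add_sum_erase D _ hk]
  have e2 : ∑ l ∈ D.erase k, ps (update P k s l) (x l) = ∑ l ∈ D.erase k, ps (P l) (x l) :=
    Finset.sum_congr rfl (fun l hl => by rw [update_of_ne (Finset.ne_of_mem_erase hl)])
  rw [e2]
  simp only [update_self] at this ⊢
  have hs' := hs (x k)
  simp only at hs'
  grind

lemma RS_card (hk : k ∈ D) (hD : D.card = 6) :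
    {S | ∃ C, Code C ∧ Rp C D y k ∧ S = sec C D y}.ncard ≤ 716636160 := by
  have := ncard_bU ((D.erase k).powersetCard 3) {S | ∃ C, Code C ∧ Rp C D y k ∧ S = sec C D y}
    (fun Z => {S | ∃ C, Code C ∧ S = sec C D y ∧ Dif C D y Z ∧ SemiOn C (insert k Z) y ∧
    ∀ l ∈ Z, SemiOn C (insert l (D \ Z)) y}) ?_ (fun _ => Tb 4 * Tb 4) ?_
  · rw [Finset.sum_const, Finset.card_powersetCard, Finset.card_erase_of_mem hk, hD] at this
    have e : Nat.choose (6 - 1) 3 • (Tb 4 * Tb 4) = 716636160 * 24 := by decide +kernel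
    omega
  · rintro S ⟨C, h, ⟨Z, h1, h2, h3⟩, hS⟩
    exact ⟨Z, Finset.mem_powersetCard.2 ⟨h1, h2⟩, C, h, hS, h3⟩
  · intro Z hZ
    obtain ⟨hZ, hZ3⟩ := Finset.mem_powersetCard.1 hZ
    obtain ⟨k0, hk0⟩ : Z.Nonempty := Finset.card_pos.1 (by omega)
    have hkZ : k ∉ Z := fun h => by simpa using hZ h
    have c1 : (insert k Z).card = 4 := by rw [Finset.card_insert_of_notMem hkZ, hZ3]
    have c2 : (insert k0 (D \ Z)).card = 4 := by
      rw [Finset.card_insert_of_notMem (by simp [hk0]),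
        Finset.card_sdiff_of_subset (hZ.trans (Finset.erase_subset _ _)), hZ3, hD]
    refine (dif_count (y := y) hk hZ hk0 _ (SS (insert k Z) y) (SS (insert k0 (D \ Z)) y) ?_).trans
      (Nat.mul_le_mul ?_ ?_)
    · rintro S ⟨C, h, hS, hd, h1, h2⟩
      exact ⟨C, h, hS, hd, fun π => ⟨_, h.tw π k, h1.tw π (by simp), rfl⟩, _, h, h2 _ hk0, rfl⟩
    · exact (SS_card ⟨k, by simp⟩ y).trans (le_of_eq (by rw [c1, Tb]))
    · exact (SS_card ⟨k0, by simp⟩ y).trans (le_of_eq (by rw [c2, Tb]))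

lemma DS_card {n : ℕ} (hn : 3 ≤ n) (hD : D.card = n)
    (IH : ∀ D' : Finset ι, 3 ≤ D'.card → D'.card < n → ∀ y, (CS D' y).ncard ≤ bb D'.card) :
    {S | ∃ C, Code C ∧ S = sec C D y ∧ ∃ K ⊆ D, 2 ≤ K.card ∧ K.card + 2 ≤ D.card ∧
      Dif C D y K}.ncard * 24 ≤ Rb n := by
  obtain ⟨k, hk⟩ : D.Nonempty := Finset.card_pos.1 (by omega)
  have := ncard_bU (D.erase k).powerset {S | ∃ C, Code C ∧ S = sec C D y ∧ ∃ K ⊆ D, 2 ≤ K.card ∧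
      K.card + 2 ≤ D.card ∧ Dif C D y K}
    (fun K => {S | ∃ C, Code C ∧ S = sec C D y ∧ (2 ≤ K.card ∧ K.card + 2 ≤ D.card) ∧ Dif C D y K}) ?_
    (fun K => if 2 ≤ K.card ∧ K.card + 2 ≤ n then bb (K.card + 1) * bb (n - K.card + 1) else 0) ?_
  · rw [Finset.sum_powerset_apply_card
      (fun j => if 2 ≤ j ∧ j + 2 ≤ n then bb (j + 1) * bb (n - j + 1) else 0),
      Finset.card_erase_of_mem hk, hD, show n - 1 + 1 = n by omega] at this
    rw [hD]
    simpa only [Rb, smul_eq_mul] using this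
  · rintro S ⟨C, h, hS, K, hK, h1, h2, hd⟩
    by_cases hkK : k ∈ K
    · have := Finset.card_sdiff_of_subset hK
      refine ⟨D \ K, ?_, C, h, hS, ?_, hd.compl⟩
      · rw [Finset.mem_powerset]; intro l hl
        rw [Finset.mem_sdiff] at hl
        exact Finset.mem_erase.2 ⟨fun e => hl.2 (e ▸ hkK), hl.1⟩
      · omega
    · refine ⟨K, ?_, C, h, hS, ⟨h1, h2⟩, hd⟩
      rw [Finset.mem_powerset]; intro l hl
      exact Finset.mem_erase.2 ⟨fun e => hkK (e ▸ hl), hK hl⟩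
  · intro K hK
    rw [Finset.mem_powerset] at hK
    have hKD := hK.trans (Finset.erase_subset _ _)
    have hkK : k ∉ K := fun h => by simpa using hK h
    split_ifs with hc
    · obtain ⟨k0, hk0⟩ : K.Nonempty := Finset.card_pos.1 (by omega)
      have c1 : (insert k K).card = K.card + 1 := Finset.card_insert_of_notMem hkK
      have c2 : (insert k0 (D \ K)).card = n - K.card + 1 := by
        rw [Finset.card_insert_of_notMem (by simp [hk0]), Finset.card_sdiff_of_subset hKD, hD]
      refine (dif_count (y := y) hk hK hk0 _ (CS (insert k K) y) (CS (insert k0 (D \ K)) y) ?_).trans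
        (Nat.mul_le_mul ?_ ?_)
      · rintro S ⟨C, h, hS, -, hd⟩
        exact ⟨C, h, hS, hd, fun π => ⟨_, h.tw π k, rfl⟩, _, h, rfl⟩
      · rw [← c1]; exact IH _ (by omega) (by omega) y
      · rw [← c2]; exact IH _ (by omega) (by omega) y
    · have : {S | ∃ C, Code C ∧ S = sec C D y ∧ (2 ≤ K.card ∧ K.card + 2 ≤ D.card) ∧ Dif C D y K} = ∅ := by
        ext S
        simp only [Set.mem_ofPred_eq, Set.mem_empty_iff_false, iff_false]
        rintro ⟨C, h, hS, hc', -⟩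
        exact hc (hD ▸ hc')
      rw [this]; simp

lemma NS_card : ∀ n, 3 ≤ n → ∀ D : Finset ι, D.card = n → ∀ y, (NS D y).ncard ≤ nb n := by
  intro n
  induction n using Nat.strong_induction_on with
  | _ n ih =>
  intro hn D hD y
  have IH : ∀ D' : Finset ι, 3 ≤ D'.card → D'.card < n → ∀ y, (CS D' y).ncard ≤ bb D'.card :=
    fun D' h3 hlt y => CS_card (Finset.card_pos.1 (by omega)) (ih _ hlt h3 D' rfl y)
  have hDS := DS_card (y := y) hn hD IH
  set DS := {S | ∃ C, Code C ∧ S = sec C D y ∧ ∃ K ⊆ D, 2 ≤ K.card ∧ K.card + 2 ≤ D.card ∧ Dif C D y K}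
  let IS := {S | ∃ C, Code C ∧ S = sec C D y ∧ Irr C D y}
  have hsub : NS D y ⊆ DS ∪ IS := by
    rintro S ⟨C, h, hs, rfl⟩
    by_cases hK : ∃ K ⊆ D, 2 ≤ K.card ∧ K.card + 2 ≤ D.card ∧ Dif C D y K
    · exact Or.inl ⟨C, h, rfl, hK⟩
    · push Not at hK
      exact Or.inr ⟨C, h, rfl, hs, hK⟩
  have hle : (NS D y).ncard ≤ DS.ncard + IS.ncard :=
    (Set.ncard_le_ncard hsub (Set.toFinite _)).trans (Set.ncard_union_le _ _)
  refine hle.trans ?_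
  obtain ⟨i, hi⟩ : D.Nonempty := Finset.card_pos.1 (by omega)
  have hDi : (D.erase i).card = n - 1 := by rw [Finset.card_erase_of_mem hi, hD]
  by_cases h6 : n ≤ 6
  · have h0 : IS = ∅ := by
      ext S
      simp only [IS, Set.mem_ofPred_eq, Set.mem_empty_iff_false, iff_false]
      rintro ⟨C, h, -, hI⟩
      exact no_irr h (by omega) (by omega) hI
    rw [h0, Set.ncard_empty]
    have : Rb n ≤ 24 * nb n := by clear * - h6 hn; interval_cases n <;> decide +kernel
    omega
  by_cases h7 : n = 7
  · subst h7
    obtain ⟨k, hk⟩ : (D.erase i).Nonempty := Finset.card_pos.1 (by omega)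
    have := irr_count hi (by omega) IS (fun a => {S | ∃ C, Code C ∧ Rp C (D.erase i) (update y i a) k ∧
      S = sec C (D.erase i) (update y i a)}) 716636160 (fun a => RS_card hk hDi)
      (by
        rintro S ⟨C, h, hS, hI⟩
        exact ⟨C, h, hS, hI, fun a ha => ⟨C, h, irr7 h hI hD hi ha hk, rfl⟩⟩)
    have e : Rb 7 + 24 * (4 * 716636160 ^ 2) ≤ 24 * nb 7 := by decide +kernel
    omega
  · have := irr_count hi (by omega) IS (fun a => NS (D.erase i) (update y i a)) (nb (n - 1))
      (fun a => ih _ (by omega) (by omega) _ hDi _)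
      (by
        rintro S ⟨C, h, hS, hI⟩
        exact ⟨C, h, hS, hI, fun a ha => ⟨C, h, ha, rfl⟩⟩)
    have hR := Rb_le (n := n) (by omega)
    rw [nb_of (by omega), ← pow_mul] at this
    rw [nb_of (by omega)]
    have h5 : 2 ^ (n - 1) = 2 * 2 ^ (n - 1 - 1) := by rw [← pow_succ']; congr 1; omega
    have h6 : 2 ^ 5 ≤ 2 ^ (n - 1 - 1) := Nat.pow_le_pow_right (by norm_num) (by omega)
    have e1 : 4 * 2 ^ ((2 ^ (n - 1 - 1) - 3) * 2) = 2 ^ (2 ^ (n - 1) - 4) := by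
      rw [show (4 : ℕ) = 2 ^ 2 by norm_num, ← pow_add]; congr 1; omega
    have e2 : 2 ^ (2 ^ (n - 1) - 3) = 2 * 2 ^ (2 ^ (n - 1) - 4) := by
      rw [← pow_succ']; congr 1; omega
    rw [e1] at this
    rw [e2]
    omega

end
end QG

namespace QG
open Function
set_option linter.unusedSectionVars false
set_option linter.unusedVariables false
section
variable {ι : Type*} [DecidableEq ι] [Fintype ι]
variable {y : ι → Fin 4} {C C' : Set (ι → Fin 4)} {k i : ι}

lemma Ag_univ (y x : ι → Fin 4) : Ag Finset.univ y x := fun i hi => absurd (Finset.mem_univ i) hi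

lemma mk_code (P : ι → Fin 3) (c : ZMod 2) (β) : Code (mk k Finset.univ y P c β) := by
  intro x i
  set r1 := ∑ l ∈ Finset.univ.erase i, ps (P l) (x l) with hr1
  set r2 := ∑ l ∈ Finset.univ.erase i, ps (P l + 1) (x l) with hr2
  let b : ↥(Finset.univ.erase k) → ZMod 2 := fun l => if (l : ι) = i then c + r1 else ps (P l) (x l)
  have key : ∀ v, update x i v ∈ mk k Finset.univ y P c β ↔
      ps (P i) v = c + r1 ∧ ps (P i + 1) v = β b + r2 := by
    intro v
    have e1 : ∑ l, ps (P l) (update x i v l) = ps (P i) v + r1 := by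
      rw [← Finset.add_sum_erase _ _ (Finset.mem_univ i), sum_upd' (fun l => ps (P l)) (by simp),
        update_self]
    have e2 : ∑ l, ps (P l + 1) (update x i v l) = ps (P i + 1) v + r2 := by
      rw [← Finset.add_sum_erase _ _ (Finset.mem_univ i),
        sum_upd' (fun l => ps (P l + 1)) (by simp), update_self]
    simp only [mk, Set.mem_ofPred_eq, e1, e2, Ag_univ, true_and]
    have e3 : ps (P i) v + r1 = c ↔ ps (P i) v = c + r1 := by
      constructor <;> intro h <;> grind
    rw [e3]
    refine and_congr_right fun hv => ?_
    have e4 : (fun l : ↥(Finset.univ.erase k) => ps (P l) (update x i v l)) = b := by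
      funext l
      by_cases hl : (l : ι) = i
      · simp only [b, if_pos hl]; rw [← hv, hl]; simp
      · simp only [b, if_neg hl, update_of_ne hl]
    rw [e4]
    constructor <;> intro h <;> grind
  obtain ⟨v, h1, h2⟩ := ps_inv (P i) (c + r1) (β b + r2)
  refine ⟨v, (key v).2 ⟨h1, h2⟩, fun w hw => ?_⟩
  have := (key w).1 hw
  exact ps_ext (p1 (P i)) (this.1.trans h1.symm) (this.2.trans h2.symm)

lemma mk_inj {P : ι → Fin 3} {c : ZMod 2} {β β'} (e : mk k Finset.univ y P c β = mk k Finset.univ y P c β') :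
    β = β' := by
  funext b
  choose inv hinv hinv' using ps_inv
  have h := mk_code (k := k) (y := y) P c β
  let x : ι → Fin 4 := fun l => if h : l ∈ Finset.univ.erase k then inv (P l) (b ⟨l, h⟩) 0 else 0
  have hx := h.sol_mem k x
  set v := sol (mk k Finset.univ y P c β) k x
  have hx' := hx
  rw [e] at hx'
  have hb : (fun l : ↥(Finset.univ.erase k) => ps (P l) (update x k v l)) = b := by
    funext l
    rw [update_of_ne (Finset.ne_of_mem_erase l.2)]
    simp only [x, dif_pos l.2, hinv]
  have e1 := hx.2.2
  have e2 := hx'.2.2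
  rw [hb] at e1 e2
  exact e1.symm.trans e2

lemma two_lin (h : Code C) {P P' : ι → Fin 3} {c c' : ZMod 2} (h1 : ∀ x ∈ C, ∑ l, ps (P l) (x l) = c)
    (h2 : ∀ x ∈ C, ∑ l, ps (P' l) (x l) = c') (hne : (P, c) ≠ (P', c')) (i : ι) : P i ≠ P' i := by
  intro hi
  have hx := h.sol_mem i (fun _ => 0)
  set x := update (fun _ => (0 : Fin 4)) i (sol C i (fun _ => 0))
  by_cases hP : P = P'
  · subst hP
    exact hne (by rw [← h1 x hx, ← h2 x hx])
  obtain ⟨j, hj⟩ : ∃ j, P j ≠ P' j := by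
    by_contra hc; push Not at hc; exact hP (funext hc)
  have hij : i ≠ j := fun e => hj (e ▸ hi)
  obtain ⟨v, hv, hv'⟩ : ∃ v, ps (P j) v = ps (P j) (x j) ∧ v ≠ x j := by
    generalize P j = p; generalize x j = a; revert p a; decide
  have hw := h.sol_mem i (update x j v)
  set u := sol C i (update x j v)
  have a1 := h1 _ hw
  have a2 := h2 _ hw
  rw [sum_upd (fun l => ps (P l)) (Finset.mem_univ i), sum_upd (fun l => ps (P l)) (Finset.mem_univ j),
    h1 x hx, update_of_ne hij] at a1
  rw [sum_upd (fun l => ps (P' l)) (Finset.mem_univ i), sum_upd (fun l => ps (P' l)) (Finset.mem_univ j),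
    h2 x hx, update_of_ne hij] at a2
  have a3 := ps_sep hj hv hv'
  rw [hi] at a1
  grind

lemma two_lin_eq (h : Code C) (h' : Code C') {P P' : ι → Fin 3} {c c' : ZMod 2}
    (h1 : ∀ x ∈ C, ∑ l, ps (P l) (x l) = c) (h2 : ∀ x ∈ C, ∑ l, ps (P' l) (x l) = c')
    (h1' : ∀ x ∈ C', ∑ l, ps (P l) (x l) = c) (h2' : ∀ x ∈ C', ∑ l, ps (P' l) (x l) = c')
    (hne : (P, c) ≠ (P', c')) (k : ι) : C = C' := by
  have hk := two_lin h h1 h2 hne k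
  ext x
  rw [h.mem k, h'.mem k]
  have e1 := (h1 _ (h.sol_mem k x)).trans (h1' _ (h'.sol_mem k x)).symm
  have e2 := (h2 _ (h.sol_mem k x)).trans (h2' _ (h'.sol_mem k x)).symm
  rw [sum_upd (fun l => ps (P l)) (Finset.mem_univ k), sum_upd (fun l => ps (P l)) (Finset.mem_univ k)] at e1
  rw [sum_upd (fun l => ps (P' l)) (Finset.mem_univ k), sum_upd (fun l => ps (P' l)) (Finset.mem_univ k)] at e2
  rw [ps_ext hk (a := sol C k x) (b := sol C' k x) (by grind) (by grind)]

lemma count_low {Q B X : Type*} [Finite Q] [Finite B] [Finite X] (F : Q → B → X)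
    (hF : ∀ q b b', F q b = F q b' → b = b')
    (hc : ∀ q q' b b' b1 b1', q ≠ q' → F q b = F q' b' → F q b1 = F q' b1' → b = b1) :
    Nat.card Q * Nat.card B ≤ Nat.card X + Nat.card Q * Nat.card Q := by
  classical
  rw [← Nat.card_prod, ← Nat.card_prod, ← Nat.card_sum]
  let g : Q × B → X ⊕ (Q × Q) := fun z => if h : ∃ q', z.1 ≠ q' ∧ ∃ b', F z.1 z.2 = F q' b' then
    Sum.inr (z.1, h.choose) else Sum.inl (F z.1 z.2)
  refine Nat.card_le_card_of_injective g ?_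
  rintro ⟨q, b⟩ ⟨q1, b1⟩ e
  simp only [g] at e
  split_ifs at e with h h' h'
  · rw [Sum.inr.injEq, Prod.mk.injEq] at e
    obtain ⟨e1, e2⟩ := e
    obtain ⟨hn, b', hb'⟩ := h.choose_spec
    obtain ⟨hn1, b1', hb1'⟩ := h'.choose_spec
    rw [← e2] at hb1'
    subst e1
    rw [hc q _ b b' b1 b1' hn hb' hb1']
  · rw [Sum.inl.injEq] at e
    by_cases hq : q = q1
    · subst hq; rw [hF _ _ _ e]
    · exact absurd ⟨q1, hq, b1, e⟩ h

end

noncomputable def mc (N : ℕ) : ℕ := Nat.card {C : Set (Fin N → Fin 4) // Code C}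

lemma mc_low {N : ℕ} (hN : 1 ≤ N) : Tb N ≤ mc N + (3 ^ N * 2) * (3 ^ N * 2) := by
  let k : Fin N := ⟨0, hN⟩
  have hs : ∀ (P : Fin N → Fin 3) c β, ∀ x ∈ mk k Finset.univ (fun _ => 0) P c β,
    ∑ l, ps (P l) (x l) = c := fun P c β x hx => hx.2.1
  have := count_low (Q := (Fin N → Fin 3) × ZMod 2)
    (B := (↥((Finset.univ : Finset (Fin N)).erase k) → ZMod 2) → ZMod 2)
    (X := {C : Set (Fin N → Fin 4) // Code C})
    (fun q β => ⟨mk k Finset.univ (fun _ => 0) q.1 q.2 β, mk_code _ _ _⟩)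
    (fun q β β' e => mk_inj (Subtype.ext_iff.1 e)) (by
      intro q q' b b' b1 b1' hq e e1
      rw [Subtype.ext_iff] at e e1
      simp only at e e1
      have h2 := hs q'.1 q'.2 b'
      have h2' := hs q'.1 q'.2 b1'
      rw [← e] at h2
      rw [← e1] at h2'
      exact mk_inj (two_lin_eq (mk_code _ _ _) (mk_code _ _ _) (hs _ _ _) h2 (hs _ _ _) h2' hq k))
  have hQ : Nat.card ((Fin N → Fin 3) × ZMod 2) = 3 ^ N * 2 := by
    rw [Nat.card_eq_fintype_card]; simp [ZMod.card]
  have hB : Nat.card ((↥((Finset.univ : Finset (Fin N)).erase k) → ZMod 2) → ZMod 2) = 2 ^ 2 ^ (N - 1) := by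
    rw [Nat.card_eq_fintype_card]
    simp only [Fintype.card_fun, ZMod.card, Fintype.card_coe,
        Finset.card_erase_of_mem (Finset.mem_univ k), Finset.card_univ, Fintype.card_fin]
  rw [hQ, hB] at this
  rw [Tb, mul_comm 2]
  exact this

lemma mc_up {N : ℕ} (hN : 3 ≤ N) : mc N ≤ Tb N + nb N := by
  have hc : (Finset.univ : Finset (Fin N)).card = N := by simp
  have h1 := CS_card (ι := Fin N) (D := Finset.univ) (y := fun _ => 0)
    (Finset.card_pos.1 (by omega)) (NS_card N hN _ hc _)
  rw [hc] at h1
  refine le_trans (le_of_eq ?_) h1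
  rw [mc, ← Nat.card_coe_set_eq]
  congr 1
  apply congrArg
  ext C
  have : ∀ C : Set (Fin N → Fin 4), sec C Finset.univ (fun _ => 0) = C := fun C => by
    ext x; simp [sec, Ag_univ]
  simp [CS, this]

lemma mc_ratio {N : ℕ} (hN : 7 ≤ N) :
    |(mc N : ℝ) / (3 ^ N * 2 ^ (2 ^ (N - 1) + 1)) - 1| ≤ (1 / 3) ^ N := by
  have h1 := mc_low (N := N) (by omega)
  have h2 := mc_up (N := N) (by omega)
  rw [nb_of hN, Tb] at h2
  rw [Tb] at h1
  have h3 : ∀ m, 7 ≤ m → 4 * m + 1 ≤ 2 ^ (m - 1) := by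
    intro m hm
    induction m, hm using Nat.le_induction with
    | base => norm_num
    | succ m hm ih =>
      have : m + 1 - 1 = (m - 1) + 1 := by omega
      rw [this, pow_succ]; omega
  have h4 : 2 * (3 ^ N * 3 ^ N) ≤ 2 ^ 2 ^ (N - 1) := by
    calc 2 * (3 ^ N * 3 ^ N) ≤ 2 * (4 ^ N * 4 ^ N) := by gcongr <;> norm_num
      _ = 2 ^ (4 * N + 1) := by
        rw [show (4 : ℕ) ^ N = 2 ^ (2 * N) by rw [pow_mul]; norm_num]; ring
      _ ≤ _ := Nat.pow_le_pow_right (by norm_num) (h3 N hN)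
  have h5 : 2 ^ (2 ^ (N - 1) - 3) ≤ 2 ^ 2 ^ (N - 1) := Nat.pow_le_pow_right (by norm_num) (Nat.sub_le _ _)
  rw [pow_succ 2 (2 ^ (N - 1)), one_div, inv_pow]
  have h6 : (0 : ℝ) < 3 ^ N := by positivity
  have h7 : (0 : ℝ) < 2 ^ 2 ^ (N - 1) := by positivity
  generalize hY : 2 ^ (2 ^ (N - 1) - 3) = Y at *
  have r1 : (2 * 3 ^ N * 2 ^ 2 ^ (N - 1) : ℝ) ≤ mc N + (3 ^ N * 2) * (3 ^ N * 2) := by exact_mod_cast h1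
  have r2 : (mc N : ℝ) ≤ 2 * 3 ^ N * 2 ^ 2 ^ (N - 1) + Y := by exact_mod_cast h2
  have r4 : (2 * (3 ^ N * 3 ^ N) : ℝ) ≤ 2 ^ 2 ^ (N - 1) := by exact_mod_cast h4
  have r5 : (Y : ℝ) ≤ 2 ^ 2 ^ (N - 1) := by exact_mod_cast h5
  generalize (mc N : ℝ) = M at *
  generalize (3 : ℝ) ^ N = a at *
  generalize (2 : ℝ) ^ 2 ^ (N - 1) = v at *
  rw [div_sub_one (by positivity), abs_le, div_le_iff₀ (by positivity), le_div_iff₀ (by positivity)]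
  have e1 : a⁻¹ * (a * (v * 2)) = 2 * v := by field_simp
  have e2 : -a⁻¹ * (a * (v * 2)) = -(2 * v) := by field_simp
  rw [e1, e2]
  constructor <;> nlinarith

lemma mc_tendsto : Filter.Tendsto (fun N : ℕ => (mc N : ℝ) / (3 ^ N * 2 ^ (2 ^ (N - 1) + 1)))
    Filter.atTop (nhds 1) := by
  rw [tendsto_iff_norm_sub_tendsto_zero]
  refine squeeze_zero' (Filter.Eventually.of_forall fun _ => norm_nonneg _) ?_
    (tendsto_pow_atTop_nhds_zero_of_lt_one (r := (1 / 3 : ℝ)) (by norm_num) (by norm_num))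
  filter_upwards [Filter.eventually_ge_atTop 7] with N hN
  exact mc_ratio hN

lemma graph_code {n : ℕ} {f : (Fin n → Fin 4) → Fin 4}
    (hf : ∀ a i b, ∃! x, f (update a i x) = b) :
    Code {x : Fin (n + 1) → Fin 4 | x 0 = f (Fin.tail x)} := by
  intro x k
  simp only [Set.mem_ofPred_eq]
  refine Fin.cases ?_ (fun j => ?_) k
  · simp only [update_self, Fin.tail_update_zero]
    exact ⟨_, rfl, fun v hv => hv⟩
  · simp only [Fin.tail_update_succ, update_of_ne (Fin.succ_ne_zero j).symm]
    simpa only [eq_comm] using hf (Fin.tail x) j (x 0)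

lemma quasi_card (n : ℕ) :
    Nat.card {f : (Fin n → Fin 4) → Fin 4 // ∀ a i b, ∃! x, f (update a i x) = b} = mc (n + 1) := by
  refine Nat.card_eq_of_bijective (fun f => ⟨_, graph_code f.2⟩) ⟨?_, ?_⟩
  · rintro ⟨f, hf⟩ ⟨g, hg⟩ e
    rw [Subtype.ext_iff] at e
    ext t : 2
    have := Set.ext_iff.1 e (Fin.cons (f t) t)
    simpa using this
  · rintro ⟨C, h⟩
    refine ⟨⟨fun t => sol C 0 (Fin.cons 0 t), fun a i b => ?_⟩, ?_⟩
    · have hl : Lat (sol C 0) {i.succ} := h.lat (by simp [eq_comm, Fin.succ_ne_zero])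
      simp only [Fin.cons_update]
      obtain ⟨v, hv⟩ := hl.surj (Finset.mem_singleton_self _) (Fin.cons 0 a) b
      exact ⟨v, hv, fun w hw => hl _ (Finset.mem_singleton_self _) (Fin.cons 0 a) (hw.trans hv.symm)⟩
    · rw [Subtype.ext_iff]
      ext x
      simp only [Set.mem_ofPred_eq]
      rw [h.mem 0, sol_congr C 0 (x := Fin.cons 0 (Fin.tail x)) (x' := x)]
      intro l hl
      obtain ⟨j, rfl⟩ := Fin.exists_succ_eq.2 hl
      simp [Fin.tail]

lemma mds_iff {n : ℕ} {C : Set (Fin n → Fin 4)} :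
    (∀ x k, ({y | ∃ a, y = update x k a} ∩ C).ncard = 1) ↔ Code C := by
  refine forall₂_congr fun x k => ?_
  rw [Set.ncard_eq_one]
  constructor
  · rintro ⟨z, hz⟩
    have : z ∈ {y | ∃ a, y = update x k a} ∩ C := by rw [hz]; rfl
    obtain ⟨⟨a, rfl⟩, ha⟩ := this
    refine ⟨a, ha, fun b hb => ?_⟩
    have : update x k b ∈ {y | ∃ a, y = update x k a} ∩ C := ⟨⟨b, rfl⟩, hb⟩
    rw [hz] at this
    exact update_injective x k this
  · rintro ⟨a, ha, hu⟩
    refine ⟨update x k a, ?_⟩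
    ext z
    constructor
    · rintro ⟨⟨b, rfl⟩, hb⟩
      rw [hu b hb]; rfl
    · rintro rfl
      exact ⟨⟨a, rfl⟩, ha⟩

end QG

/-- `v_n / (3^(n+1)·2^(2^n+1)) → 1` and `m_n / (3^n·2^(2^(n−1)+1)) → 1`
as `n → ∞`, where `v_n` is the number of `n`-quasigroups of order 4 and
`m_n` the number of MDS codes in `Σ^n`. -/
theorem asymptotic_number_of_quasigroups_and_MDS_codes :
    Filter.Tendsto (fun n : ℕ =>
        (Nat.card {f : (Fin n → V4) → V4 // IsNQuasigroup f} : ℝ) /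
          (3 ^ (n + 1) * 2 ^ (2 ^ n + 1)))
      Filter.atTop (nhds 1) ∧
    Filter.Tendsto (fun n : ℕ =>
        (Nat.card {C : Set (Fin n → V4) // IsMDSCode C} : ℝ) /
          (3 ^ n * 2 ^ (2 ^ (n - 1) + 1)))
      Filter.atTop (nhds 1) := by
  refine ⟨?_, ?_⟩
  · have h := (Filter.tendsto_add_atTop_iff_nat 1).2 QG.mc_tendsto
    refine h.congr fun n => ?_
    have e : Nat.card {f : (Fin n → V4) → V4 // IsNQuasigroup f} = QG.mc (n + 1) := QG.quasi_card n
    rw [e, Nat.add_sub_cancel]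
  · refine QG.mc_tendsto.congr fun n => ?_
    have e : Nat.card {C : Set (Fin n → V4) // IsMDSCode C} = QG.mc n :=
      Nat.card_congr (Equiv.subtypeEquivRight fun C => QG.mds_iff)
    rw [e]
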